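/- For every η ∈ (0,1] there exist constants c₁' > 0 and c₂' > 0, depending only on η, with the following property. Let L ≠ ℚ be a number field, let β₁ be an exceptional real zero of ζ_L, i.e. a real zero of ζ_L in (0,1) with β₁ ≥ 1 − 1/(29.57(log d_L + n_L log 2)), and let ρ = β' + it be a nontrivial zero of ζ_L with ρ ≠ β₁ and |t| ≤ 1. Then either β' ≤ 1 − η, or β' ≤ 1 − c₂' · log( c₁' / ((1 − β₁) · log d_L) ) / log d_L. -/

import Mathlib

section
namespace DH

/-- Fejer-type positivity. -/
lemma fejer_aux (z : ℂ) (hz : ‖z‖ ≤ 1) (J : ℕ) :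
    ‖∑ j ∈ Finset.range (J+1), z ^ j‖ ^ 2 ≤
      (J : ℝ) + 1 + 2 * ∑ j ∈ Finset.range J, ((J : ℝ) - j) * (z ^ (j+1)).re := by
  induction J with
  | zero => simp
  | succ J ih =>
    have h1 : ∑ j ∈ Finset.range (J+1), (((J+1 : ℕ) : ℝ) - j) * (z ^ (j+1)).re
        = ∑ j ∈ Finset.range J, ((J : ℝ) - j) * (z ^ (j+1)).re
          + (z * ∑ j ∈ Finset.range (J+1), z ^ j).re := by
      rw [Finset.mul_sum, Complex.re_sum]
      have : ∑ j ∈ Finset.range J, ((J : ℝ) - j) * (z ^ (j+1)).re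
          = ∑ j ∈ Finset.range (J+1), ((J : ℝ) - j) * (z ^ (j+1)).re := by
        rw [Finset.sum_range_succ]; simp
      rw [this, ← Finset.sum_add_distrib]
      refine Finset.sum_congr rfl fun j _ => ?_
      push_cast
      rw [show z * z ^ j = z ^ (j+1) by ring]; ring
    have h2 : ∑ j ∈ Finset.range (J+1+1), z ^ j = 1 + z * ∑ j ∈ Finset.range (J+1), z ^ j := by
      rw [Finset.sum_range_succ', Finset.mul_sum, add_comm]
      simp [pow_succ, mul_comm]
    rw [h1, h2]
    set T := ∑ j ∈ Finset.range (J+1), z ^ j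
    have h3 : ‖1 + z * T‖ ^ 2 = 1 + 2 * (z * T).re + ‖z‖^2 * ‖T‖^2 := by
      rw [← mul_pow, ← norm_mul]
      simp only [Complex.sq_norm, Complex.normSq_apply, Complex.add_re, Complex.add_im,
        Complex.one_re, Complex.one_im]
      ring
    rw [h3]
    have h4 : ‖z‖^2 ≤ 1 := by
      have := norm_nonneg z
      nlinarith
    have h5 : ‖z‖^2 * ‖T‖^2 ≤ ‖T‖^2 := by
      have := sq_nonneg ‖T‖
      nlinarith
    push_cast
    linarith

lemma fejer (z : ℂ) (hz : ‖z‖ ≤ 1) (J : ℕ) :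
    -((J : ℝ) + 1) / 2 ≤ ∑ j ∈ Finset.range J, ((J : ℝ) - j) * (z ^ (j+1)).re := by
  have := fejer_aux z hz J
  have h2 := sq_nonneg ‖∑ j ∈ Finset.range (J+1), z ^ j‖
  linarith

lemma re_pow_mul_re_pow (w v : ℂ) (k : ℕ) :
    (w ^ k).re * (v ^ k).re = ((w * v) ^ k).re / 2 + ((w * (starRingEnd ℂ) v) ^ k).re / 2 := by
  rw [mul_pow, mul_pow, ← map_pow]
  simp only [Complex.mul_re, Complex.conj_re, Complex.conj_im]
  ring

lemma sum_weights (J : ℕ) : ∑ j ∈ Finset.range J, ((J : ℝ) - j) = (J : ℝ) * (J + 1) / 2 := by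
  induction J with
  | zero => simp
  | succ J ih =>
    rw [Finset.sum_range_succ]
    have : ∑ j ∈ Finset.range J, (((J+1 : ℕ) : ℝ) - j) = ∑ j ∈ Finset.range J, (((J : ℝ) - j) + 1) := by
      refine Finset.sum_congr rfl fun j _ => ?_
      push_cast; ring
    rw [this, Finset.sum_add_distrib, ih]
    simp
    ring

/-- Power sum inequality. -/
theorem power_sum {ι : Type*} [Fintype ι] (z : ι → ℂ) (r : ℝ) (hr : 0 < r)
    (hz : ∀ i, ‖z i‖ ≤ r) (i0 : ι) (h0 : ‖z i0‖ = r) (ε : ℕ → ℝ) (hε : ∀ k, 0 ≤ ε k)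
    (h : ∀ k, ∑ i, ((z i) ^ (k+1)).re ≤ ε k) (J : ℕ) :
    ((J : ℝ) - 3) / 4 - Fintype.card ι ≤ 2 * ∑ j ∈ Finset.range J, (r⁻¹) ^ (j+1) * ε j := by
  classical
  set w : ι → ℂ := fun i => z i / r with hw
  set v : ℂ := w i0 with hv
  have hwn : ∀ i, ‖w i‖ ≤ 1 := fun i => by
    simp only [hw, norm_div, Complex.norm_real, Real.norm_eq_abs, abs_of_pos hr]
    rw [div_le_one hr]; exact hz i
  have hvn : ‖v‖ = 1 := by
    simp only [hv, hw, norm_div, Complex.norm_real, Real.norm_eq_abs, abs_of_pos hr, h0]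
    exact div_self hr.ne'
  have hJ : (0:ℝ) < (J:ℝ) + 1 := by positivity
  -- the key functional
  set F : ℂ → ℝ := fun u => ∑ j ∈ Finset.range J, ((J : ℝ) - j) * ((u ^ (j+1)).re * (1 + (v ^ (j+1)).re))
    with hF
  have hFe : ∀ u, F u = ∑ j ∈ Finset.range J, ((J : ℝ) - j) * (u ^ (j+1)).re
      + (∑ j ∈ Finset.range J, ((J : ℝ) - j) * ((u * v) ^ (j+1)).re) / 2
      + (∑ j ∈ Finset.range J, ((J : ℝ) - j) * ((u * (starRingEnd ℂ) v) ^ (j+1)).re) / 2 := by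
    intro u
    simp only [hF]
    rw [Finset.sum_div, Finset.sum_div, ← Finset.sum_add_distrib, ← Finset.sum_add_distrib]
    refine Finset.sum_congr rfl fun j _ => ?_
    have := re_pow_mul_re_pow u v (j+1)
    rw [mul_add, this]; ring
  have hFlow : ∀ i, -((J : ℝ) + 1) ≤ F (w i) := by
    intro i
    rw [hFe]
    have a1 := fejer (w i) (hwn i) J
    have a2 := fejer (w i * v) (by rw [norm_mul, hvn, mul_one]; exact hwn i) J
    have a3 := fejer (w i * (starRingEnd ℂ) v) (by rw [norm_mul, RCLike.norm_conj, hvn, mul_one]; exact hwn i) J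
    linarith
  have hFv : ((J:ℝ)+1) * ((J:ℝ) - 3) / 4 ≤ F v := by
    rw [hFe]
    have a1 := fejer v hvn.le J
    have a2 := fejer (v * v) (by rw [norm_mul, hvn, mul_one]) J
    have a3 : v * (starRingEnd ℂ) v = 1 := by
      rw [Complex.mul_conj, Complex.normSq_eq_norm_sq, hvn]; simp
    rw [a3]
    simp only [one_pow, Complex.one_re, mul_one, sum_weights]
    nlinarith
  have hsum : ((J:ℝ)+1) * (((J : ℝ) - 3) / 4 - Fintype.card ι) ≤ ∑ i, F (w i) := by
    rw [← Finset.add_sum_erase _ _ (Finset.mem_univ i0)]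
    have : ∑ i ∈ Finset.univ.erase i0, (-((J : ℝ) + 1)) ≤ ∑ i ∈ Finset.univ.erase i0, F (w i) :=
      Finset.sum_le_sum fun i _ => hFlow i
    rw [Finset.sum_const, Finset.card_erase_of_mem (Finset.mem_univ _), Finset.card_univ,
      nsmul_eq_mul] at this
    have hc : (((Fintype.card ι - 1 : ℕ)) : ℝ) ≤ Fintype.card ι := by exact_mod_cast Nat.sub_le _ _
    have h3 : (((Fintype.card ι - 1 : ℕ)) : ℝ) * ((J:ℝ)+1) ≤ Fintype.card ι * ((J:ℝ)+1) :=
      mul_le_mul_of_nonneg_right hc hJ.le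
    have hFv' : ((J:ℝ)+1) * ((J:ℝ) - 3) / 4 ≤ F (w i0) := hFv
    nlinarith
  have hsum2 : ∑ i, F (w i) ≤ ((J:ℝ)+1) * (2 * ∑ j ∈ Finset.range J, (r⁻¹) ^ (j+1) * ε j) := by
    simp only [hF]
    rw [Finset.sum_comm]
    rw [Finset.mul_sum, Finset.mul_sum]
    refine Finset.sum_le_sum fun j hj => ?_
    have hj' : (j:ℝ) ≤ J := by exact_mod_cast (Finset.mem_range.mp hj).le
    have e1 : ∑ i, ((J : ℝ) - j) * ((w i ^ (j+1)).re * (1 + (v ^ (j+1)).re))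
        = (((J : ℝ) - j) * (1 + (v ^ (j+1)).re)) * ((r⁻¹) ^ (j+1) * ∑ i, ((z i) ^ (j+1)).re) := by
      rw [Finset.mul_sum, Finset.mul_sum]
      refine Finset.sum_congr rfl fun i _ => ?_
      have : (w i ^ (j+1)).re = (r⁻¹) ^ (j+1) * ((z i) ^ (j+1)).re := by
        simp only [hw]
        rw [div_eq_mul_inv, mul_pow, mul_comm, ← Complex.ofReal_inv, ← Complex.ofReal_pow,
          Complex.re_ofReal_mul]
      rw [this]; ring
    rw [e1]
    have hv1 : |(v ^ (j+1)).re| ≤ 1 := by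
      refine (Complex.abs_re_le_norm _).trans ?_
      rw [norm_pow, hvn, one_pow]
    have hv2 := abs_le.mp hv1
    have b1 : 0 ≤ ((J : ℝ) - j) * (1 + (v ^ (j+1)).re) :=
      mul_nonneg (by linarith) (by linarith)
    have b2 : ((J : ℝ) - j) * (1 + (v ^ (j+1)).re) ≤ ((J:ℝ)+1) * 2 := by
      apply mul_le_mul <;> linarith
    have b3 : (r⁻¹) ^ (j+1) * ∑ i, ((z i) ^ (j+1)).re ≤ (r⁻¹) ^ (j+1) * ε j :=
      mul_le_mul_of_nonneg_left (h j) (by positivity)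
    have b4 : 0 ≤ (r⁻¹) ^ (j+1) * ε j := mul_nonneg (by positivity) (hε j)
    calc _ ≤ (((J : ℝ) - j) * (1 + (v ^ (j+1)).re)) * ((r⁻¹) ^ (j+1) * ε j) :=
          mul_le_mul_of_nonneg_left b3 b1
      _ ≤ ((J:ℝ)+1) * 2 * ((r⁻¹) ^ (j+1) * ε j) := mul_le_mul_of_nonneg_right b2 b4
      _ = _ := by ring
  exact le_of_mul_le_mul_left (hsum.trans hsum2) hJ

end DH
end

section
open Metric
namespace DH

/-- One step: extraction of a zero from an entire function. -/
lemma extract_zero (h : ℂ → ℂ) (hh : Differentiable ℂ h) (a : ℂ) (ha : h a = 0) :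
    ∃ k : ℂ → ℂ, Differentiable ℂ k ∧ ∀ s, h s = (s - a) * k s := by
  refine ⟨dslope h a, ?_, fun s => ?_⟩
  · rw [← differentiableOn_univ, Complex.differentiableOn_dslope (by simp)]
    exact hh.differentiableOn
  · have := sub_smul_dslope h a s
    rw [ha, sub_zero, smul_eq_mul] at this
    exact this.symm

lemma sphere_bound (g : ℂ → ℂ) (c : ℂ) (A : ℝ) (hgc : g c ≠ 0)
    (hb : ∀ s, ‖s - c‖ = 12 → ‖g s‖ ≤ Real.exp A * ‖g c‖)
    (N : ℕ) (ρ : Fin N → ℂ) (hρ : ∀ i, ‖ρ i - c‖ ≤ 4) (h : ℂ → ℂ) (hh : Differentiable ℂ h)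
    (hf : ∀ s, g s = (∏ i, (s - ρ i)) * h s) (s : ℂ) (hs : ‖s - c‖ ≤ 12) :
    2 ^ N * ‖h s‖ ≤ Real.exp A * ‖h c‖ := by
  have hmax : ‖h s‖ ≤ Real.exp A * ‖g c‖ / 8 ^ N := by
    refine Complex.norm_le_of_forall_mem_frontier_norm_le (U := ball c 12) isBounded_ball
      hh.diffContOnCl ?_ (by rw [closure_ball _ (by norm_num)]; simpa [dist_eq_norm] using hs)
    intro z hz
    rw [frontier_ball _ (by norm_num), mem_sphere, dist_eq_norm] at hz
    rw [le_div_iff₀ (by positivity)]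
    refine le_trans ?_ (hb z hz)
    rw [hf z, norm_mul, norm_prod, mul_comm]
    refine mul_le_mul_of_nonneg_right ?_ (norm_nonneg _)
    calc (8:ℝ) ^ N = ∏ i : Fin N, (8:ℝ) := by simp
      _ ≤ _ := Finset.prod_le_prod (fun _ _ => by norm_num) fun i _ => by
        have : z - ρ i = (z - c) - (ρ i - c) := by ring
        rw [this]
        have h1 := norm_sub_norm_le (z - c) (ρ i - c)
        have h2 := hρ i
        linarith
  have hgc2 : ‖g c‖ ≤ 4 ^ N * ‖h c‖ := by
    rw [hf c, norm_mul, norm_prod]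
    refine mul_le_mul_of_nonneg_right ?_ (norm_nonneg _)
    calc _ ≤ ∏ i : Fin N, (4:ℝ) := Finset.prod_le_prod (fun _ _ => norm_nonneg _) fun i _ => by
          rw [norm_sub_rev]; exact hρ i
      _ = _ := by simp
  calc (2:ℝ) ^ N * ‖h s‖ ≤ 2 ^ N * (Real.exp A * (4 ^ N * ‖h c‖) / 8 ^ N) := by
        gcongr
        refine hmax.trans ?_
        gcongr
    _ = _ := by
        rw [show (8:ℝ) = 2 * 4 by norm_num, mul_pow]
        field_simp

lemma count_bound (g : ℂ → ℂ) (c : ℂ) (A : ℝ) (hgc : g c ≠ 0)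
    (hb : ∀ s, ‖s - c‖ = 12 → ‖g s‖ ≤ Real.exp A * ‖g c‖)
    (N : ℕ) (ρ : Fin N → ℂ) (hρ : ∀ i, ‖ρ i - c‖ ≤ 4) (h : ℂ → ℂ) (hh : Differentiable ℂ h)
    (hf : ∀ s, g s = (∏ i, (s - ρ i)) * h s) : (N : ℝ) ≤ 2 * A := by
  have h1 := sphere_bound g c A hgc hb N ρ hρ h hh hf c (by simp)
  have hc : h c ≠ 0 := fun h0 => hgc (by rw [hf c, h0, mul_zero])
  have h2 : (2:ℝ) ^ N ≤ Real.exp A := le_of_mul_le_mul_right h1 (norm_pos_iff.mpr hc)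
  have h3 := Real.log_le_log (by positivity) h2
  rw [Real.log_exp, Real.log_pow] at h3
  have := Real.log_two_gt_d9
  have hN : (0:ℝ) ≤ N := by positivity
  nlinarith

lemma exists_extraction (g : ℂ → ℂ) (hg : Differentiable ℂ g) (c : ℂ) (A : ℝ) (hgc : g c ≠ 0)
    (hb : ∀ s, ‖s - c‖ = 12 → ‖g s‖ ≤ Real.exp A * ‖g c‖) :
    ∃ (N : ℕ) (ρ : Fin N → ℂ) (h : ℂ → ℂ), (∀ i, ‖ρ i - c‖ ≤ 4) ∧ Differentiable ℂ h ∧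
      (∀ s, g s = (∏ i, (s - ρ i)) * h s) ∧ ∀ s, ‖s - c‖ ≤ 4 → h s ≠ 0 := by
  classical
  by_contra hcon
  push Not at hcon
  have key : ∀ N : ℕ, ∃ (ρ : Fin N → ℂ) (h : ℂ → ℂ), (∀ i, ‖ρ i - c‖ ≤ 4) ∧ Differentiable ℂ h ∧
      (∀ s, g s = (∏ i, (s - ρ i)) * h s) := by
    intro N
    induction N with
    | zero => exact ⟨Fin.elim0, g, fun i => i.elim0, hg, fun s => by simp⟩
    | succ N ih =>
      obtain ⟨ρ, h, h1, h2, h3⟩ := ih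
      obtain ⟨a, ha, ha0⟩ := hcon N ρ h h1 h2 h3
      obtain ⟨k, hk, hk2⟩ := extract_zero h h2 a ha0
      refine ⟨Fin.cons a ρ, k, ?_, hk, ?_⟩
      · intro i
        refine Fin.cases ?_ (fun i => ?_) i
        · simpa using ha
        · simpa using h1 i
      · intro s
        rw [Fin.prod_univ_succ]
        simp only [Fin.cons_zero, Fin.cons_succ]
        rw [h3 s, hk2 s]; ring
  obtain ⟨N, hN⟩ := exists_nat_gt (2 * A)
  obtain ⟨ρ, h, h1, h2, h3⟩ := key N
  exact absurd (count_bound g c A hgc hb N ρ h1 h h2 h3) (not_le.mpr hN)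

lemma iteratedDeriv_inv_sub (m : ℕ) (a c : ℂ) :
    iteratedDeriv m (fun s : ℂ => (s - a)⁻¹) c = (-1) ^ m * m.factorial * ((c - a)⁻¹) ^ (m+1) := by
  have := congrFun (iter_deriv_inv_linear_sub (𝕜 := ℂ) m 1 a) c
  rw [iteratedDeriv_eq_iterate]
  simp only [one_mul, one_pow, mul_one] at this
  rw [this]
  congr 1
  rw [show (-1 - (m:ℤ)) = -((m+1 : ℕ) : ℤ) by push_cast; ring, zpow_neg, zpow_natCast, inv_pow]

/-- Bound for the Taylor coefficients of the logarithmic derivative of a zero free function. -/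
lemma logDeriv_coeff (h : ℂ → ℂ) (hh : Differentiable ℂ h) (c : ℂ) (A : ℝ) (hA : 0 < A)
    (hz : ∀ s, ‖s - c‖ ≤ 4 → h s ≠ 0)
    (hb : ∀ s, ‖s - c‖ ≤ 4 → ‖h s‖ ≤ Real.exp A * ‖h c‖) (m : ℕ) :
    ‖iteratedDeriv m (fun s => deriv h s / h s) c‖ ≤
      (m+1).factorial * (18 * A) / (18/5) ^ (m+1) := by
  have hd : DifferentiableOn ℂ (fun s => deriv h s / h s) (ball c 4) := by
    intro s hs
    have hs' : ‖s - c‖ ≤ 4 := by rw [mem_ball, dist_eq_norm] at hs; exact hs.le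
    exact ((hh.deriv s).div (hh s) (hz s hs')).differentiableWithinAt
  obtain ⟨u, hu0, hu⟩ := hd.isExactOn_ball.with_val_at c 0
  have hc : h c ≠ 0 := hz c (by simp)
  -- exp u = h / h c
  have hexp : ∀ s ∈ ball c 4, Complex.exp (u s) * h c = h s := by
    have hconst : ∀ s ∈ ball c 4, h s * Complex.exp (-u s) = h c * Complex.exp (-u c) := by
      intro s hs
      refine (convex_ball c 4).is_const_of_fderivWithin_eq_zero (𝕜 := ℂ) (f := fun s => h s * Complex.exp (-u s)) ?_ ?_ hs (mem_ball_self (by norm_num))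
      · intro z hz
        exact ((hh z).mul ((hu z hz).differentiableAt.neg.cexp)).differentiableWithinAt
      · intro z hz'
        have hz'' : ‖z - c‖ ≤ 4 := by rw [mem_ball, dist_eq_norm] at hz'; exact hz'.le
        have hder : HasDerivAt (fun s => h s * Complex.exp (-u s)) 0 z := by
          have := (hh z).hasDerivAt.mul ((hu z hz').neg.cexp)
          convert! this using 1
          field_simp [hz z hz'']
          simp
        rw [fderivWithin_of_isOpen isOpen_ball hz']
        ext
        simp [hder.deriv]
    intro s hs
    have := hconst s hs
    rw [hu0, neg_zero, Complex.exp_zero, mul_one, Complex.exp_neg] at this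
    rw [← this]
    field_simp [Complex.exp_ne_zero]
  have hre : ∀ s ∈ ball c 4, (u s).re ≤ A := by
    intro s hs
    have hs' : ‖s - c‖ ≤ 4 := by rw [mem_ball, dist_eq_norm] at hs; exact hs.le
    have h1 := hb s hs'
    rw [← hexp s hs, norm_mul, Complex.norm_exp] at h1
    exact Real.exp_le_exp.mp (le_of_mul_le_mul_right h1 (norm_pos_iff.mpr hc))
  have hmem : ∀ z : ℂ, z ∈ ball (0:ℂ) 4 → c + z ∈ ball c 4 := by
    intro z hz; simpa [dist_eq_norm] using hz
  have hubound : ∀ s, ‖s - c‖ < 4 → ‖u s‖ ≤ 2 * A * ‖s - c‖ / (4 - ‖s - c‖) := by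
    intro s hs
    have := Complex.borelCaratheodory_zero (f := fun z => u (c + z)) (M := A) (R := 4) (z := s - c) hA
      (by
        intro z hz
        have h1 := (hu (c+z) (hmem z hz)).differentiableAt
        exact (h1.comp z (by fun_prop)).differentiableWithinAt)
      (fun z hz => hre _ (hmem z hz)) (by norm_num) (by simpa using hs) (by simpa using hu0)
    simpa using this
  have hit : iteratedDeriv m (fun s => deriv h s / h s) c = iteratedDeriv (m+1) u c := by
    rw [iteratedDeriv_succ']
    refine (Filter.EventuallyEq.iteratedDeriv_eq m ?_)
    filter_upwards [ball_mem_nhds c (by norm_num : (0:ℝ) < 4)] with s hs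
    exact (hu s hs).deriv.symm
  rw [hit]
  refine Complex.norm_iteratedDeriv_le_of_forall_mem_sphere_norm_le (m+1) (by norm_num) ?_ ?_
  · have : DifferentiableOn ℂ u (ball c 4) := fun s hs => (hu s hs).differentiableAt.differentiableWithinAt
    refine DifferentiableOn.diffContOnCl (this.mono ?_)
    rw [closure_ball _ (by norm_num)]
    exact closedBall_subset_ball (by norm_num)
  · intro z hz
    rw [mem_sphere, dist_eq_norm] at hz
    have := hubound z (by rw [hz]; norm_num)
    rw [hz] at this
    refine this.trans (le_of_eq ?_)
    ring

theorem local_zeros (g : ℂ → ℂ) (hg : Differentiable ℂ g) (c : ℂ) (A : ℝ) (hA : 0 < A) (hgc : g c ≠ 0)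
    (hb : ∀ s, ‖s - c‖ = 12 → ‖g s‖ ≤ Real.exp A * ‖g c‖) :
    ∃ (N : ℕ) (ρ : Fin N → ℂ), (N : ℝ) ≤ 2 * A ∧
      (∀ z, ‖z - c‖ ≤ 4 → g z = 0 → ∃ i, ρ i = z) ∧ (∀ i, ρ i ≠ c) ∧
      ∃ e : ℕ → ℂ, ∀ m : ℕ, iteratedDeriv m (fun s => deriv g s / g s) c =
        (-1) ^ m * m.factorial * (∑ i, ((c - ρ i)⁻¹) ^ (m+1) + e m) ∧
        ‖e m‖ ≤ (m+1) * (18 * A) / (18/5) ^ (m+1) := by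
  obtain ⟨N, ρ, h, h1, h2, h3, h4⟩ := exists_extraction g hg c A hgc hb
  have hρc : ∀ i, ρ i ≠ c := by
    intro i hi
    apply hgc
    rw [h3 c, Finset.prod_eq_zero (Finset.mem_univ i) (by rw [hi, sub_self]), zero_mul]
  refine ⟨N, ρ, count_bound g c A hgc hb N ρ h1 h h2 h3, ?_, hρc,
    fun m => iteratedDeriv m (fun s => deriv h s / h s) c / ((-1) ^ m * m.factorial), fun m => ⟨?_, ?_⟩⟩
  · intro z hz hgz
    rw [h3 z] at hgz
    rcases mul_eq_zero.mp hgz with h5 | h5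
    · obtain ⟨i, -, hi⟩ := Finset.prod_eq_zero_iff.mp h5
      exact ⟨i, (sub_eq_zero.mp hi).symm⟩
    · exact absurd h5 (h4 z hz)
  · have hfact : ((-1 : ℂ)) ^ m * m.factorial ≠ 0 := by
      apply mul_ne_zero
      · exact pow_ne_zero _ (by norm_num)
      · exact_mod_cast Nat.factorial_ne_zero m
    have heq : (fun s => deriv g s / g s) =ᶠ[nhds c]
        (fun s => (∑ i, (s - ρ i)⁻¹) + deriv h s / h s) := by
      have hne : ∀ᶠ s in nhds c, g s ≠ 0 := hg.continuous.continuousAt.eventually_ne hgc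
      filter_upwards [hne] with s hs
      rw [h3 s] at hs
      have hp := left_ne_zero_of_mul hs
      have hhs := right_ne_zero_of_mul hs
      have e1 : deriv g s / g s = logDeriv (fun s => (∏ i, (s - ρ i)) * h s) s := by
        rw [logDeriv_apply, ← show g = (fun s => (∏ i, (s - ρ i)) * h s) from funext h3]
        congr 1
        exact h3 s
      have hpi : ∀ i ∈ Finset.univ, s - ρ i ≠ 0 := fun i hi => Finset.prod_ne_zero_iff.mp hp i hi
      rw [e1, logDeriv_mul s hp hhs (by fun_prop) (h2 s), logDeriv_prod (f := fun i s => s - ρ i) hpi (fun i _ => by fun_prop)]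
      simp [logDeriv_apply]
    have hcd : ∀ i, ContDiffAt ℂ m (fun s => (s - ρ i)⁻¹) c := fun i =>
      (contDiffAt_id.sub contDiffAt_const).inv (sub_ne_zero.mpr (hρc i).symm)
    have hcd2 : ContDiffAt ℂ m (fun s => deriv h s / h s) c := by
      have : AnalyticAt ℂ (fun s => deriv h s / h s) c :=
        (h2.analyticAt c).deriv.div (h2.analyticAt c) (h4 c (by simp))
      exact this.contDiffAt
    rw [heq.iteratedDeriv_eq]
    rw [show (fun s => (∑ i, (s - ρ i)⁻¹) + deriv h s / h s) = (fun s => ∑ i, (s - ρ i)⁻¹) + (fun s => deriv h s / h s) from rfl,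
      iteratedDeriv_add (ContDiffAt.sum fun i _ => hcd i) hcd2, iteratedDeriv_fun_sum (fun i _ => hcd i)]
    simp_rw [iteratedDeriv_inv_sub]
    rw [mul_add, mul_div_cancel₀ _ hfact, Finset.mul_sum]
  · have hs := fun s hs => sphere_bound g c A hgc hb N ρ h1 h h2 h3 s hs
    have hb' : ∀ s, ‖s - c‖ ≤ 4 → ‖h s‖ ≤ Real.exp A * ‖h c‖ := by
      intro s hs4
      have := hs s (hs4.trans (by norm_num))
      have h2N : (1:ℝ) ≤ 2 ^ N := one_le_pow₀ (by norm_num)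
      nlinarith [norm_nonneg (h s)]
    have := logDeriv_coeff h h2 c A hA h4 hb' m
    rw [norm_div, norm_mul, norm_pow, norm_neg, norm_one, one_pow, one_mul, Complex.norm_natCast,
      div_le_iff₀ (by exact_mod_cast Nat.factorial_pos m)]
    refine this.trans (le_of_eq ?_)
    rw [Nat.factorial_succ]; push_cast; ring

end DH
end

section
namespace DH

lemma pow_sub_pow_bound (a b : ℂ) (ha : ‖a‖ ≤ 1) (hb : ‖b‖ ≤ 1) (k : ℕ) :
    ‖a ^ k - b ^ k‖ ≤ k * ‖a - b‖ := by
  induction k with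
  | zero => simp
  | succ k ih =>
    have : a ^ (k+1) - b ^ (k+1) = a ^ k * (a - b) + (a ^ k - b ^ k) * b := by ring
    rw [this]
    refine (norm_add_le _ _).trans ?_
    rw [norm_mul, norm_mul, norm_pow]
    have h1 : ‖a‖ ^ k ≤ 1 := pow_le_one₀ (norm_nonneg _) ha
    push_cast
    nlinarith [norm_nonneg (a - b), norm_nonneg (a^k - b^k), mul_le_mul_of_nonneg_right h1 (norm_nonneg (a-b)), mul_le_mul_of_nonneg_left hb (norm_nonneg (a^k - b^k))]

lemma logMul_iterate (Λ : ℕ → ℝ) (k n : ℕ) :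
    (LSeries.logMul^[k] (fun n => (Λ n : ℂ))) n = (((Real.log n) ^ k * Λ n : ℝ) : ℂ) := by
  induction k generalizing n with
  | zero => simp
  | succ k ih =>
    rw [Function.iterate_succ_apply']
    simp only [LSeries.logMul]
    rw [ih]
    rw [← Complex.natCast_log]
    push_cast; ring

lemma LSeries_pos (a : ℕ → ℝ) (ha : ∀ n, 0 ≤ a n) (t : ℝ)
    (hs : LSeriesSummable (fun n => (a n : ℂ)) 2) :
    0 ≤ (LSeries (fun n => (a n : ℂ)) 2).re + (LSeries (fun n => (a n : ℂ)) (2 + t * Complex.I)).re := by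
  have h1 : ‖LSeries (fun n => (a n : ℂ)) (2 + t * Complex.I)‖ ≤ (LSeries (fun n => (a n : ℂ)) 2).re := by
    rw [LSeries, LSeries]
    have hs' : Summable (fun n => LSeries.term (fun n => (a n : ℂ)) 2 n) := hs
    have e1 : ∀ n, ‖LSeries.term (fun n => (a n : ℂ)) (2 + t * Complex.I) n‖ = (LSeries.term (fun n => (a n : ℂ)) 2 n).re := by
      intro n
      rw [LSeries.norm_term_eq]
      rcases eq_or_ne n 0 with rfl | hn
      · simp
      · rw [if_neg hn, LSeries.term_of_ne_zero hn]
        have : ((n:ℂ) ^ (2:ℂ)) = (((n:ℝ)^2 : ℝ) : ℂ) := by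
          rw [show (2:ℂ) = ((2:ℕ):ℂ) by norm_num, Complex.cpow_natCast]; push_cast; ring
        rw [this, ← Complex.ofReal_div, Complex.ofReal_re]
        simp [abs_of_nonneg (ha n)]
    have hs2 : Summable (fun n => (LSeries.term (fun n => (a n : ℂ)) 2 n).re) := by
      exact (Complex.hasSum_re hs'.hasSum).summable
    rw [Complex.re_tsum hs']
    refine tsum_of_norm_bounded hs2.hasSum (fun n => (e1 n).le)
  have := Complex.abs_re_le_norm (LSeries (fun n => (a n : ℂ)) (2 + t * Complex.I))
  have := neg_abs_le (LSeries (fun n => (a n : ℂ)) (2 + t * Complex.I)).re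
  linarith

lemma center (g : ℂ → ℂ) (hg : Differentiable ℂ g) (Λ : ℕ → ℝ)
    (hab : LSeries.abscissaOfAbsConv (fun n => (Λ n : ℂ)) ≤ 1)
    (hlog : ∀ s : ℂ, 1 < s.re → deriv g s / g s = (s - 1)⁻¹ - LSeries (fun n => (Λ n : ℂ)) s)
    (A : ℝ) (hA : 0 < A) (t : ℝ) (ht : |t| ≤ 1) (c : ℂ) (hc : c = 2 + t * Complex.I) (hgc : g c ≠ 0)
    (hb : ∀ s, ‖s - c‖ = 12 → ‖g s‖ ≤ Real.exp A * ‖g c‖)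
    (β₁ : ℝ) (hβ0 : 0 < β₁) (hβ1 : β₁ < 1) (hgβ : g β₁ = 0) :
    ∃ (κ : Type) (_ : Fintype κ) (z : κ → ℂ), (Fintype.card κ : ℝ) ≤ 2 * A ∧
      (∀ ρ : ℂ, ‖ρ - c‖ ≤ 4 → g ρ = 0 → ρ ≠ β₁ → ∃ i, z i = (c - ρ)⁻¹) ∧
      ∀ k : ℕ, ‖∑ i, (z i) ^ (k+1) + LSeries (LSeries.logMul^[k] (fun n => (Λ n : ℂ))) c / k.factorial‖
        ≤ (k+1) * (1 - β₁) + (k+1) * (18 * A) / (18/5) ^ (k+1) := by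
  obtain ⟨N, ρ, hN, hz, hρc, e, he⟩ := local_zeros g hg c A hA hgc hb
  have hcre : c.re = 2 := by simp [hc]
  have hcim : c.im = t := by simp [hc]
  have hd : ‖(β₁ : ℂ) - c‖ ≤ 4 := by
    refine (Complex.norm_le_abs_re_add_abs_im _).trans ?_
    simp only [Complex.sub_re, Complex.sub_im, hcre, hcim, Complex.ofReal_re, Complex.ofReal_im]
    rw [abs_of_nonpos (by linarith), zero_sub, abs_neg]
    linarith
  obtain ⟨i1, hi1⟩ := hz β₁ hd hgβ
  refine ⟨{i : Fin N // i ≠ i1}, inferInstance, fun i => (c - ρ i)⁻¹, ?_, ?_, ?_⟩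
  · refine le_trans ?_ hN
    have := Fintype.card_subtype_le (fun i : Fin N => i ≠ i1)
    rw [Fintype.card_fin] at this
    exact_mod_cast this
  · intro w hw hgw hne
    obtain ⟨i, hi⟩ := hz w hw hgw
    refine ⟨⟨i, ?_⟩, by simp [hi]⟩
    rintro rfl
    exact hne (hi ▸ hi1)
  · intro k
    obtain ⟨he1, he2⟩ := he k
    have hab' : LSeries.abscissaOfAbsConv (fun n => (Λ n : ℂ)) < c.re := by
      refine lt_of_le_of_lt hab ?_
      rw [hcre]; exact_mod_cast (by norm_num : (1:ℝ) < 2)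
    have heq : (fun s => deriv g s / g s) =ᶠ[nhds c] ((fun s => (s - 1)⁻¹) - LSeries (fun n => (Λ n : ℂ))) := by
      have : ∀ᶠ s in nhds c, 1 < s.re := Complex.continuous_re.continuousAt.eventually_const_lt (by rw [hcre]; norm_num)
      filter_upwards [this] with s hs
      simpa using hlog s hs
    have hc1 : c - 1 ≠ 0 := by
      intro h
      have := congrArg Complex.re h
      simp [hcre] at this
      norm_num at this
    have hcd1 : ContDiffAt ℂ k (fun s : ℂ => (s - 1)⁻¹) c :=
      (contDiffAt_id.sub contDiffAt_const).inv hc1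
    have hcd2 : ContDiffAt ℂ k (LSeries (fun n => (Λ n : ℂ))) c :=
      ((LSeries_analyticOnNhd _) c hab').contDiffAt
    rw [heq.iteratedDeriv_eq, iteratedDeriv_sub hcd1 hcd2, iteratedDeriv_inv_sub, LSeries_iteratedDeriv k hab'] at he1
    have hsum : ∑ i, ((c - ρ i)⁻¹) ^ (k+1) = ((c - β₁)⁻¹) ^ (k+1) + ∑ i : {i : Fin N // i ≠ i1}, ((c - ρ i)⁻¹) ^ (k+1) := by
      rw [← hi1]
      exact Fintype.sum_eq_add_sum_subtype_ne _ i1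
    rw [hsum] at he1
    set S := ∑ i : {i : Fin N // i ≠ i1}, ((c - ρ i)⁻¹) ^ (k+1)
    set Y := LSeries (LSeries.logMul^[k] (fun n => (Λ n : ℂ))) c
    have hk : (k.factorial : ℂ) ≠ 0 := by exact_mod_cast Nat.factorial_ne_zero k
    have h1 : ((-1:ℂ))^k ≠ 0 := pow_ne_zero _ (by norm_num)
    have key : S + Y / k.factorial = (((c - 1)⁻¹) ^ (k+1) - ((c - β₁)⁻¹) ^ (k+1)) - e k := by
      have h2 : (-1:ℂ)^k * (k.factorial * ((c - 1)⁻¹) ^ (k+1) - Y - k.factorial * (((c - β₁)⁻¹) ^ (k+1) + S + e k)) = 0 := by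
        linear_combination he1
      have h3 := (mul_eq_zero.mp h2).resolve_left h1
      field_simp at h3 ⊢
      linear_combination -h3
    rw [key]
    refine (norm_sub_le _ _).trans (add_le_add ?_ he2)
    have hn1 : 1 ≤ ‖c - 1‖ := by
      have := Complex.re_le_norm (c - 1); simp [hcre] at this; linarith
    have hn2 : 1 ≤ ‖c - β₁‖ := by
      have := Complex.re_le_norm (c - β₁); simp [hcre] at this; linarith
    have hcb : c - β₁ ≠ 0 := by
      intro h; rw [h, norm_zero] at hn2; linarith
    refine (pow_sub_pow_bound _ _ ?_ ?_ _).trans ?_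
    · rw [norm_inv]; exact inv_le_one_of_one_le₀ hn1
    · rw [norm_inv]; exact inv_le_one_of_one_le₀ hn2
    · push_cast
      apply mul_le_mul_of_nonneg_left _ (by positivity)
      have : (c - 1)⁻¹ - (c - β₁)⁻¹ = ((1 - β₁ : ℝ) : ℂ) * ((c-1)⁻¹ * (c - β₁)⁻¹) := by
        push_cast; field_simp; ring
      rw [this, norm_mul, norm_mul, norm_inv, norm_inv, Complex.norm_real, Real.norm_of_nonneg (by linarith)]
      have a1 := inv_le_one_of_one_le₀ hn1
      have a2 := inv_le_one_of_one_le₀ hn2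
      have : ‖c - 1‖⁻¹ * ‖c - β₁‖⁻¹ ≤ 1 := mul_le_one₀ a1 (by positivity) a2
      nlinarith

lemma geom_bound (J : ℕ) : ∑ j ∈ Finset.range J, ((j:ℝ)+1) * (5/9) ^ (j+1) ≤ 3 := by
  have : ∀ J : ℕ, ∑ j ∈ Finset.range J, ((j:ℝ)+1) * (5/9) ^ (j+1) = 45/16 - (45/16 + (5/4) * J) * (5/9)^J := by
    intro J
    induction J with
    | zero => simp
    | succ J ih => rw [Finset.sum_range_succ, ih]; push_cast; ring
  rw [this]
  have : 0 ≤ (45/16 + (5/4) * (J:ℝ)) * (5/9)^J := by positivity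
  linarith

theorem abstract_DH (g : ℂ → ℂ) (hg : Differentiable ℂ g) (Λ : ℕ → ℝ) (hΛ : ∀ n, 0 ≤ Λ n)
    (hab : LSeries.abscissaOfAbsConv (fun n => (Λ n : ℂ)) ≤ 1)
    (hlog : ∀ s : ℂ, 1 < s.re → deriv g s / g s = (s - 1)⁻¹ - LSeries (fun n => (Λ n : ℂ)) s)
    (A : ℝ) (hA : 0 < A)
    (hgc : ∀ t : ℝ, |t| ≤ 1 → g (2 + t * Complex.I) ≠ 0)
    (hb : ∀ t : ℝ, |t| ≤ 1 → ∀ s, ‖s - (2 + t * Complex.I)‖ = 12 → ‖g s‖ ≤ Real.exp A * ‖g (2 + t * Complex.I)‖)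
    (β₁ : ℝ) (hβ0 : 0 < β₁) (hβ1 : β₁ < 1) (hgβ : g β₁ = 0)
    (ρ : ℂ) (hρ0 : 0 < ρ.re) (hρ1 : ρ.re < 1) (hgρ : g ρ = 0) (hne : ρ ≠ β₁) (hρt : |ρ.im| ≤ 1) (J : ℕ) :
    ((J : ℝ) - 3) / 4 - 220 * A ≤ 4 * (1 - β₁) * J ^ 2 * (2 - ρ.re) ^ J := by
  have hg2 : g 2 ≠ 0 := by simpa using hgc 0 (by simp)
  have hb2 : ∀ s, ‖s - 2‖ = 12 → ‖g s‖ ≤ Real.exp A * ‖g 2‖ := by simpa using hb 0 (by simp)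
  obtain ⟨κ, _, z, hκ, hz, hs⟩ := center g hg Λ hab hlog A hA 0 (by simp) 2 (by simp) hg2 hb2 β₁ hβ0 hβ1 hgβ
  obtain ⟨κ', _, z', hκ', hz', hs'⟩ := center g hg Λ hab hlog A hA ρ.im hρt _ rfl (hgc _ hρt) (hb _ hρt) β₁ hβ0 hβ1 hgβ
  have hcρ : (2 + ρ.im * Complex.I) - ρ = ((2 - ρ.re : ℝ) : ℂ) := by
    apply Complex.ext <;> simp
  obtain ⟨i', hi'⟩ := hz' ρ (by
    rw [← norm_neg, neg_sub, hcρ, Complex.norm_real, Real.norm_of_nonneg (by linarith)]; linarith) hgρ hne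
  rw [hcρ] at hi'
  let Z : κ ⊕ κ' → ℂ := Sum.elim z z'
  have : Nonempty (κ ⊕ κ') := ⟨Sum.inr i'⟩
  obtain ⟨i0, hi0⟩ := Finite.exists_max (fun i => ‖Z i‖)
  have hr : (2 - ρ.re)⁻¹ ≤ ‖Z i0‖ := by
    refine le_trans ?_ (hi0 (Sum.inr i'))
    show _ ≤ ‖z' i'‖
    rw [hi', norm_inv, Complex.norm_real, Real.norm_of_nonneg (by linarith)]
  have hr0 : 0 < ‖Z i0‖ := lt_of_lt_of_le (inv_pos.mpr (by linarith)) hr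
  have hrinv : ‖Z i0‖⁻¹ ≤ 2 - ρ.re := inv_le_of_inv_le₀ (by linarith) hr
  set ε : ℕ → ℝ := fun k => 2 * ((k+1) * (1 - β₁) + (k+1) * (18 * A) / (18/5) ^ (k+1)) with hε
  have hε0 : ∀ k, 0 ≤ ε k := fun k => by
    have : 0 < 1 - β₁ := by linarith
    simp only [hε]; positivity
  have hre : ∀ k, ∑ i, ((Z i) ^ (k+1)).re ≤ ε k := by
    intro k
    have e1 : ∑ i, ((Z i) ^ (k+1)).re = (∑ i, (z i)^(k+1)).re + (∑ i, (z' i)^(k+1)).re := by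
      rw [Fintype.sum_sum_type, Complex.re_sum, Complex.re_sum]; rfl
    have p1 := (Complex.re_le_norm _).trans (hs k)
    have p2 := (Complex.re_le_norm _).trans (hs' k)
    have e2 : (LSeries.logMul^[k] (fun n => (Λ n : ℂ))) = fun n : ℕ => (((Real.log n) ^ k * Λ n : ℝ) : ℂ) :=
      funext fun n => logMul_iterate Λ k n
    have hsum : LSeriesSummable (LSeries.logMul^[k] (fun n => (Λ n : ℂ))) 2 := by
      apply LSeriesSummable_of_abscissaOfAbsConv_lt_re
      rw [LSeries.absicssaOfAbsConv_logPowMul]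
      exact lt_of_le_of_lt hab (by simp; exact_mod_cast (by norm_num : (1:ℝ) < 2))
    rw [e2] at hsum p1 p2
    have p3 := LSeries_pos (fun n : ℕ => (Real.log n) ^ k * Λ n) (fun n => mul_nonneg (pow_nonneg (Real.log_natCast_nonneg n) k) (hΛ n)) ρ.im hsum
    rw [Complex.add_re, Complex.div_natCast_re] at p1 p2
    have p4 : 0 ≤ ((LSeries (fun n : ℕ => (((Real.log n) ^ k * Λ n : ℝ) : ℂ)) 2).re) / k.factorial + ((LSeries (fun n : ℕ => (((Real.log n) ^ k * Λ n : ℝ) : ℂ)) (2 + ρ.im * Complex.I)).re) / k.factorial := by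
      rw [← add_div]; positivity
    rw [e1]
    simp only [hε]
    linarith
  have main := power_sum Z ‖Z i0‖ hr0 hi0 i0 rfl ε hε0 hre J
  have hcard : (Fintype.card (κ ⊕ κ') : ℝ) ≤ 4 * A := by
    rw [Fintype.card_sum]; push_cast; linarith
  have hsumle : ∑ j ∈ Finset.range J, (‖Z i0‖⁻¹) ^ (j+1) * ε j ≤
      2 * (1 - β₁) * J ^ 2 * (2 - ρ.re) ^ J + 108 * A := by
    have t1 : ∀ j ∈ Finset.range J, (‖Z i0‖⁻¹) ^ (j+1) * ε j ≤
        2 * (1 - β₁) * J * (2 - ρ.re) ^ J + 36 * A * (((j:ℝ)+1) * (5/9) ^ (j+1)) := by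
      intro j hj
      have hj' : j + 1 ≤ J := Finset.mem_range.mp hj
      have hjr : (j:ℝ) + 1 ≤ J := by exact_mod_cast hj'
      have q0 : (‖Z i0‖⁻¹) ^ (j+1) ≤ (2 - ρ.re) ^ (j+1) := by gcongr
      have q1 : (2 - ρ.re) ^ (j+1) ≤ (2 - ρ.re) ^ J := pow_le_pow_right₀ (by linarith) hj'
      have q2 : (‖Z i0‖⁻¹) ^ (j+1) ≤ 2 ^ (j+1) := by gcongr; linarith
      have q3 : (5/9 : ℝ)^(j+1) = 2 ^ (j+1) / (18/5) ^ (j+1) := by rw [← div_pow]; norm_num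
      have hb : 0 < 1 - β₁ := by linarith
      have u1 : (‖Z i0‖⁻¹) ^ (j+1) * (2 * ((j+1) * (1 - β₁))) ≤ (2 - ρ.re) ^ J * (2 * (J * (1 - β₁))) := by
        gcongr
        · exact pow_nonneg (by linarith) _
        · linarith
      have u2 : (‖Z i0‖⁻¹) ^ (j+1) * (36 * A * (j+1) / (18/5)^(j+1)) ≤ 2 ^ (j+1) * (36 * A * (j+1) / (18/5)^(j+1)) := by
        gcongr
      rw [q3]
      calc _ = (‖Z i0‖⁻¹) ^ (j+1) * (2 * ((j+1) * (1 - β₁))) + (‖Z i0‖⁻¹) ^ (j+1) * (36 * A * (j+1) / (18/5)^(j+1)) := by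
            simp only [hε]; ring
        _ ≤ _ := add_le_add u1 u2
        _ = _ := by ring
    refine (Finset.sum_le_sum t1).trans ?_
    rw [Finset.sum_add_distrib, Finset.sum_const, Finset.card_range, nsmul_eq_mul, ← Finset.mul_sum]
    have := geom_bound J
    have h36 := mul_le_mul_of_nonneg_left this (by positivity : (0:ℝ) ≤ 36 * A)
    nlinarith
  linarith

/-- Numeric conclusion: choose `J`. -/
theorem numeric_DH (C : ℝ) (hC : 1 ≤ C) : ∃ c₁ > 0, ∃ c₂ > 0, ∀ (l δ x : ℝ), 1 ≤ l → 0 < δ → 0 < x → 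
    (∀ J : ℕ, ((J : ℝ) - 3) / 4 - 220 * (C * l) ≤ 4 * δ * J ^ 2 * (1 + x) ^ J) →
    c₂ * Real.log (c₁ / (δ * l)) / l ≤ x := by
  refine ⟨1 / (4 * 2000 ^ 2 * C), by positivity, 1 / (2000 * C), by positivity, fun l δ x hl hδ hx h => ?_⟩
  have hCl : 1 ≤ C * l := by nlinarith
  set J := ⌊2000 * (C * l)⌋₊ with hJ
  have hJ1 : (J:ℝ) ≤ 2000 * (C * l) := Nat.floor_le (by positivity)
  have hJ2 : 2000 * (C * l) < J + 1 := Nat.lt_floor_add_one _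
  have h1 := h J
  have h2 : (1 + x) ^ J ≤ Real.exp (x * (2000 * (C * l))) := by
    calc (1 + x) ^ J ≤ (Real.exp x) ^ J := by
          gcongr; linarith [Real.add_one_le_exp x]
      _ = Real.exp (J * x) := (Real.exp_nat_mul x J).symm
      _ ≤ _ := by apply Real.exp_le_exp.mpr; nlinarith
  have hE := Real.exp_pos (x * (2000 * (C * l)))
  have h3 : C * l ≤ 4 * δ * (2000 * (C * l)) ^ 2 * Real.exp (x * (2000 * (C * l))) := by
    have h4 : 4 * δ * J ^ 2 * (1 + x) ^ J ≤ 4 * δ * (2000 * (C * l)) ^ 2 * Real.exp (x * (2000 * (C * l))) := by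
      gcongr
    linarith
  have h5 : 1 / (4 * 2000 ^ 2 * C) / (δ * l) ≤ Real.exp (x * (2000 * (C * l))) := by
    rw [div_div, div_le_iff₀ (by positivity)]
    have : C * l * 1 ≤ C * l * (Real.exp (x * (2000 * (C * l))) * (4 * 2000 ^ 2 * C * (δ * l))) := by
      nlinarith
    exact le_of_mul_le_mul_left this (by positivity)
  have h6 : Real.log (1 / (4 * 2000 ^ 2 * C) / (δ * l)) ≤ x * (2000 * (C * l)) := by
    rw [← Real.log_exp (x * (2000 * (C * l)))]
    exact Real.log_le_log (by positivity) h5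
  rw [div_le_iff₀ (by positivity), one_div, inv_mul_le_iff₀ (by positivity)]
  linarith

end DH
end

section
namespace DH

open Finsupp in
/-- splitting off one coordinate of a finitely supported function. -/
noncomputable def splitEquiv {P : Type*} [DecidableEq P] (a : P) (S : Finset P) (ha : a ∉ S) :
    ℕ × {f : P →₀ ℕ // f.support ⊆ S} ≃ {f : P →₀ ℕ // f.support ⊆ insert a S} where
  toFun q := ⟨single a q.1 + q.2.1, by
    refine Finsupp.support_add.trans ?_
    refine Finset.union_subset ?_ (q.2.2.trans (Finset.subset_insert _ _))
    exact Finsupp.support_single_subset.trans (by simp)⟩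
  invFun f := (f.1 a, ⟨f.1.erase a, by
    rw [Finsupp.support_erase]
    intro b hb
    rw [Finset.mem_erase] at hb
    exact (Finset.mem_insert.mp (f.2 hb.2)).resolve_left hb.1⟩)
  left_inv := by
    rintro ⟨k, f, hf⟩
    have hfa : f a = 0 := by
      by_contra h
      exact ha (hf (Finsupp.mem_support_iff.mpr h))
    refine Prod.ext (by simp [hfa]) (Subtype.ext ?_)
    simp only
    ext b
    by_cases hb : b = a
    · subst hb; simp [hfa]
    · simp [Finsupp.erase_ne hb]
  right_inv := by
    rintro ⟨f, hf⟩
    exact Subtype.ext (Finsupp.single_add_erase a f)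

/-- the monomial attached to a finitely supported exponent function -/
noncomputable def mon {P R : Type*} [CommSemiring R] (x : P → R) (f : P →₀ ℕ) : R := f.prod fun p k => x p ^ k

lemma mon_norm {P : Type*} (x : P → ℂ) (f : P →₀ ℕ) : ‖mon x f‖ = mon (fun p => ‖x p‖) f := by
  simp [mon, Finsupp.prod, norm_prod]

lemma mon_add {P R : Type*} [CommSemiring R] (x : P → R) (f g : P →₀ ℕ) : mon x (f + g) = mon x f * mon x g := by
  classical
  exact Finsupp.prod_add_index' (by simp) (fun p a b => pow_add _ _ _)

lemma mon_single {P R : Type*} [CommSemiring R] (x : P → R) (p : P) (k : ℕ) : mon x (Finsupp.single p k) = x p ^ k := by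
  simp [mon]

lemma finite_euler {P : Type*} [DecidableEq P] (x : P → ℂ) (h1 : ∀ p, ‖x p‖ < 1) (S : Finset P) :
    Summable (fun f : {f : P →₀ ℕ // f.support ⊆ S} => ‖mon x f.1‖) ∧
    HasSum (fun f : {f : P →₀ ℕ // f.support ⊆ S} => mon x f.1) (∏ p ∈ S, (1 - x p)⁻¹) := by
  induction S using Finset.induction_on with
  | empty =>
    have : Unique {f : P →₀ ℕ // f.support ⊆ ∅} :=
      { default := ⟨0, by simp⟩
        uniq := by rintro ⟨f, hf⟩; apply Subtype.ext; simpa using hf }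
    refine ⟨(hasSum_fintype _).summable, ?_⟩
    convert hasSum_fintype _ using 1
    rw [Fintype.sum_unique]
    have e : (default : {f : P →₀ ℕ // f.support ⊆ ∅}).1 = 0 := by
      have := (default : {f : P →₀ ℕ // f.support ⊆ ∅}).2
      simpa using this
    rw [e]; simp [mon]
  | insert a S ha ih =>
    have hg := summable_geometric_of_lt_one (norm_nonneg (x a)) (h1 a)
    have hg' : Summable (fun k : ℕ => ‖x a ^ k‖) := by simpa [norm_pow] using hg
    have hmul := summable_mul_of_summable_norm hg' ih.1
    have hmul' := (Summable.mul_norm hg' ih.1)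
    rw [Finset.prod_insert ha]
    have e : ∀ q, mon x ((splitEquiv a S ha q).1) = x a ^ q.1 * mon x q.2.1 := by
      intro q
      simp only [splitEquiv, Equiv.coe_fn_mk]
      rw [mon_add, mon_single]
    constructor
    · rw [← (splitEquiv a S ha).summable_iff]
      refine hmul'.congr (fun q => ?_)
      simp only [Function.comp]; rw [e]
    · rw [← (splitEquiv a S ha).hasSum_iff]
      have := (hasSum_geometric_of_norm_lt_one (h1 a)).mul ih.2 hmul
      refine this.congr_fun ?_ |> fun h => h
      intro q; simp only [Function.comp]; rw [e]

lemma euler_summable {P : Type*} (x : P → ℂ) (hx : Summable (fun p => ‖x p‖)) (h1 : ∀ p, ‖x p‖ ≤ 1/2) :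
    Summable (fun f : P →₀ ℕ => ‖mon x f‖) ∧ ∑' f : P →₀ ℕ, ‖mon x f‖ ≤ Real.exp (2 * ∑' p, ‖x p‖) := by
  classical
  have hb : ∀ F : Finset (P →₀ ℕ), ∑ f ∈ F, ‖mon x f‖ ≤ Real.exp (2 * ∑' p, ‖x p‖) := by
    intro F
    set S := F.biUnion (fun f => f.support)
    have hS : ∀ f ∈ F, f.support ⊆ S := fun f hf => Finset.subset_biUnion_of_mem (fun f : P →₀ ℕ => f.support) hf
    set y : P → ℂ := fun p => (‖x p‖ : ℂ)
    have hy : ∀ p, ‖y p‖ < 1 := fun p => by simp [y]; linarith [h1 p]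
    obtain ⟨s1, s2⟩ := finite_euler y hy S
    have e1 : ∀ f, mon y f = ((‖mon x f‖ : ℝ) : ℂ) := by
      intro f; rw [mon_norm]; simp [mon, y, Finsupp.prod]
    have e2 : HasSum (fun f : {f : P →₀ ℕ // f.support ⊆ S} => ‖mon x f.1‖) (∏ p ∈ S, (1 - ‖x p‖)⁻¹) := by
      rw [← Complex.hasSum_ofReal]
      convert s2 using 1
      · ext f; rw [e1]
      · simp [y]
    have e3 : ∑ f ∈ F, ‖mon x f‖ ≤ ∏ p ∈ S, (1 - ‖x p‖)⁻¹ := by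
      have := sum_le_hasSum (F.subtype (fun f => f.support ⊆ S)) (fun _ _ => norm_nonneg _) e2
      rwa [Finset.sum_subtype_of_mem (fun f => ‖mon x f‖) hS] at this
    refine e3.trans ?_
    have e4 : ∏ p ∈ S, (1 - ‖x p‖)⁻¹ ≤ ∏ p ∈ S, Real.exp (2 * ‖x p‖) := by
      apply Finset.prod_le_prod
      · intro p _; exact inv_nonneg.mpr (by linarith [h1 p])
      · intro p _
        refine le_trans ?_ (Real.add_one_le_exp _)
        rw [inv_le_iff_one_le_mul₀ (by linarith [h1 p])]
        nlinarith [h1 p, norm_nonneg (x p)]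
    refine e4.trans ?_
    rw [← Real.exp_sum, ← Finset.mul_sum]
    apply Real.exp_le_exp.mpr
    gcongr
    exact hx.sum_le_tsum S (fun _ _ => norm_nonneg _)
  have hs := summable_of_sum_le (fun f => norm_nonneg (mon x f)) hb
  exact ⟨hs, hs.tsum_le_of_sum_le hb⟩

lemma summable_log_one_sub {P : Type*} (x : P → ℂ) (hx : Summable (fun p => ‖x p‖)) (h1 : ∀ p, ‖x p‖ ≤ 1/2) :
    Summable (fun p => -Complex.log (1 - x p)) := by
  have : Summable (fun p => 2 * ‖x p‖) := hx.mul_left 2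
  refine Summable.of_norm_bounded this (fun p => ?_)
  rw [norm_neg]
  have := Complex.norm_log_one_add_half_le_self (z := -x p) (by simpa using h1 p)
  rw [← sub_eq_add_neg, norm_neg] at this
  linarith [norm_nonneg (x p)]

theorem euler_abstract {P : Type*} (x : P → ℂ) (hx : Summable (fun p => ‖x p‖)) (h1 : ∀ p, ‖x p‖ ≤ 1/2) :
    ∑' f : P →₀ ℕ, mon x f = Complex.exp (∑' p, -Complex.log (1 - x p)) := by
  classical
  obtain ⟨hs, -⟩ := euler_summable x hx h1
  have l1 : Filter.Tendsto (fun S : Finset P => ∑' f : P →₀ ℕ, {f : P →₀ ℕ | f.support ⊆ S}.indicator (mon x) f)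
      Filter.atTop (nhds (∑' f : P →₀ ℕ, mon x f)) := by
    refine tendsto_tsum_of_dominated_convergence hs ?_ ?_
    · intro f
      apply tendsto_const_nhds.congr'
      filter_upwards [Filter.eventually_ge_atTop f.support] with S hS
      rw [Set.indicator_of_mem]; exact hS
    · filter_upwards with S f
      exact norm_indicator_le_norm_self _ _
  have l2 : Filter.Tendsto (fun S : Finset P => Complex.exp (∑ p ∈ S, -Complex.log (1 - x p)))
      Filter.atTop (nhds (Complex.exp (∑' p, -Complex.log (1 - x p)))) :=
    (Complex.continuous_exp.tendsto _).comp (summable_log_one_sub x hx h1).hasSum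
  refine tendsto_nhds_unique l1 (l2.congr (fun S => ?_))
  have h1' : ∀ p, ‖x p‖ < 1 := fun p => by linarith [h1 p]
  have := (finite_euler x h1' S).2
  have this2 : HasSum ({f : P →₀ ℕ | f.support ⊆ S}.indicator (mon x)) (∏ p ∈ S, (1 - x p)⁻¹) :=
    hasSum_subtype_iff_indicator.mp this
  rw [this2.tsum_eq, Complex.exp_sum]
  apply Finset.prod_congr rfl
  intro p _
  rw [Complex.exp_neg, Complex.exp_log]
  intro h
  have : x p = 1 := by linear_combination -h
  have h2 := h1 p
  rw [this] at h2; norm_num at h2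
end DH
end

section
namespace DH
set_option linter.unusedSectionVars false
open NumberField IsDedekindDomain Ideal

variable (K : Type*) [Field K] [NumberField K]

/-- the integer below a prime ideal -/
noncomputable def below (P : HeightOneSpectrum (𝓞 K)) : ℕ := absNorm (P.asIdeal.under ℤ)

lemma below_ne (P : HeightOneSpectrum (𝓞 K)) : P.asIdeal.under ℤ ≠ ⊥ :=
  (P.under ℤ).ne_bot

lemma below_le (P : HeightOneSpectrum (𝓞 K)) : below K P ≤ absNorm P.asIdeal := by
  have : P.asIdeal.LiesOver (P.asIdeal.under ℤ) := ⟨rfl⟩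
  have := P.isPrime
  have h := absNorm_dvd_absNorm_of_le (le_refl P.asIdeal)
  have hp := below_ne K P
  have h2 : absNorm (P.asIdeal.under ℤ) ∣ absNorm P.asIdeal := by
    have : Prime (P.asIdeal.under ℤ) := (P.under ℤ).prime
    have hm : (P.asIdeal.under ℤ).IsMaximal := (P.under ℤ).isMaximal
    rw [absNorm_eq_pow_inertiaDeg'_of_liesOver P.asIdeal (P.asIdeal.under ℤ)]
    · apply dvd_pow_self
      exact (inertiaDeg'_pos (P.asIdeal.under ℤ) P.asIdeal).ne'
    · exact hm.isPrime
    · exact hp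
  exact Nat.le_of_dvd (Nat.pos_of_ne_zero (by rw [Ne, absNorm_eq_zero_iff]; exact P.ne_bot)) h2

lemma below_fiber (F : Finset (HeightOneSpectrum (𝓞 K))) (m : ℕ) :
    (F.filter (fun P => below K P = m)).card ≤ Module.finrank ℚ K := by
  classical
  rcases (F.filter (fun P => below K P = m)).eq_empty_or_nonempty with h | ⟨P0, hP0⟩
  · rw [h]; simp
  · have hm := (Finset.mem_filter.mp hP0).2
    set p := P0.asIdeal.under ℤ with hp
    have hmax : p.IsMaximal := (P0.under ℤ).isMaximal
    have key := card_primesOverFinset_le_finrank (𝓞 K) ℚ K (p := p) (below_ne K P0)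
    refine le_trans ?_ key
    refine Finset.card_le_card_of_injOn (fun P => P.asIdeal) ?_ ?_
    · intro P hP
      simp only [Finset.coe_filter, Set.mem_ofPred_eq] at hP
      rw [Finset.mem_coe, IsDedekindDomain.mem_primesOverFinset_iff (below_ne K P0)]
      refine ⟨P.isPrime, ⟨?_⟩⟩
      have e : absNorm (P.asIdeal.under ℤ) = absNorm p := hP.2.trans hm.symm
      change p = P.asIdeal.under ℤ
      rw [← Int.ideal_span_absNorm_eq_self p, ← Int.ideal_span_absNorm_eq_self (P.asIdeal.under ℤ), e]
    · intro P _ Q _ h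
      exact HeightOneSpectrum.ext h

lemma absNorm_ge_two (P : HeightOneSpectrum (𝓞 K)) : 2 ≤ absNorm P.asIdeal := by
  have h0 : absNorm P.asIdeal ≠ 0 := by rw [Ne, absNorm_eq_zero_iff]; exact P.ne_bot
  have h1 : absNorm P.asIdeal ≠ 1 := by rw [Ne, absNorm_eq_one_iff]; exact P.isPrime.ne_top
  omega

lemma below_ge_two (P : HeightOneSpectrum (𝓞 K)) : 2 ≤ below K P := by
  have h0 : below K P ≠ 0 := by rw [below, Ne, absNorm_eq_zero_iff]; exact below_ne K P
  have h1 : below K P ≠ 1 := by rw [below, Ne, absNorm_eq_one_iff]; exact (P.under ℤ).isPrime.ne_top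
  omega

lemma prime_sum (σ : ℝ) (hσ : 1 < σ) (F : Finset (HeightOneSpectrum (𝓞 K))) :
    ∑ P ∈ F, (absNorm P.asIdeal : ℝ) ^ (-σ) ≤ Module.finrank ℚ K * ∑' m : ℕ, (m : ℝ) ^ (-σ) := by
  classical
  calc ∑ P ∈ F, (absNorm P.asIdeal : ℝ) ^ (-σ) ≤ ∑ P ∈ F, (below K P : ℝ) ^ (-σ) := by
        refine Finset.sum_le_sum fun P _ => ?_
        apply Real.rpow_le_rpow_of_nonpos
        · exact_mod_cast (by linarith [below_ge_two K P] : 0 < below K P)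
        · exact_mod_cast below_le K P
        · linarith
    _ = ∑ m ∈ F.image (below K), ∑ P ∈ F.filter (fun P => below K P = m), (below K P : ℝ) ^ (-σ) := by
        rw [Finset.sum_fiberwise_of_maps_to]
        intro P hP; exact Finset.mem_image_of_mem _ hP
    _ ≤ ∑ m ∈ F.image (below K), (Module.finrank ℚ K) * (m:ℝ) ^ (-σ) := by
        refine Finset.sum_le_sum fun m _ => ?_
        have : ∑ P ∈ F.filter (fun P => below K P = m), (below K P : ℝ) ^ (-σ) =
            ∑ P ∈ F.filter (fun P => below K P = m), (m : ℝ) ^ (-σ) :=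
          Finset.sum_congr rfl fun P hP => by rw [(Finset.mem_filter.mp hP).2]
        rw [this, Finset.sum_const, nsmul_eq_mul]
        gcongr
        exact below_fiber K F m
    _ ≤ _ := by
        rw [← Finset.mul_sum]
        gcongr
        refine Summable.sum_le_tsum _ (fun _ _ => by positivity) ?_
        exact Real.summable_nat_rpow.mpr (by linarith)

/-- nonzero ideals are finitely supported exponent functions on primes -/
noncomputable def idealOf (f : HeightOneSpectrum (𝓞 K) →₀ ℕ) : Ideal (𝓞 K) := mon (fun P => P.asIdeal) f

lemma idealOf_ne (f : HeightOneSpectrum (𝓞 K) →₀ ℕ) : idealOf K f ≠ ⊥ := by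
  rw [idealOf, mon, Finsupp.prod, ← Ideal.zero_eq_bot, Finset.prod_ne_zero_iff]
  intro P _
  exact pow_ne_zero _ P.ne_bot

lemma idealOf_eq (f : HeightOneSpectrum (𝓞 K) →₀ ℕ) :
    idealOf K f = ((Finsupp.toMultiset f).map (fun P => P.asIdeal)).prod := by
  classical
  rw [idealOf, mon, Finsupp.toMultiset_map, Finsupp.prod_toMultiset, Finsupp.prod_mapDomain_index]
  · simp
  · intro _ a b; exact pow_add _ _ _

lemma idealOf_bij : Function.Bijective (fun f => (⟨idealOf K f, idealOf_ne K f⟩ : {I : Ideal (𝓞 K) // I ≠ ⊥})) := by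
  classical
  constructor
  · intro f g h
    have h' : idealOf K f = idealOf K g := congrArg Subtype.val h
    have nf : ∀ f, UniqueFactorizationMonoid.normalizedFactors (idealOf K f) = (Finsupp.toMultiset f).map (fun P => P.asIdeal) := by
      intro f
      rw [idealOf_eq]
      apply UniqueFactorizationMonoid.normalizedFactors_prod_of_prime
      intro I hI
      obtain ⟨P, _, rfl⟩ := Multiset.mem_map.mp hI
      exact P.prime
    have h2 := nf f
    rw [h', nf g] at h2
    have := Multiset.map_injective (fun P Q h => HeightOneSpectrum.ext h) h2
    have h3 := congrArg Multiset.toFinsupp this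
    rw [Finsupp.toMultiset_toFinsupp, Finsupp.toMultiset_toFinsupp] at h3
    exact h3.symm
  · rintro ⟨I, hI⟩
    have hpr : ∀ J ∈ UniqueFactorizationMonoid.normalizedFactors I, Prime J := fun J hJ => UniqueFactorizationMonoid.prime_of_normalized_factor J hJ
    let m : Multiset (HeightOneSpectrum (𝓞 K)) :=
      (UniqueFactorizationMonoid.normalizedFactors I).pmap (fun J hJ => ⟨J, Ideal.isPrime_of_prime hJ, hJ.ne_zero⟩) hpr
    refine ⟨Multiset.toFinsupp m, Subtype.ext ?_⟩
    simp only
    rw [idealOf_eq, Multiset.toFinsupp_toMultiset, Multiset.map_pmap, Multiset.pmap_eq_map, Multiset.map_id']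
    exact Ideal.prod_normalizedFactors_eq_self hI

lemma absNorm_idealOf (f : HeightOneSpectrum (𝓞 K) →₀ ℕ) (s : ℂ) :
    (absNorm (idealOf K f) : ℂ) ^ s = mon (fun P => (absNorm P.asIdeal : ℂ) ^ s) f := by
  have h1 : absNorm (idealOf K f) = mon (fun P => absNorm P.asIdeal) f := by
    simp [idealOf, mon, Finsupp.prod, map_prod]
  have h2 : ∀ S : Finset (HeightOneSpectrum (𝓞 K)), ((∏ P ∈ S, absNorm P.asIdeal ^ f P : ℕ) : ℂ) ^ s = 
      ∏ P ∈ S, ((absNorm P.asIdeal : ℂ) ^ s) ^ f P := by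
    classical
    intro S
    induction S using Finset.induction_on with
    | empty => simp
    | insert a S ha ih =>
      rw [Finset.prod_insert ha, Finset.prod_insert ha, Nat.cast_mul, Complex.natCast_mul_natCast_cpow, ih]
      congr 1
      rw [Nat.cast_pow, ← Complex.natCast_cpow_natCast_mul, Complex.cpow_nat_mul]
      
  rw [h1]
  exact h2 _

lemma xP_norm (P : HeightOneSpectrum (𝓞 K)) (s : ℂ) : ‖(absNorm P.asIdeal : ℂ) ^ (-s)‖ = (absNorm P.asIdeal : ℝ) ^ (-s.re) := by
  rw [Complex.norm_natCast_cpow_of_pos (by linarith [absNorm_ge_two K P])]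
  simp

lemma xP_half (P : HeightOneSpectrum (𝓞 K)) (s : ℂ) (hs : 1 < s.re) : ‖(absNorm P.asIdeal : ℂ) ^ (-s)‖ ≤ 1/2 := by
  rw [xP_norm]
  have h2 : (2:ℝ) ≤ absNorm P.asIdeal := by exact_mod_cast absNorm_ge_two K P
  calc (absNorm P.asIdeal : ℝ) ^ (-s.re) ≤ (absNorm P.asIdeal : ℝ) ^ (-1 : ℝ) :=
        Real.rpow_le_rpow_of_exponent_le (by linarith) (by linarith)
    _ = (absNorm P.asIdeal : ℝ)⁻¹ := Real.rpow_neg_one _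
    _ ≤ 1/2 := by rw [one_div]; exact inv_anti₀ (by norm_num) h2

lemma xP_summable (s : ℂ) (hs : 1 < s.re) : Summable (fun P : HeightOneSpectrum (𝓞 K) => ‖(absNorm P.asIdeal : ℂ) ^ (-s)‖) ∧
    ∑' P : HeightOneSpectrum (𝓞 K), ‖(absNorm P.asIdeal : ℂ) ^ (-s)‖ ≤ Module.finrank ℚ K * ∑' m : ℕ, (m : ℝ) ^ (-s.re) := by
  simp_rw [xP_norm]
  have h := summable_of_sum_le (f := fun P : HeightOneSpectrum (𝓞 K) => (absNorm P.asIdeal : ℝ) ^ (-s.re)) (fun _ => by positivity) (prime_sum K s.re hs)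
  exact ⟨h, h.tsum_le_of_sum_le (prime_sum K s.re hs)⟩

/-- summability of the Dedekind zeta series with a bound -/
theorem zeta_summable (s : ℂ) (hs : 1 < s.re) :
    Summable (fun I : {I : Ideal (𝓞 K) // I ≠ ⊥} => ‖(absNorm I.1 : ℂ) ^ (-s)‖) ∧
    ∑' I : {I : Ideal (𝓞 K) // I ≠ ⊥}, ‖(absNorm I.1 : ℂ) ^ (-s)‖ ≤
      Real.exp (2 * (Module.finrank ℚ K * ∑' m : ℕ, (m : ℝ) ^ (-s.re))) := by
  let e := Equiv.ofBijective _ (idealOf_bij K)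
  have he : ∀ f, ((fun I : {I : Ideal (𝓞 K) // I ≠ ⊥} => ‖(absNorm I.1 : ℂ) ^ (-s)‖) ∘ e) f =
      ‖mon (fun P : HeightOneSpectrum (𝓞 K) => (absNorm P.asIdeal : ℂ) ^ (-s)) f‖ := by
    intro f
    rw [← absNorm_idealOf]; rfl
  obtain ⟨h1, h2⟩ := xP_summable K s hs
  obtain ⟨h3, h4⟩ := euler_summable _ h1 (fun P => xP_half K P s hs)
  constructor
  · rw [← e.summable_iff]
    exact h3.congr (fun f => (he f).symm)
  · rw [← e.tsum_eq]
    refine le_trans (le_of_eq (tsum_congr he)) (h4.trans ?_)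
    apply Real.exp_le_exp.mpr
    linarith

/-- coefficients of the logarithm of the Dedekind zeta function -/
noncomputable def logCoeff (n : ℕ) : ℝ :=
  ∑' q : (fun q : HeightOneSpectrum (𝓞 K) × ℕ => absNorm q.1.asIdeal ^ (q.2 + 1)) ⁻¹' {n}, (1 : ℝ) / (q.1.2 + 1)

lemma logCoeff_nonneg (n : ℕ) : 0 ≤ logCoeff K n := tsum_nonneg fun q => by positivity

lemma log_hasSum (s : ℂ) (hs : 1 < s.re) :
    HasSum (fun n => LSeries.term (fun n => (logCoeff K n : ℂ)) s n)
      (∑' P : HeightOneSpectrum (𝓞 K), -Complex.log (1 - (absNorm P.asIdeal : ℂ) ^ (-s))) := by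
  set x : HeightOneSpectrum (𝓞 K) → ℂ := fun P => (absNorm P.asIdeal : ℂ) ^ (-s) with hx
  obtain ⟨h1, -⟩ := xP_summable K s hs
  have hhalf : ∀ P, ‖x P‖ ≤ 1/2 := fun P => xP_half K P s hs
  have hsum1 : ∀ P, HasSum (fun m : ℕ => x P ^ (m+1) / ((m:ℂ) + 1)) (-Complex.log (1 - x P)) := by
    intro P
    have := Complex.hasSum_taylorSeries_neg_log (z := x P) (by linarith [hhalf P])
    rw [← hasSum_nat_add_iff' 1] at this
    simpa using this
  have hnorm : Summable (fun q : HeightOneSpectrum (𝓞 K) × ℕ => ‖x q.1‖ ^ (q.2+1)) := by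
    have hg : ∀ P, HasSum (fun m : ℕ => ‖x P‖ ^ (m+1)) (‖x P‖ * (1 - ‖x P‖)⁻¹) := by
      intro P
      have := (hasSum_geometric_of_lt_one (norm_nonneg (x P)) (by linarith [hhalf P])).mul_left ‖x P‖
      simpa [pow_succ'] using this
    rw [summable_prod_of_nonneg (fun q => by positivity)]
    refine ⟨fun P => (hg P).summable, ?_⟩
    refine Summable.of_nonneg_of_le (fun P => tsum_nonneg fun m => by positivity) (fun P => ?_) (h1.mul_left 2)
    simp only
    rw [(hg P).tsum_eq, mul_comm]
    gcongr
    rw [inv_le_comm₀ (by linarith [hhalf P]) (by norm_num)]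
    linarith [hhalf P]
  have hsumm : Summable (fun q : HeightOneSpectrum (𝓞 K) × ℕ => x q.1 ^ (q.2+1) / ((q.2:ℂ) + 1)) := by
    refine Summable.of_norm_bounded hnorm (fun q => ?_)
    rw [norm_div, norm_pow]
    apply div_le_self (by positivity)
    have : ((q.2:ℂ) + 1) = ((q.2 + 1 : ℕ) : ℂ) := by push_cast; ring
    rw [this, Complex.norm_natCast]
    exact_mod_cast Nat.succ_le_succ (Nat.zero_le _)
  have hS : HasSum (fun q : HeightOneSpectrum (𝓞 K) × ℕ => x q.1 ^ (q.2+1) / ((q.2:ℂ) + 1)) (∑' P, -Complex.log (1 - x P)) := by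
    have := hsumm.hasSum
    rw [hsumm.tsum_prod] at this
    rwa [tsum_congr (fun P => (hsum1 P).tsum_eq)] at this
  have hfib := hS.tsum_fiberwise (fun q : HeightOneSpectrum (𝓞 K) × ℕ => absNorm q.1.asIdeal ^ (q.2 + 1))
  suffices hfun : ∀ n, LSeries.term (fun n => (logCoeff K n : ℂ)) s n = _ by
    rw [show (fun n => LSeries.term (fun n => (logCoeff K n : ℂ)) s n) = _ from funext hfun]
    exact hfib
  intro n
  rcases eq_or_ne n 0 with rfl | hn
  · rw [LSeries.term_zero]
    have : IsEmpty ((fun q : HeightOneSpectrum (𝓞 K) × ℕ => absNorm q.1.asIdeal ^ (q.2 + 1)) ⁻¹' {0}) := by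
      constructor
      rintro ⟨⟨P, m⟩, hq⟩
      have hq' : absNorm P.asIdeal ^ (m+1) = 0 := hq
      have := (pow_eq_zero_iff (n := m + 1) (by omega)).mp hq'
      have := absNorm_ge_two K P
      omega
    rw [tsum_empty]
  · rw [LSeries.term_of_ne_zero hn, logCoeff, Complex.ofReal_tsum, div_eq_mul_inv, ← Complex.cpow_neg, ← tsum_mul_right]
    apply tsum_congr
    rintro ⟨⟨P, m⟩, hq⟩
    have hq' : absNorm P.asIdeal ^ (m+1) = n := hq
    simp only
    have e1 : (n : ℂ) ^ (-s) = x P ^ (m+1) := by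
      rw [← hq', hx]
      rw [Nat.cast_pow, ← Complex.natCast_cpow_natCast_mul, Complex.cpow_nat_mul]
    rw [e1]
    push_cast
    ring

/-- `ζ_K = exp (∑ logCoeff n n^{-s})`. -/
theorem zeta_eq_exp (s : ℂ) (hs : 1 < s.re) :
    LSeriesSummable (fun n => (logCoeff K n : ℂ)) s ∧
    ∑' I : {I : Ideal (𝓞 K) // I ≠ ⊥}, (absNorm I.1 : ℂ) ^ (-s) = Complex.exp (LSeries (fun n => (logCoeff K n : ℂ)) s) := by
  have h := log_hasSum K s hs
  refine ⟨h.summable, ?_⟩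
  rw [LSeries, h.tsum_eq, ← euler_abstract _ (xP_summable K s hs).1 (fun P => xP_half K P s hs)]
  let e := Equiv.ofBijective _ (idealOf_bij K)
  rw [← e.tsum_eq]
  apply tsum_congr
  intro f
  rw [← absNorm_idealOf]; rfl

lemma zeta_two_bound : ∑' m : ℕ, (m : ℝ) ^ (-2 : ℝ) ≤ 2 := by
  have h := hasSum_zeta_two
  have e : ∀ m : ℕ, (m : ℝ) ^ (-2 : ℝ) = 1 / (m:ℝ)^2 := by
    intro m
    rw [Real.rpow_neg (by positivity), one_div]; norm_cast
  rw [tsum_congr e, h.tsum_eq]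
  have := Real.pi_lt_d2
  have := Real.pi_pos
  nlinarith

/-- bound of `ζ_K(σ)` for `σ ≥ 2`. -/
theorem zeta_bound (σ : ℝ) (hσ : 2 ≤ σ) :
    Summable (fun I : {I : Ideal (𝓞 K) // I ≠ ⊥} => (absNorm I.1 : ℝ) ^ (-σ)) ∧
    ∑' I : {I : Ideal (𝓞 K) // I ≠ ⊥}, (absNorm I.1 : ℝ) ^ (-σ) ≤ Real.exp (4 * Module.finrank ℚ K) := by
  have hpos : ∀ I : {I : Ideal (𝓞 K) // I ≠ ⊥}, 0 < absNorm I.1 := fun I =>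
    Nat.pos_of_ne_zero (by rw [Ne, absNorm_eq_zero_iff]; exact I.2)
  have hn : ∀ (τ : ℝ) (I : {I : Ideal (𝓞 K) // I ≠ ⊥}), ‖(absNorm I.1 : ℂ) ^ (-(τ:ℂ))‖ = (absNorm I.1 : ℝ) ^ (-τ) := by
    intro τ I
    rw [Complex.norm_natCast_cpow_of_pos (hpos I)]; simp
  obtain ⟨h1, -⟩ := zeta_summable K σ (by simp; linarith)
  obtain ⟨h3, h4⟩ := zeta_summable K ((2:ℝ):ℂ) (by simp)
  simp_rw [hn] at h1 h3 h4
  refine ⟨h1, (h1.tsum_le_tsum (fun I => ?_) h3).trans (h4.trans ?_)⟩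
  · exact Real.rpow_le_rpow_of_exponent_le (by exact_mod_cast hpos I) (by linarith)
  · apply Real.exp_le_exp.mpr
    have := zeta_two_bound
    simp only [Complex.ofReal_re]
    have hk : (0:ℝ) ≤ Module.finrank ℚ K := by positivity
    nlinarith

/-- lower bound on the line `Re s = 2`. -/
theorem zeta_lower (t : ℝ) :
    Real.exp (-(4 * Module.finrank ℚ K)) ≤ ‖∑' I : {I : Ideal (𝓞 K) // I ≠ ⊥}, (absNorm I.1 : ℂ) ^ (-(2 + t * Complex.I))‖ := by
  obtain ⟨s1, e1⟩ := zeta_eq_exp K (2 + t * Complex.I) (by simp)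
  obtain ⟨s2, e2⟩ := zeta_eq_exp K 2 (by simp)
  rw [e1, Complex.norm_exp]
  apply Real.exp_le_exp.mpr
  have hle : ‖LSeries (fun n => (logCoeff K n : ℂ)) (2 + t * Complex.I)‖ ≤ (LSeries (fun n => (logCoeff K n : ℂ)) 2).re := by
    have s2' : Summable (fun n => LSeries.term (fun n => (logCoeff K n : ℂ)) 2 n) := s2
    rw [LSeries, LSeries, Complex.re_tsum s2']
    refine tsum_of_norm_bounded (Complex.hasSum_re s2'.hasSum).summable.hasSum (fun n => le_of_eq ?_)
    rw [LSeries.norm_term_eq]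
    rcases eq_or_ne n 0 with rfl | hn
    · simp
    · rw [if_neg hn, LSeries.term_of_ne_zero hn]
      have : ((n:ℂ) ^ (2:ℂ)) = (((n:ℝ)^2 : ℝ) : ℂ) := by
        rw [show (2:ℂ) = ((2:ℕ):ℂ) by norm_num, Complex.cpow_natCast]; push_cast; ring
      rw [this, ← Complex.ofReal_div, Complex.ofReal_re]
      simp [abs_of_nonneg (logCoeff_nonneg K n)]
  have h4 := (zeta_bound K 2 le_rfl).2
  have h5 : Real.exp (LSeries (fun n => (logCoeff K n : ℂ)) 2).re ≤ Real.exp (4 * Module.finrank ℚ K) := by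
    rw [← Complex.norm_exp, ← e2]
    refine le_trans (le_trans (norm_tsum_le_tsum_norm (zeta_summable K 2 (by simp)).1) (le_of_eq (tsum_congr fun I => ?_))) h4
    rw [Complex.norm_natCast_cpow_of_pos (Nat.pos_of_ne_zero (by rw [Ne, absNorm_eq_zero_iff]; exact I.2))]; simp
  have h6 := Real.exp_le_exp.mp h5
  have := Complex.abs_re_le_norm (LSeries (fun n => (logCoeff K n : ℂ)) (2 + t * Complex.I))
  have := neg_abs_le (LSeries (fun n => (logCoeff K n : ℂ)) (2 + t * Complex.I)).re
  linarith

end DH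
end

section
namespace DH
open MeasureTheory Real

lemma summable_pi_prod {ι κ : Type*} [Fintype ι] (f : κ → ℝ) (hf : Summable f) (h0 : ∀ k, 0 ≤ f k) :
    Summable (fun m : ι → κ => ∏ i, f (m i)) := by
  classical
  refine summable_of_sum_le (c := ∏ _i : ι, ∑' k, f k) (fun m => Finset.prod_nonneg fun i _ => h0 _) (fun s => ?_)
  calc ∑ m ∈ s, ∏ i, f (m i) ≤ ∑ m ∈ Fintype.piFinset (fun i => s.image (fun m => m i)), ∏ i, f (m i) := by
        refine Finset.sum_le_sum_of_subset_of_nonneg ?_ (fun m _ _ => Finset.prod_nonneg fun i _ => h0 _)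
        intro m hm
        rw [Fintype.mem_piFinset]
        intro i
        exact Finset.mem_image_of_mem _ hm
    _ = ∏ i, ∑ k ∈ s.image (fun m => m i), f k := (Finset.prod_univ_sum _ _).symm
    _ ≤ _ := by
        refine Finset.prod_le_prod (fun i _ => Finset.sum_nonneg fun k _ => h0 k) (fun i _ => ?_)
        exact hf.sum_le_tsum _ (fun k _ => h0 k)

lemma summable_gauss_int (c : ℝ) (hc : 0 < c) : Summable (fun k : ℤ => Real.exp (-c * (k:ℝ)^2)) := by
  have : Summable (fun k : ℤ => Real.exp (-c * |(k:ℝ)|)) := by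
    have g : Summable (fun n : ℕ => Real.exp (-c * n)) := by
      have := summable_geometric_of_lt_one (Real.exp_pos (-c)).le (Real.exp_lt_one_iff.mpr (by linarith))
      refine this.congr (fun n => ?_)
      rw [← Real.exp_nat_mul]; ring_nf
    refine Summable.of_nat_of_neg ?_ ?_ <;> refine g.congr (fun n => by simp)
  refine Summable.of_nonneg_of_le (fun _ => (Real.exp_pos _).le) (fun k => ?_) this
  apply Real.exp_le_exp.mpr
  have : |(k:ℝ)| ≤ (k:ℝ)^2 := by
    rw [← sq_abs]
    rcases eq_or_ne k 0 with rfl | hk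
    · simp
    · have : (1:ℝ) ≤ |(k:ℝ)| := by exact_mod_cast Int.one_le_abs hk
      nlinarith
  nlinarith

lemma summable_gauss {ι : Type*} [Fintype ι] (c : ℝ) (hc : 0 < c) :
    Summable (fun m : ι → ℤ => Real.exp (-c * ∑ i, (m i : ℝ)^2)) := by
  refine (summable_pi_prod _ (summable_gauss_int c hc) (fun _ => (Real.exp_pos _).le)).congr (fun m => ?_)
  rw [← Real.exp_sum, Finset.mul_sum]

set_option linter.unusedSectionVars false
variable {ι : Type*} [Fintype ι] [DecidableEq ι]

/-- the quadratic form attached to `A` -/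
noncomputable def qf (A : Matrix ι ι ℝ) (u : ι → ℝ) : ℝ := ∑ i, (A.mulVec u i) ^ 2

lemma qf_cont (A : Matrix ι ι ℝ) : Continuous (qf A) := by
  unfold qf Matrix.mulVec dotProduct; fun_prop

lemma qf_lower (A : Matrix ι ι ℝ) (hA : A.det ≠ 0) : ∃ l > 0, ∀ u, l * ∑ i, (u i)^2 ≤ qf A u := by
  let T : (ι → ℝ) →L[ℝ] (ι → ℝ) := LinearMap.toContinuousLinearMap (Matrix.toLin' A⁻¹)
  set M := ‖T‖
  have hM : 0 ≤ M := norm_nonneg _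
  refine ⟨1 / (Fintype.card ι * M ^ 2 + 1), by positivity, fun u => ?_⟩
  have h1 : u = T (A.mulVec u) := by
    have : IsUnit A.det := isUnit_iff_ne_zero.mpr hA
    simp only [T, LinearMap.coe_toContinuousLinearMap', Matrix.toLin'_apply, Matrix.mulVec_mulVec]
    rw [Matrix.nonsing_inv_mul _ this, Matrix.one_mulVec]
  have h2 : ‖u‖ ≤ M * ‖A.mulVec u‖ := by
    conv_lhs => rw [h1]
    exact T.le_opNorm _
  have h3 : ‖A.mulVec u‖ ^ 2 ≤ qf A u := by
    have hq : 0 ≤ qf A u := Finset.sum_nonneg fun i _ => sq_nonneg _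
    have : ‖A.mulVec u‖ ≤ √(qf A u) := by
      rw [pi_norm_le_iff_of_nonneg (Real.sqrt_nonneg _)]
      intro i
      rw [Real.norm_eq_abs]
      apply Real.abs_le_sqrt
      exact Finset.single_le_sum (f := fun i => (A.mulVec u i)^2) (fun i _ => sq_nonneg _) (Finset.mem_univ i)
    calc _ ≤ (√(qf A u))^2 := by gcongr
      _ = _ := Real.sq_sqrt hq
  have h4 : ∑ i, (u i)^2 ≤ Fintype.card ι * ‖u‖^2 := by
    calc ∑ i, (u i)^2 ≤ ∑ _i : ι, ‖u‖^2 := by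
          refine Finset.sum_le_sum fun i _ => ?_
          rw [← sq_abs]
          have := norm_le_pi_norm u i
          rw [Real.norm_eq_abs] at this
          gcongr
      _ = _ := by simp
  have hq : 0 ≤ qf A u := Finset.sum_nonneg fun i _ => sq_nonneg _
  rw [div_mul_eq_mul_div, one_mul, div_le_iff₀ (by positivity)]
  have h5 : ‖u‖^2 ≤ M^2 * ‖A.mulVec u‖^2 := by rw [← mul_pow]; gcongr
  have hk : (0:ℝ) ≤ Fintype.card ι := by positivity
  calc ∑ i, (u i)^2 ≤ Fintype.card ι * (M^2 * ‖A.mulVec u‖^2) := h4.trans (by gcongr)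
    _ ≤ Fintype.card ι * (M^2 * qf A u) := by gcongr
    _ ≤ _ := by nlinarith

lemma gauss_shift_bound (A : Matrix ι ι ℝ) (l : ℝ) (hl : 0 < l) (h : ∀ u, l * ∑ i, (u i)^2 ≤ qf A u)
    (u v : ι → ℝ) : Real.exp (-π * qf A (u + v)) ≤ Real.exp (π * l * ∑ i, (u i)^2) * Real.exp (-(π * l / 2) * ∑ i, (v i)^2) := by
  rw [← Real.exp_add]
  apply Real.exp_le_exp.mpr
  have h1 := h (u + v)
  have h2 : ∑ i, (v i)^2 / 2 - ∑ i, (u i)^2 ≤ ∑ i, ((u + v) i)^2 := by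
    rw [← Finset.sum_sub_distrib]
    refine Finset.sum_le_sum fun i _ => ?_
    simp only [Pi.add_apply]
    nlinarith [sq_nonneg (v i + 2 * u i)]
  rw [← Finset.sum_div] at h2
  have h3 := mul_le_mul_of_nonneg_left h2 (by positivity : 0 ≤ π * l)
  have h4 := mul_le_mul_of_nonneg_left h1 pi_pos.le
  nlinarith

/-- real vector of an integer vector -/
def ivec (m : ι → ℤ) : ι → ℝ := fun i => (m i : ℝ)

lemma summable_shift (A : Matrix ι ι ℝ) (hA : A.det ≠ 0) (u : ι → ℝ) :
    Summable (fun m : ι → ℤ => Real.exp (-π * qf A (u + ivec m))) := by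
  obtain ⟨l, hl, h⟩ := qf_lower A hA
  refine Summable.of_nonneg_of_le (fun _ => (Real.exp_pos _).le) (fun m => gauss_shift_bound A l hl h u (ivec m)) ?_
  exact (summable_gauss (π * l / 2) (by positivity)).mul_left _

lemma cont_periodized (A : Matrix ι ι ℝ) (hA : A.det ≠ 0) :
    Continuous (fun u : ι → ℝ => ∑' m : ι → ℤ, (Real.exp (-π * qf A (u + ivec m)) : ℂ)) := by
  obtain ⟨l, hl, h⟩ := qf_lower A hA
  rw [continuous_iff_continuousAt]
  intro u0
  have : ContinuousOn (fun u : ι → ℝ => ∑' m : ι → ℤ, (Real.exp (-π * qf A (u + ivec m)) : ℂ)) (Metric.ball u0 1) := by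
    obtain ⟨C, hC⟩ := (isCompact_closedBall u0 (1:ℝ)).bddAbove_image
      (f := fun u : ι → ℝ => Real.exp (π * l * ∑ i, (u i)^2)) (by fun_prop)
    refine continuousOn_tsum (u := fun m : ι → ℤ => C * Real.exp (-(π * l / 2) * ∑ i, (ivec m i)^2)) ?_ ?_ ?_
    · intro m
      apply Continuous.continuousOn
      have := qf_cont A
      fun_prop
    · exact (summable_gauss (π * l / 2) (by positivity)).mul_left _
    · intro m u hu
      rw [Complex.norm_real, Real.norm_of_nonneg (Real.exp_pos _).le]
      refine (gauss_shift_bound A l hl h u (ivec m)).trans ?_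
      gcongr
      exact hC (Set.mem_image_of_mem _ (Metric.ball_subset_closedBall hu))
  exact this.continuousAt (Metric.ball_mem_nhds u0 one_pos)

/-- Gaussian with linear phase -/
lemma gauss_integral (w : ι → ℝ) :
    ∫ v : ι → ℝ, Complex.exp (-2 * π * Complex.I * ∑ i, w i * v i) * (Real.exp (-π * ∑ i, (v i)^2) : ℂ) = (Real.exp (-π * ∑ i, (w i)^2) : ℂ) := by
  have := GaussianFourier.integral_cexp_neg_mul_sum_add (b := (π : ℂ)) (by simpa using pi_pos) (fun i : ι => (-2 * π * Complex.I * w i : ℂ))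
  rw [div_self (by exact_mod_cast pi_ne_zero), Complex.one_cpow, one_mul] at this
  convert this using 1
  · congr 1; ext v
    push_cast
    rw [← Complex.exp_add]
    congr 1
    rw [Finset.mul_sum]
    simp_rw [mul_assoc]
    ring
  · push_cast
    congr 1
    rw [Finset.mul_sum, Finset.sum_div]
    apply Finset.sum_congr rfl
    intro i _
    have : (π : ℂ) ≠ 0 := by exact_mod_cast pi_ne_zero
    field_simp
    ring_nf
    rw [Complex.I_sq]; ring

lemma gauss_integrable (w : ι → ℝ) :
    Integrable (fun v : ι → ℝ => Complex.exp (-2 * π * Complex.I * ∑ i, w i * v i) * (Real.exp (-π * ∑ i, (v i)^2) : ℂ)) := by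
  have := GaussianFourier.integrable_cexp_neg_mul_sum_add (b := (π : ℂ)) (by simpa using pi_pos) (fun i : ι => (-2 * π * Complex.I * w i : ℂ))
  convert this using 1
  ext v
  push_cast
  rw [← Complex.exp_add]
  congr 1
  rw [Finset.mul_sum]
  simp_rw [mul_assoc]
  ring

end DH
end

section
namespace DH
open MeasureTheory Real Set
set_option linter.unusedSectionVars false
variable {ι : Type*} [Fintype ι] [DecidableEq ι]

/-- unit cube at an integer point -/
def icube (m : ι → ℤ) : Set (ι → ℝ) := {x | ∀ i, x i ∈ Ioc (m i : ℝ) (m i + 1)}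

lemma icube_meas (m : ι → ℤ) : MeasurableSet (icube m) :=
  MeasurableSet.univ_pi' (fun i => measurableSet_Ioc (a := (m i : ℝ)) (b := m i + 1))

lemma icube_disj : Pairwise (Function.onFun Disjoint (icube (ι := ι))) := by
  intro m n hmn
  rw [Function.onFun, Set.disjoint_left]
  intro x hx hy
  apply hmn
  ext i
  have h1 := hx i
  have h2 := hy i
  have a1 : (m i : ℝ) < n i + 1 := h1.1.trans_le h2.2
  have a2 : (n i : ℝ) < m i + 1 := h2.1.trans_le h1.2
  have b1 : m i < n i + 1 := by exact_mod_cast a1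
  have b2 : n i < m i + 1 := by exact_mod_cast a2
  omega

lemma icube_union : ⋃ m : ι → ℤ, icube m = Set.univ := by
  ext x
  simp only [mem_iUnion, mem_univ, iff_true]
  refine ⟨fun i => ⌈x i⌉ - 1, fun i => ⟨?_, ?_⟩⟩
  · push_cast; linarith [Int.ceil_lt_add_one (x i)]
  · push_cast; linarith [Int.le_ceil (x i)]

lemma icube_shift {E : Type*} [NormedAddCommGroup E] [NormedSpace ℝ E] (G : (ι → ℝ) → E) (m : ι → ℤ) :
    ∫ u in icube m, G u = ∫ u in icube (0 : ι → ℤ), G (u + ivec m) := by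
  have := (measurePreserving_add_right (volume : Measure (ι → ℝ)) (ivec m)).setIntegral_preimage_emb
    (MeasurableEquiv.addRight (ivec m)).measurableEmbedding G (icube m)
  rw [← this]
  congr 2
  ext u
  simp [icube, ivec]
  refine forall_congr' fun i => ?_
  constructor <;> rintro ⟨h1, h2⟩ <;> constructor <;> linarith

lemma periodize (G : (ι → ℝ) → ℂ) (hG : Integrable G) :
    ∫ u in icube (0 : ι → ℤ), ∑' m : ι → ℤ, G (u + ivec m) = ∫ u, G u := by
  have key : ∀ {E : Type} [NormedAddCommGroup E] [NormedSpace ℝ E] (G : (ι → ℝ) → E), Integrable G →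
      HasSum (fun m : ι → ℤ => ∫ u in icube (0 : ι → ℤ), G (u + ivec m)) (∫ u, G u) := by
    intro E _ _ G hG
    have := hasSum_integral_iUnion (μ := volume) (f := G) (fun m : ι → ℤ => icube_meas m) icube_disj hG.integrableOn
    rw [icube_union, setIntegral_univ] at this
    have e : (fun m : ι → ℤ => ∫ u in icube (0 : ι → ℤ), G (u + ivec m)) = fun m => ∫ u in icube m, G u :=
      funext fun m => (icube_shift G m).symm
    rw [e]; exact this
  have h1 := hasSum_integral_of_summable_integral_norm (μ := volume.restrict (icube (0 : ι → ℤ)))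
    (F := fun (m : ι → ℤ) u => G (u + ivec m)) (fun m => (hG.comp_add_right _).integrableOn) (key (fun u => ‖G u‖) hG.norm).summable
  exact h1.unique (key G hG)

lemma quot_open : IsOpenQuotientMap (fun (u : ι → ℝ) (i : ι) => (u i : UnitAddCircle)) := by
  have : IsOpenQuotientMap (fun x : ℝ => (x : UnitAddCircle)) := QuotientAddGroup.isOpenQuotientMap_mk
  exact IsOpenQuotientMap.piMap (f := fun (i : ι) (x : ℝ) => (x : UnitAddCircle)) (fun _ => this)

lemma lift_torus (H : (ι → ℝ) → ℂ) (hc : Continuous H) (hp : ∀ u (m : ι → ℤ), H (u + ivec m) = H u) :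
    ∃ F : C(UnitAddTorus ι, ℂ), ∀ u : ι → ℝ, F (fun i => (u i : UnitAddCircle)) = H u := by
  have hq := quot_open (ι := ι)
  have hinv : ∀ u v : ι → ℝ, (fun i => (u i : UnitAddCircle)) = (fun i => (v i : UnitAddCircle)) → H u = H v := by
    intro u v h
    have : ∀ i, ∃ k : ℤ, v i = u i + k := by
      intro i
      have := congrFun h i
      obtain ⟨k, hk⟩ := AddSubgroup.mem_zmultiples_iff.mp (QuotientAddGroup.eq.mp this)
      refine ⟨k, ?_⟩
      simp at hk
      linarith
    choose k hk using this
    rw [← hp u k]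
    congr 1
    ext i
    simp [ivec, hk i]
  let F : UnitAddTorus ι → ℂ := fun x => H (Function.surjInv hq.surjective x)
  have hF : ∀ u : ι → ℝ, F (fun i => (u i : UnitAddCircle)) = H u := fun u =>
    hinv _ _ (Function.surjInv_eq hq.surjective _)
  refine ⟨⟨F, ?_⟩, hF⟩
  rw [hq.isQuotientMap.continuous_iff]
  have : (F ∘ fun (u : ι → ℝ) (i : ι) => (u i : UnitAddCircle)) = H := funext hF
  rw [this]; exact hc

lemma mFourier_coe (n : ι → ℤ) (u : ι → ℝ) :
    UnitAddTorus.mFourier n (fun i => (u i : UnitAddCircle)) = Complex.exp (2 * π * Complex.I * ∑ i, n i * u i) := by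
  simp only [UnitAddTorus.mFourier, ContinuousMap.coe_mk, fourier_coe_apply]
  rw [← Complex.exp_sum]
  push_cast
  rw [Finset.mul_sum]
  congr 1
  apply Finset.sum_congr rfl
  intro i _
  simp; ring

/-- change of variables -/
lemma gauss_fourier (A : Matrix ι ι ℝ) (hA : A.det ≠ 0) (n : ι → ℤ) :
    Integrable (fun u : ι → ℝ => Complex.exp (-2 * π * Complex.I * ∑ i, n i * u i) * (Real.exp (-π * qf A u) : ℂ)) ∧
    ∫ u : ι → ℝ, Complex.exp (-2 * π * Complex.I * ∑ i, n i * u i) * (Real.exp (-π * qf A u) : ℂ)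
      = ((|A.det|⁻¹ * Real.exp (-π * qf (A⁻¹).transpose (ivec n)) : ℝ) : ℂ) := by
  set w : ι → ℝ := (A⁻¹).transpose.mulVec (ivec n) with hw
  set G : (ι → ℝ) → ℂ := fun v => Complex.exp (-2 * π * Complex.I * ∑ i, w i * v i) * (Real.exp (-π * ∑ i, (v i)^2) : ℂ) with hG
  have hcomp : (fun u : ι → ℝ => Complex.exp (-2 * π * Complex.I * ∑ i, n i * u i) * (Real.exp (-π * qf A u) : ℂ)) = fun u => G (Matrix.toLin' A u) := by
    funext u
    simp only [hG, Matrix.toLin'_apply]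
    congr 3
    have : w ⬝ᵥ A.mulVec u = ivec n ⬝ᵥ u := by
      rw [hw, Matrix.mulVec_transpose, ← Matrix.dotProduct_mulVec, Matrix.mulVec_mulVec, Matrix.nonsing_inv_mul _ (isUnit_iff_ne_zero.mpr hA), Matrix.one_mulVec]
    simp only [dotProduct, ivec] at this
    exact_mod_cast this.symm
  have hm := Real.map_matrix_volume_pi_eq_smul_volume_pi hA
  have hemb : MeasurableEmbedding (Matrix.toLin' A) := by
    have : IsUnit A.det := isUnit_iff_ne_zero.mpr hA
    have h2 := (LinearEquiv.toContinuousLinearEquiv (Matrix.toLin'OfInv (Matrix.nonsing_inv_mul A this) (Matrix.mul_nonsing_inv A this))).toHomeomorph.measurableEmbedding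
    have e : ⇑(Matrix.toLin' A) = (LinearEquiv.toContinuousLinearEquiv (Matrix.toLin'OfInv (Matrix.nonsing_inv_mul A this) (Matrix.mul_nonsing_inv A this))).toHomeomorph := by
      ext u; rfl
    rw [e]; exact h2
  have hGi : Integrable G := gauss_integrable w
  rw [hcomp]
  constructor
  · have := (hemb.integrable_map_iff (μ := volume) (g := G)).mp (by rw [hm]; exact hGi.smul_measure ENNReal.ofReal_ne_top)
    exact this
  · have := hemb.integral_map (μ := volume) G
    rw [← this, hm, integral_smul_measure, gauss_integral w]
    rw [ENNReal.toReal_ofReal (abs_nonneg _), abs_inv]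
    simp [qf, hw]

theorem poisson (A : Matrix ι ι ℝ) (hA : A.det ≠ 0) :
    ∑' m : ι → ℤ, Real.exp (-π * qf A (ivec m)) = |A.det|⁻¹ * ∑' m : ι → ℤ, Real.exp (-π * qf (A⁻¹).transpose (ivec m)) := by
  obtain ⟨F, hF⟩ := lift_torus _ (cont_periodized A hA) (by
    intro u m
    rw [← (Equiv.addLeft m).tsum_eq (fun k : ι → ℤ => (Real.exp (-π * qf A (u + ivec k)) : ℂ))]
    congr 1; funext k
    congr 4
    ext i
    simp [ivec]; ring)
  have hcoef : ∀ n, UnitAddTorus.mFourierCoeff F n = ((|A.det|⁻¹ * Real.exp (-π * qf (A⁻¹).transpose (ivec n)) : ℝ) : ℂ) := by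
    intro n
    obtain ⟨hi, he⟩ := gauss_fourier A hA n
    rw [UnitAddTorus.mFourierCoeff_eq_integral F n (fun _ => 0), ← he, ← periodize _ hi]
    have : {x : ι → ℝ | ∀ i, x i ∈ Ioc (0:ℝ) (0 + 1)} = icube (0 : ι → ℤ) := by ext; simp [icube]
    rw [this]
    congr 1
    funext u
    rw [hF, mFourier_coe, smul_eq_mul, ← tsum_mul_left]
    congr 1; funext m
    congr 1
    have : (2 * π * Complex.I * ∑ i, ((-n) i : ℤ) * u i : ℂ) = -2 * π * Complex.I * ∑ i, n i * u i := by
      simp only [Pi.neg_apply, Int.cast_neg, neg_mul, Finset.sum_neg_distrib]; push_cast; ring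
    rw [this]
    have h2 : (-2 * π * Complex.I * ((∑ i, (n i:ℝ) * (u + ivec m) i : ℝ) : ℂ) : ℂ) = -2 * π * Complex.I * ∑ i, n i * u i + ((-∑ i, n i * m i : ℤ):ℂ) * (2 * π * Complex.I) := by
      simp only [Pi.add_apply, ivec]
      push_cast
      simp only [mul_add, Finset.sum_add_distrib]
      ring
    rw [h2, Complex.exp_add, Complex.exp_int_mul_two_pi_mul_I, mul_one]
  have hdet : (A⁻¹).transpose.det ≠ 0 := by
    rw [Matrix.det_transpose, Matrix.det_nonsing_inv]; simpa using hA
  have hs : Summable (fun m : ι → ℤ => |A.det|⁻¹ * Real.exp (-π * qf (A⁻¹).transpose (ivec m))) := by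
    have := (summable_shift _ hdet 0).mul_left |A.det|⁻¹
    simpa using this
  have := UnitAddTorus.hasSum_mFourier_series_apply_of_summable (f := F) (by
    refine (hs.map Complex.ofRealHom Complex.continuous_ofReal).congr (fun n => ?_)
    simp [hcoef]) (fun i => ((0:ℝ) : UnitAddCircle))
  have h0 := hF 0
  simp only [Pi.zero_apply] at h0
  rw [h0] at this
  have h1 : ∀ n : ι → ℤ, UnitAddTorus.mFourier n (fun i : ι => ((0:ℝ) : UnitAddCircle)) = 1 := by
    intro n
    have := mFourier_coe n (0 : ι → ℝ)
    simpa using this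
  simp only [h1, hcoef, smul_eq_mul, mul_one, zero_add] at this
  have h3 := this.tsum_eq
  rw [← Complex.ofReal_tsum, ← Complex.ofReal_tsum, tsum_mul_left] at h3
  exact_mod_cast h3.symm

end DH
end

section
namespace DH
open MeasureTheory Real NumberField NumberField.InfinitePlace NumberField.mixedEmbedding Module
open scoped nonZeroDivisors Classical
set_option linter.unusedSectionVars false
variable (K : Type) [Field K] [NumberField K]

/-- scaling factors -/
noncomputable def sc : index K → ℝ := Sum.elim (fun _ => 1) (fun _ => √2)
/-- signs -/
noncomputable def sg : index K → ℝ := Sum.elim (fun _ => 1) (fun p => if p.2 = 0 then 1 else -1)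

/-- the quadratic form on mixed space -/
noncomputable def QF (x : mixedSpace K) : ℝ := ∑ k, (sc K k * (stdBasis K).repr x k) ^ 2

lemma QF_eq (x : mixedSpace K) : QF K x = ∑ v, (x.1 v)^2 + ∑ v, 2 * ‖x.2 v‖^2 := by
  unfold QF
  rw [Fintype.sum_sum_type, Fintype.sum_prod_type]
  congr 1
  · simp [sc]
  · apply Finset.sum_congr rfl
    intro v _
    simp only [Fin.sum_univ_two, sc, Sum.elim_inr, stdBasis_apply_isComplex_fst, stdBasis_apply_isComplex_snd]
    rw [mul_pow, mul_pow, Real.sq_sqrt (by norm_num), Complex.sq_norm, Complex.normSq_apply]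
    ring

lemma trace_mixed (z : K) : (Algebra.trace ℚ K z : ℝ) = ∑ v, (mixedEmbedding K z).1 v + ∑ v, 2 * ((mixedEmbedding K z).2 v).re := by
  have h := trace_eq_sum_embeddings (K := ℚ) (L := K) ℂ (x := z)
  have h2 : ∑ σ : K →ₐ[ℚ] ℂ, σ z = ∑ k : index K, indexEquiv K k z := by
    rw [Equiv.sum_comp (indexEquiv K) (fun σ : K →+* ℂ => σ z), ← Equiv.sum_comp (RingHom.equivRatAlgHom K ℂ)]
    rfl
  rw [h2, Fintype.sum_sum_type, Fintype.sum_prod_type] at h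
  have h3 := congrArg Complex.re h
  simp only [eq_ratCast, Complex.ratCast_re, Complex.add_re, Complex.re_sum, Fin.sum_univ_two, indexEquiv_apply_isReal, indexEquiv_apply_isComplex_fst, indexEquiv_apply_isComplex_snd, ComplexEmbedding.conjugate_coe_eq, Complex.conj_re] at h3
  rw [h3]
  refine congrArg₂ _ ?_ ?_
  · apply Finset.sum_congr rfl
    intro v _
    rw [mixedEmbedding_apply_isReal, ← embedding_of_isReal_apply v.2, Complex.ofReal_re]
  · apply Finset.sum_congr rfl
    intro v _
    rw [mixedEmbedding_apply_isComplex]; ring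

lemma ne_zero_of_norm {y : mixedSpace K} (hy : mixedEmbedding.norm y ≠ 0) : (∀ v, y.1 v ≠ 0) ∧ (∀ v, y.2 v ≠ 0) := by
  rw [mixedEmbedding.norm_ne_zero_iff] at hy
  constructor
  · intro v
    have := hy v
    rw [normAtPlace_apply_of_isReal v.2] at this
    simpa using this
  · intro v
    have := hy v
    rw [normAtPlace_apply_of_isComplex v.2] at this
    simpa using this

lemma pairing (y : mixedSpace K) (hy : mixedEmbedding.norm y ≠ 0) (x x' : K) :
    ∑ k, (sc K k * (stdBasis K).repr (y * mixedEmbedding K x) k) * (sc K k * sg K k * (stdBasis K).repr (y⁻¹ * mixedEmbedding K x') k)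
      = (Algebra.trace ℚ K (x * x') : ℝ) := by
  obtain ⟨h1, h2⟩ := ne_zero_of_norm K hy
  rw [trace_mixed, Fintype.sum_sum_type, Fintype.sum_prod_type]
  congr 1
  · apply Finset.sum_congr rfl
    intro v _
    have := h1 v
    simp [sc, sg, -mixedEmbedding_apply_isReal]
    field_simp
  · apply Finset.sum_congr rfl
    intro v _
    have hv := h2 v
    simp only [Fin.sum_univ_two, sc, sg, Sum.elim_inr, stdBasis_apply_isComplex_fst, stdBasis_apply_isComplex_snd]
    have e : (mixedEmbedding K (x * x')).2 v = (y * mixedEmbedding K x).2 v * (y⁻¹ * mixedEmbedding K x').2 v := by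
      rw [map_mul]
      simp only [Prod.snd_mul, Pi.mul_apply, Prod.snd_inv, Pi.inv_apply]
      field_simp
    rw [e, Complex.mul_re]
    have hs : √2 * √2 = 2 := Real.mul_self_sqrt (by norm_num)
    set a := (y * mixedEmbedding K x).2 v
    set b := (y⁻¹ * mixedEmbedding K x').2 v
    simp only [if_true, one_ne_zero, if_false]
    linear_combination (a.re * b.re - a.im * b.im) * hs

lemma norm_inv' (y : mixedSpace K) : mixedEmbedding.norm y⁻¹ = (mixedEmbedding.norm y)⁻¹ := by
  rw [mixedEmbedding.norm_apply, mixedEmbedding.norm_apply, ← Finset.prod_inv_distrib]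
  apply Finset.prod_congr rfl
  intro v _
  rw [← inv_pow]
  congr 1
  by_cases hv : IsReal v
  · rw [normAtPlace_apply_of_isReal hv, normAtPlace_apply_of_isReal hv]; simp
  · rw [not_isReal_iff_isComplex] at hv
    rw [normAtPlace_apply_of_isComplex hv, normAtPlace_apply_of_isComplex hv]; simp

/-- determinant of multiplication -/
lemma det_mul (y : mixedSpace K) : |LinearMap.det (LinearMap.mulLeft ℝ y)| = mixedEmbedding.norm y := by
  have : LinearMap.mulLeft ℝ y = LinearMap.prodMap (LinearMap.pi fun v => LinearMap.mulLeft ℝ (y.1 v) ∘ₗ LinearMap.proj v) (LinearMap.pi fun v => LinearMap.mulLeft ℝ (y.2 v) ∘ₗ LinearMap.proj v) := by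
    ext <;> simp
  rw [this, LinearMap.det_prodMap, LinearMap.det_pi, LinearMap.det_pi, abs_mul, Finset.abs_prod, Finset.abs_prod, mixedEmbedding.norm_apply]
  have hr : ∀ a : ℝ, LinearMap.det (LinearMap.mulLeft ℝ a) = a := by
    intro a; simp [LinearMap.det_ring]
  have hc : ∀ a : ℂ, LinearMap.det (LinearMap.mulLeft ℝ a) = ‖a‖^2 := by
    intro a
    have := Algebra.norm_complex_apply a
    rw [Complex.sq_norm, ← this]; rfl
  simp only [hr, hc]
  rw [prod_eq_prod_mul_prod]
  congr 1
  · apply Finset.prod_congr rfl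
    intro v _
    rw [normAtPlace_apply_of_isReal v.2, mult_isReal]; simp
  · apply Finset.prod_congr rfl
    intro v _
    rw [normAtPlace_apply_of_isComplex v.2, mult_isComplex]; simp

/-- a ℚ-basis of `K`, indexed by `index K`, spanning the fractional ideal `I`. -/
lemma exists_basis (I : (FractionalIdeal (𝓞 K)⁰ K)ˣ) : ∃ b : Basis (index K) ℚ K,
    (∀ x : K, x ∈ (I : FractionalIdeal (𝓞 K)⁰ K) ↔ ∃ m : index K → ℤ, x = ∑ j, m j • b j) ∧
    (∀ x : K, x ∈ FractionalIdeal.dual ℤ ℚ (I : FractionalIdeal (𝓞 K)⁰ K) ↔ ∃ m : index K → ℤ, x = ∑ j, m j • b.traceDual j) ∧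
    2 ^ (nrComplexPlaces K) * |(stdBasis K).det (mixedEmbedding K ∘ b)| = √|(discr K : ℝ)| * FractionalIdeal.absNorm I.1 := by
  let e : Free.ChooseBasisIndex ℤ I ≃ index K := (fractionalIdealLatticeBasis K I).indexEquiv (stdBasis K)
  let b := (basisOfFractionalIdeal K I).reindex e
  have hr : Set.range b = Set.range (basisOfFractionalIdeal K I) := Basis.range_reindex _ _
  have hspan : ((I : FractionalIdeal (𝓞 K)⁰ K) : Submodule (𝓞 K) K).restrictScalars ℤ = Submodule.span ℤ (Set.range b) := by
    ext x
    rw [hr]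
    exact (mem_span_basisOfFractionalIdeal K (I := I) (x := x)).symm
  have hmem : ∀ (c : index K → K) (x : K), x ∈ Submodule.span ℤ (Set.range c) ↔ ∃ m : index K → ℤ, x = ∑ j, m j • c j := by
    intro c x
    rw [Submodule.mem_span_range_iff_exists_fun]
    exact exists_congr fun m => eq_comm
  refine ⟨b, fun x => ?_, fun x => ?_, ?_⟩
  · rw [← hmem b x, ← hspan]; rfl
  · rw [← hmem, ← Submodule.traceDual_span_of_basis (A := ℤ) (K := ℚ) _ b hspan, ← FractionalIdeal.coe_dual (A := ℤ) (K := ℚ) I.ne_zero]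
    rfl
  · let B := (fractionalIdealLatticeBasis K I).reindex e
    have h1 := ZSpan.measure_fundamentalDomain B volume (stdBasis K)
    have h2 : ⇑B = mixedEmbedding K ∘ b := by
      funext j
      simp [B, b]
    have h3 : ZSpan.fundamentalDomain B = ZSpan.fundamentalDomain (fractionalIdealLatticeBasis K I) := by
      exact ZSpan.fundamentalDomain_reindex _ _
    rw [h2, h3, volume_fundamentalDomain_stdBasis, mul_one, volume_fundamentalDomain_fractionalIdealLatticeBasis, volume_fundamentalDomain_latticeBasis] at h1
    have h4 := congrArg ENNReal.toReal h1
    rw [ENNReal.toReal_ofReal (abs_nonneg _), ENNReal.toReal_mul, ENNReal.toReal_mul, ENNReal.toReal_ofReal (by exact_mod_cast FractionalIdeal.absNorm_nonneg I.val)] at h4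
    rw [← h4]
    simp
    field_simp
    rw [Int.norm_eq_abs]

lemma det_scaled (y : mixedSpace K) (b : index K → K) :
    |Matrix.det (Matrix.of fun k j => sc K k * (stdBasis K).repr (y * mixedEmbedding K (b j)) k)| =
      mixedEmbedding.norm y * (2 ^ (nrComplexPlaces K) * |(stdBasis K).det (mixedEmbedding K ∘ b)|) := by
  have e : (Matrix.of fun k j => sc K k * (stdBasis K).repr (y * mixedEmbedding K (b j)) k) =
      Matrix.diagonal (sc K) * (LinearMap.toMatrix (stdBasis K) (stdBasis K) (LinearMap.mulLeft ℝ y) * (stdBasis K).toMatrix (mixedEmbedding K ∘ b)) := by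
    ext k j
    rw [Matrix.diagonal_mul, Matrix.of_apply]
    congr 1
    rw [Matrix.mul_apply]
    have := LinearMap.toMatrix_mulVec_repr (stdBasis K) (stdBasis K) (LinearMap.mulLeft ℝ y) (mixedEmbedding K (b j))
    have := congrFun this k
    simp only [LinearMap.mulLeft_apply] at this
    rw [← this]
    rfl
  rw [e, Matrix.det_mul, Matrix.det_mul, LinearMap.det_toMatrix, abs_mul, abs_mul, det_mul, Matrix.det_diagonal, Basis.det_apply]
  have : |∏ i, sc K i| = 2 ^ (nrComplexPlaces K) := by
    rw [Fintype.prod_sum_type, Fintype.prod_prod_type]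
    simp [sc, nrComplexPlaces]
  rw [this]; ring

end DH
end

section
namespace DH
open MeasureTheory Real NumberField NumberField.InfinitePlace NumberField.mixedEmbedding Module
open scoped nonZeroDivisors Classical
set_option linter.unusedSectionVars false
variable (K : Type) [Field K] [NumberField K]

/-- Gaussian on mixed space -/
noncomputable def gf (x : mixedSpace K) : ℝ := Real.exp (-π * QF K x)

/-- covolume -/
noncomputable def DD (I : (FractionalIdeal (𝓞 K)⁰ K)ˣ) : ℝ := √|(discr K : ℝ)| * FractionalIdeal.absNorm I.1

/-- dual -/
noncomputable def dualU (I : (FractionalIdeal (𝓞 K)⁰ K)ˣ) : (FractionalIdeal (𝓞 K)⁰ K)ˣ :=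
  Units.mk0 (FractionalIdeal.dual ℤ ℚ I.1) (FractionalIdeal.dual_ne_zero ℤ ℚ I.ne_zero)

/-- integer combinations of a basis -/
lemma sum_equiv (b : Basis (index K) ℚ K) (J : FractionalIdeal (𝓞 K)⁰ K)
    (hJ : ∀ x : K, x ∈ J ↔ ∃ m : index K → ℤ, x = ∑ j, m j • b j) :
    ∃ e : (index K → ℤ) ≃ {x : K // x ∈ J}, ∀ m, (e m : K) = ∑ j, m j • b j := by
  refine ⟨Equiv.ofBijective (fun m => ⟨∑ j, m j • b j, (hJ _).mpr ⟨m, rfl⟩⟩) ⟨?_, ?_⟩, fun m => rfl⟩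
  · intro m m' h
    have h1 : ∑ j, m j • b j = ∑ j, m' j • b j := congrArg Subtype.val h
    have h2 : ∑ j, (m j : ℚ) • b j = ∑ j, (m' j : ℚ) • b j := by
      simpa only [Int.cast_smul_eq_zsmul] using h1
    funext j
    have := congrFun (congrArg DFunLike.coe (congrArg b.repr h2)) j
    simp only [Basis.repr_sum_self] at this
    exact_mod_cast this
  · rintro ⟨x, hx⟩
    obtain ⟨m, hm⟩ := (hJ x).mp hx
    exact ⟨m, Subtype.ext hm.symm⟩

lemma qf_mul (t : index K → ℝ) (ht : ∀ k, t k ^ 2 = sc K k ^ 2) (y : mixedSpace K) (b : index K → K) (m : index K → ℤ) :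
    qf (Matrix.of fun k j => t k * (stdBasis K).repr (y * mixedEmbedding K (b j)) k) (ivec m) =
      QF K (y * mixedEmbedding K (∑ j, m j • b j)) := by
  unfold qf QF
  apply Finset.sum_congr rfl
  intro k _
  have : ((Matrix.of fun k j => t k * (stdBasis K).repr (y * mixedEmbedding K (b j)) k).mulVec (ivec m)) k = t k * (stdBasis K).repr (y * mixedEmbedding K (∑ j, m j • b j)) k := by
    rw [map_sum, Finset.mul_sum, map_sum]
    simp only [Matrix.mulVec, dotProduct, Matrix.of_apply, ivec, Finsupp.coe_finsetSum, Finset.sum_apply, Finset.mul_sum, map_zsmul, mul_smul_comm]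
    apply Finset.sum_congr rfl
    intro j _
    have : (m j • (y * mixedEmbedding K (b j)) : mixedSpace K) = (m j : ℝ) • (y * mixedEmbedding K (b j)) := by
      rw [Int.cast_smul_eq_zsmul]
    rw [← map_zsmul, this, map_smul, Finsupp.smul_apply, smul_eq_mul]; ring
  rw [this, mul_pow, mul_pow, ht]

theorem theta_eq (I : (FractionalIdeal (𝓞 K)⁰ K)ˣ) (y : mixedSpace K) (hy : mixedEmbedding.norm y ≠ 0) :
    Summable (fun x : {x : K // x ∈ I.1} => gf K (y * mixedEmbedding K x.1)) ∧
    Summable (fun x : {x : K // x ∈ (dualU K I).1} => gf K (y⁻¹ * mixedEmbedding K x.1)) ∧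
    ∑' x : {x : K // x ∈ I.1}, gf K (y * mixedEmbedding K x.1) =
      (mixedEmbedding.norm y * DD K I)⁻¹ * ∑' x : {x : K // x ∈ (dualU K I).1}, gf K (y⁻¹ * mixedEmbedding K x.1) := by
  obtain ⟨b, h1, h2, h3⟩ := exists_basis K I
  obtain ⟨e1, he1⟩ := sum_equiv K b _ h1
  obtain ⟨e2, he2⟩ := sum_equiv K b.traceDual (dualU K I).1 h2
  set A : Matrix (index K) (index K) ℝ := Matrix.of fun k j => sc K k * (stdBasis K).repr (y * mixedEmbedding K (b j)) k with hA
  set B : Matrix (index K) (index K) ℝ := Matrix.of fun k j => sc K k * sg K k * (stdBasis K).repr (y⁻¹ * mixedEmbedding K (b.traceDual j)) k with hB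
  have hAB : A.transpose * B = 1 := by
    ext i j
    rw [Matrix.mul_apply]
    simp only [Matrix.transpose_apply, hA, hB, Matrix.of_apply]
    rw [pairing K y hy, Basis.trace_mul_traceDual, Matrix.one_apply]
    split_ifs <;> simp
  have hBinv : (A⁻¹).transpose = B := by
    rw [Matrix.transpose_nonsing_inv]; exact Matrix.inv_eq_right_inv hAB
  have hdet : A.det ≠ 0 := by
    have := congrArg Matrix.det hAB
    rw [Matrix.det_mul, Matrix.det_transpose, Matrix.det_one] at this
    exact left_ne_zero_of_mul_eq_one this
  have hdetB : B.det ≠ 0 := by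
    have := congrArg Matrix.det hAB
    rw [Matrix.det_mul, Matrix.det_transpose, Matrix.det_one] at this
    exact right_ne_zero_of_mul_eq_one this
  have hP := poisson A hdet
  rw [hBinv] at hP
  have hs : ∀ k, (sc K k * sg K k)^2 = sc K k ^ 2 := by
    intro k
    have : sg K k ^ 2 = 1 := by
      rcases k with k | ⟨k, i⟩
      · simp [sg]
      · simp only [sg, Sum.elim_inr]; split_ifs <;> norm_num
    rw [mul_pow, this, mul_one]
  have hqA : ∀ m, qf A (ivec m) = QF K (y * mixedEmbedding K (e1 m : K)) := fun m => by
    rw [he1]; exact qf_mul K (sc K) (fun _ => rfl) y b m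
  have hqB : ∀ m, qf B (ivec m) = QF K (y⁻¹ * mixedEmbedding K (e2 m : K)) := fun m => by
    rw [he2]; exact qf_mul K _ hs y⁻¹ b.traceDual m
  have hd : |A.det| = mixedEmbedding.norm y * DD K I := by
    rw [hA, det_scaled, h3]; rfl
  refine ⟨?_, ?_, ?_⟩
  · rw [← e1.summable_iff]
    have := summable_shift A hdet 0
    refine this.congr (fun m => ?_)
    simp [gf, ← hqA]
  · rw [← e2.summable_iff]
    have := summable_shift B hdetB 0
    refine this.congr (fun m => ?_)
    simp [gf, ← hqB]
  · rw [← e1.tsum_eq, ← e2.tsum_eq, ← hd]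
    simp only [gf, ← hqA, ← hqB]
    exact hP

lemma dualU_dualU (I : (FractionalIdeal (𝓞 K)⁰ K)ˣ) : dualU K (dualU K I) = I := by
  ext1
  simp [dualU]

lemma DD_pos (I : (FractionalIdeal (𝓞 K)⁰ K)ˣ) : 0 < DD K I := by
  unfold DD
  have h1 : 0 < FractionalIdeal.absNorm I.1 := lt_of_le_of_ne (FractionalIdeal.absNorm_nonneg _) (Ne.symm (by
    rw [Ne, FractionalIdeal.absNorm_eq_zero_iff]; exact I.ne_zero))
  have h2 : 0 < |(discr K : ℝ)| := abs_pos.mpr (by exact_mod_cast discr_ne_zero K)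
  have : (0:ℝ) < FractionalIdeal.absNorm I.1 := by exact_mod_cast h1
  positivity

lemma DD_dual (I : (FractionalIdeal (𝓞 K)⁰ K)ˣ) : DD K (dualU K I) = (DD K I)⁻¹ := by
  obtain ⟨s1, s2, h1⟩ := theta_eq K I 1 (by simp)
  obtain ⟨-, -, h2⟩ := theta_eq K (dualU K I) 1 (by simp)
  rw [dualU_dualU] at h2
  simp only [map_one, one_mul, inv_one] at h1 h2 s1 s2
  rw [h2] at h1
  have hpos : 0 < ∑' x : {x : K // x ∈ I.1}, gf K (mixedEmbedding K x.1) :=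
    s1.tsum_pos (fun _ => (Real.exp_pos _).le) ⟨0, Submodule.zero_mem _⟩ (Real.exp_pos _)
  have p1 := DD_pos K I
  have p2 := DD_pos K (dualU K I)
  field_simp at h1 ⊢
  nlinarith
end DH
end

section
namespace DH
open MeasureTheory Real NumberField NumberField.InfinitePlace NumberField.mixedEmbedding Module
open scoped nonZeroDivisors Classical
set_option linter.unusedSectionVars false
variable (K : Type) [Field K] [NumberField K]

/-- multiplicative Haar measure -/
noncomputable def nu : Measure (mixedSpace K) :=
  volume.withDensity (fun y => ENNReal.ofReal (mixedEmbedding.norm y)⁻¹)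

lemma meas_norm : Measurable (fun y : mixedSpace K => mixedEmbedding.norm y) := by
  exact (mixedEmbedding.continuous_norm K).measurable

lemma meas_dens : Measurable (fun y : mixedSpace K => ENNReal.ofReal (mixedEmbedding.norm y)⁻¹) :=
  (meas_norm K).inv.ennreal_ofReal

lemma lintegral_nu (F : mixedSpace K → ENNReal) (hF : Measurable F) :
    ∫⁻ y, F y ∂(nu K) = ∫⁻ y, ENNReal.ofReal (mixedEmbedding.norm y)⁻¹ * F y := by
  rw [nu, lintegral_withDensity_eq_lintegral_mul _ (meas_dens K) hF]; rfl

lemma ae_nu : ∀ᵐ y ∂(nu K), mixedEmbedding.norm y ≠ 0 := by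
  rw [nu, ae_withDensity_iff (meas_dens K)]
  refine Filter.Eventually.of_forall fun y hy h => hy (by simp [h])

lemma inv_mul_mixed (a : mixedSpace K) (ha : mixedEmbedding.norm a ≠ 0) : a⁻¹ * a = 1 := by
  obtain ⟨h1, h2⟩ := ne_zero_of_norm K ha
  ext v
  · simp [h1 v]
  · simp [h2 v]

lemma nu_smul (a : mixedSpace K) (ha : mixedEmbedding.norm a ≠ 0) (F : mixedSpace K → ENNReal)
    (hF : Measurable F) : ∫⁻ y, F (a * y) ∂(nu K) = ∫⁻ y, F y ∂(nu K) := by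
  have hmul : Measurable (fun y : mixedSpace K => a * y) := (continuous_const.mul continuous_id).measurable
  rw [lintegral_nu K (fun y => F (a * y)) (hF.comp hmul), lintegral_nu K _ hF]
  have hdet : LinearMap.det (LinearMap.mulLeft ℝ a) ≠ 0 := by
    intro h; apply ha; rw [← det_mul, h, abs_zero]
  have key := Measure.map_linearMap_addHaar_eq_smul_addHaar (volume : Measure (mixedSpace K)) hdet
  have hG : Measurable (fun y : mixedSpace K => ENNReal.ofReal (mixedEmbedding.norm y)⁻¹ * F y) := (meas_dens K).mul hF
  have h1 := congrArg (fun μ => ∫⁻ y, ENNReal.ofReal (mixedEmbedding.norm y)⁻¹ * F y ∂μ) key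
  rw [lintegral_smul_measure, lintegral_map hG (by exact hmul), abs_inv, det_mul] at h1
  have hpos : 0 < mixedEmbedding.norm a := lt_of_le_of_ne (mixedEmbedding.norm_nonneg a) (Ne.symm ha)
  have h2 : ∀ y : mixedSpace K, ENNReal.ofReal (mixedEmbedding.norm y)⁻¹ * F (a * y) =
      ENNReal.ofReal (mixedEmbedding.norm a) * (ENNReal.ofReal (mixedEmbedding.norm (a*y))⁻¹ * F (a * y)) := by
    intro y
    rw [← mul_assoc, ← ENNReal.ofReal_mul hpos.le, map_mul]
    congr 2
    field_simp
  simp only [h2]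
  rw [lintegral_const_mul _ (show Measurable (fun y : mixedSpace K => ENNReal.ofReal (mixedEmbedding.norm (a*y))⁻¹ * F (a * y)) from hG.comp hmul)]
  have h3 : ∫⁻ y, ENNReal.ofReal (mixedEmbedding.norm (a*y))⁻¹ * F (a * y) = _ := h1
  rw [h3, smul_eq_mul, ← mul_assoc, ← ENNReal.ofReal_mul hpos.le, mul_inv_cancel₀ ha]
  simp

/-- number of roots of unity -/
noncomputable def wK : ENNReal := (Nat.card (Units.torsion K) : ENNReal)

lemma wK_ne : wK K ≠ 0 ∧ wK K ≠ ⊤ := by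
  constructor
  · simp only [wK, ne_eq, Nat.cast_eq_zero]
    exact Nat.card_pos.ne'
  · simp [wK]

lemma unit_count (z : mixedSpace K) (hz : mixedEmbedding.norm z ≠ 0) :
    ∑' u : (𝓞 K)ˣ, (fundamentalCone K).indicator (fun _ => (1 : ENNReal)) (mixedEmbedding K (u : K) * z) = wK K := by
  obtain ⟨u0, hu0⟩ := fundamentalCone.exists_unit_smul_mem hz
  rw [← (Equiv.mulRight u0).tsum_eq]
  have h1 : ∀ u : (𝓞 K)ˣ, (fundamentalCone K).indicator (fun _ => (1 : ENNReal)) (mixedEmbedding K (((Equiv.mulRight u0) u : (𝓞 K)ˣ) : K) * z)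
      = (Units.torsion K : Set (𝓞 K)ˣ).indicator (fun _ => (1 : ENNReal)) u := by
    intro u
    have h2 : mixedEmbedding K (((Equiv.mulRight u0) u : (𝓞 K)ˣ) : K) * z = u • (u0 • z) := by
      have : ∀ (v : (𝓞 K)ˣ) (y : mixedSpace K), v • y = mixedEmbedding K (v : K) * y := fun v y => rfl
      rw [this, this]
      simp [mul_assoc]
    rw [h2]
    have h3 := fundamentalCone.unit_smul_mem_iff_mem_torsion hu0 u
    by_cases h : u ∈ Units.torsion K
    · rw [Set.indicator_of_mem (h3.mpr h), Set.indicator_of_mem (by exact h)]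
    · rw [Set.indicator_of_notMem (fun h' => h (h3.mp h')), Set.indicator_of_notMem (by exact h)]
  rw [tsum_congr h1, ← tsum_subtype (Units.torsion K : Set (𝓞 K)ˣ) (fun _ => (1 : ENNReal))]
  rw [ENNReal.tsum_const]
  simp only [wK, mul_one, ENat.card_eq_coe_natCard, SetLike.coe_sort_coe]
  rfl
end DH
end

section
namespace DH
open MeasureTheory Real NumberField NumberField.InfinitePlace NumberField.mixedEmbedding Module
open scoped nonZeroDivisors Classical
set_option linter.unusedSectionVars false
variable (K : Type) [Field K] [NumberField K]

/-- pairs (i, x) with x a nonzero element of the i-th ideal -/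
abbrev TT {ι : Type} (b : ι → (FractionalIdeal (𝓞 K)⁰ K)ˣ) : Type :=
  {p : ι × K // p.2 ∈ (b p.1).1 ∧ p.2 ≠ 0}

lemma ideal_sum {ι : Type} (b : ι → (FractionalIdeal (𝓞 K)⁰ K)ˣ)
    (hb : Function.Bijective (fun i => ClassGroup.mk K (b i))) (H : K → ENNReal) (w : ENNReal)
    (hH : ∀ x : K, x ≠ 0 → ∑' u : (𝓞 K)ˣ, H ((u : K) * x) = w) (G : ℝ → ENNReal) :
    ∑' p : TT K b, G (mixedEmbedding.norm (mixedEmbedding K p.1.2) / (FractionalIdeal.absNorm (b p.1.1).1 : ℝ)) * H p.1.2 =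
      (∑' J : {J : Ideal (𝓞 K) // J ≠ ⊥}, G (Ideal.absNorm J.1)) * w := by
  have ex : ∀ J : {J : Ideal (𝓞 K) // J ≠ ⊥}, ∃ i : ι, ∃ x : K,
      (J.1 : FractionalIdeal (𝓞 K)⁰ K) * (b i).1 = FractionalIdeal.spanSingleton (𝓞 K)⁰ x := by
    intro J
    let Ju : (FractionalIdeal (𝓞 K)⁰ K)ˣ := Units.mk0 (J.1 : FractionalIdeal (𝓞 K)⁰ K) (FractionalIdeal.coeIdeal_ne_zero.mpr J.2)
    obtain ⟨i, hi⟩ := hb.2 (ClassGroup.mk K Ju)⁻¹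
    refine ⟨i, ?_⟩
    have h1 : ClassGroup.mk K (Ju * b i) = 1 := by
      rw [map_mul]; simp only at hi; rw [hi, mul_inv_cancel]
    rw [ClassGroup.mk_eq_one_iff, FractionalIdeal.isPrincipal_iff] at h1
    simpa [Ju] using h1
  choose iJ xJ hJ using ex
  have hx0 : ∀ J, xJ J ≠ 0 := by
    intro J h
    have := hJ J
    rw [h, FractionalIdeal.spanSingleton_zero] at this
    rcases mul_eq_zero.mp this with h' | h'
    · exact FractionalIdeal.coeIdeal_ne_zero.mpr J.2 h'
    · exact (b (iJ J)).ne_zero h'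
  have hunit : ∀ (u : (𝓞 K)ˣ) (x : K), FractionalIdeal.spanSingleton (𝓞 K)⁰ ((u : K) * x) = FractionalIdeal.spanSingleton (𝓞 K)⁰ x := by
    intro u x
    symm
    rw [FractionalIdeal.spanSingleton_eq_spanSingleton]
    exact ⟨u, by rw [Units.smul_def, Algebra.smul_def]⟩
  have hmem : ∀ J (u : (𝓞 K)ˣ), (u : K) * xJ J ∈ (b (iJ J)).1 := by
    intro J u
    rw [← FractionalIdeal.spanSingleton_le_iff_mem, hunit, ← hJ]
    calc _ ≤ 1 * (b (iJ J)).1 := by gcongr; exact FractionalIdeal.coeIdeal_le_one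
      _ = _ := one_mul _
  have hu0 : ∀ u : (𝓞 K)ˣ, ((u : 𝓞 K) : K) ≠ 0 := fun u => by simp
  let Φ : ({J : Ideal (𝓞 K) // J ≠ ⊥} × (𝓞 K)ˣ) → TT K b := fun q =>
    ⟨(iJ q.1, (q.2 : K) * xJ q.1), hmem q.1 q.2, mul_ne_zero (hu0 _) (hx0 _)⟩
  have hΦ : Function.Bijective Φ := by
    constructor
    · rintro ⟨J, u⟩ ⟨J', u'⟩ h
      have h1 : iJ J = iJ J' := congrArg (fun p : TT K b => p.1.1) h
      have h2 : (u : K) * xJ J = (u' : K) * xJ J' := congrArg (fun p : TT K b => p.1.2) h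
      have h3 := congrArg (FractionalIdeal.spanSingleton (𝓞 K)⁰) h2
      rw [hunit, hunit, ← hJ, ← hJ, h1] at h3
      have h4 := mul_right_cancel₀ (b (iJ J')).ne_zero h3
      rw [FractionalIdeal.coeIdeal_inj] at h4
      have h5 : J = J' := Subtype.ext h4
      subst h5
      have h6 := mul_right_cancel₀ (hx0 J) h2
      have h7 : u = u' := Units.ext (RingOfIntegers.ext h6)
      rw [h7]
    · rintro ⟨⟨i, x⟩, hx, hx0'⟩
      simp only at hx hx0'
      have h1 : FractionalIdeal.spanSingleton (𝓞 K)⁰ x * (b i)⁻¹.1 ≤ 1 := by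
        calc _ ≤ (b i).1 * (b i)⁻¹.1 := by gcongr; rwa [FractionalIdeal.spanSingleton_le_iff_mem]
          _ = 1 := Units.mul_inv _
      obtain ⟨J, hJe⟩ := FractionalIdeal.le_one_iff_exists_coeIdeal.mp h1
      have h2 : (J : FractionalIdeal (𝓞 K)⁰ K) * (b i).1 = FractionalIdeal.spanSingleton (𝓞 K)⁰ x := by
        rw [hJe, mul_assoc, Units.inv_mul, mul_one]
      have hJ0 : J ≠ ⊥ := by
        rintro rfl
        simp only [FractionalIdeal.coeIdeal_bot, zero_mul] at h2
        exact hx0' (FractionalIdeal.spanSingleton_eq_zero_iff.mp h2.symm)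
      let JJ : {J : Ideal (𝓞 K) // J ≠ ⊥} := ⟨J, hJ0⟩
      have princ : ∀ j y, (J : FractionalIdeal (𝓞 K)⁰ K) * (b j).1 = FractionalIdeal.spanSingleton (𝓞 K)⁰ y →
          ClassGroup.mk K (b j) = (ClassGroup.mk K (Units.mk0 (J : FractionalIdeal (𝓞 K)⁰ K) (FractionalIdeal.coeIdeal_ne_zero.mpr hJ0)))⁻¹ := by
        intro j y hy
        rw [eq_inv_iff_mul_eq_one, mul_comm, ← map_mul, ClassGroup.mk_eq_one_iff, FractionalIdeal.isPrincipal_iff]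
        exact ⟨y, by simpa using hy⟩
      have h3 : iJ JJ = i := hb.1 (by simp only; rw [princ i x h2, princ _ _ (hJ JJ)])
      have h4 := hJ JJ
      rw [h3] at h4
      have h5 : FractionalIdeal.spanSingleton (𝓞 K)⁰ (xJ JJ) = FractionalIdeal.spanSingleton (𝓞 K)⁰ x := by
        rw [← h4, ← h2]
      obtain ⟨u, hu⟩ := FractionalIdeal.spanSingleton_eq_spanSingleton.mp h5
      refine ⟨(JJ, u), Subtype.ext (Prod.ext h3 ?_)⟩
      rw [Units.smul_def, Algebra.smul_def] at hu
      exact hu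
  rw [← (Equiv.ofBijective Φ hΦ).tsum_eq, ENNReal.tsum_prod', ← ENNReal.tsum_mul_right]
  refine tsum_congr fun J => ?_
  have hN : ∀ u : (𝓞 K)ˣ, mixedEmbedding.norm (mixedEmbedding K ((u : K) * xJ J)) / (FractionalIdeal.absNorm (b (iJ J)).1 : ℝ) = Ideal.absNorm J.1 := by
    intro u
    have h1 := congrArg FractionalIdeal.absNorm (hJ J)
    rw [← hunit u, map_mul, FractionalIdeal.absNorm_span_singleton, FractionalIdeal.coeIdeal_absNorm] at h1
    rw [mixedEmbedding.norm_eq_norm, ← h1]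
    have : (FractionalIdeal.absNorm (b (iJ J)).1 : ℚ) ≠ 0 := by
      rw [Ne, FractionalIdeal.absNorm_eq_zero_iff]; exact (b (iJ J)).ne_zero
    have : (FractionalIdeal.absNorm (b (iJ J)).1 : ℝ) ≠ 0 := by exact_mod_cast this
    push_cast
    field_simp
  have : ∀ u : (𝓞 K)ˣ, (G (mixedEmbedding.norm (mixedEmbedding K ((Equiv.ofBijective Φ hΦ) (J,u)).1.2) / (FractionalIdeal.absNorm (b ((Equiv.ofBijective Φ hΦ) (J,u)).1.1).1 : ℝ)) * H ((Equiv.ofBijective Φ hΦ) (J,u)).1.2)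
      = G (Ideal.absNorm J.1) * H ((u : K) * xJ J) := by
    intro u
    rw [← hN u]; rfl
  rw [tsum_congr this, ENNReal.tsum_mul_left, hH _ (hx0 J)]
end DH
end

section
namespace DH
open MeasureTheory Real NumberField NumberField.InfinitePlace NumberField.mixedEmbedding Module
open scoped nonZeroDivisors Classical
set_option linter.unusedSectionVars false
variable (K : Type) [Field K] [NumberField K]

instance countK : Countable K := by
  exact Countable.of_equiv _ (Module.finBasis ℚ K).equivFun.toEquiv.symm

lemma unfold_sum {ι : Type} [Countable ι] (b : ι → (FractionalIdeal (𝓞 K)⁰ K)ˣ)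
    (hb : Function.Bijective (fun i => ClassGroup.mk K (b i))) (θ : K → mixedSpace K) (e : (𝓞 K)ˣ ≃ (𝓞 K)ˣ)
    (hθ0 : ∀ x, x ≠ 0 → mixedEmbedding.norm (θ x) ≠ 0)
    (hθ : ∀ (u : (𝓞 K)ˣ) x, x ≠ 0 → θ ((u : K) * x) = mixedEmbedding K (e u : K) * θ x)
    (P : mixedSpace K → ENNReal) (hP : Measurable P) (G : ℝ → ENNReal) :
    ∑' p : TT K b, ∫⁻ y in fundamentalCone K, 
      G (mixedEmbedding.norm (mixedEmbedding K p.1.2) / (FractionalIdeal.absNorm (b p.1.1).1 : ℝ)) * P (y * (θ p.1.2)⁻¹) ∂(nu K) =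
      (∫⁻ y, P y ∂(nu K)) * ((∑' J : {J : Ideal (𝓞 K) // J ≠ ⊥}, G (Ideal.absNorm J.1)) * wK K) := by
  have hC : MeasurableSet (fundamentalCone K) := measurableSet_fundamentalCone K
  set χ : mixedSpace K → ENNReal := (fundamentalCone K).indicator (fun _ => 1) with hχ
  have hχm : Measurable χ := measurable_const.indicator hC
  have hmulr : ∀ a : mixedSpace K, Measurable (fun y : mixedSpace K => y * a) := fun a => (continuous_id.mul continuous_const).measurable
  have h1 : ∀ p : TT K b, ∫⁻ y in fundamentalCone K, 
      G (mixedEmbedding.norm (mixedEmbedding K p.1.2) / (FractionalIdeal.absNorm (b p.1.1).1 : ℝ)) * P (y * (θ p.1.2)⁻¹) ∂(nu K)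
      = ∫⁻ z, P z * (G (mixedEmbedding.norm (mixedEmbedding K p.1.2) / (FractionalIdeal.absNorm (b p.1.1).1 : ℝ)) * χ (z * θ p.1.2)) ∂(nu K) := by
    intro p
    have hp0 := hθ0 _ p.2.2
    set g := G (mixedEmbedding.norm (mixedEmbedding K p.1.2) / (FractionalIdeal.absNorm (b p.1.1).1 : ℝ))
    have hF : Measurable (fun z => P z * (g * χ (z * θ p.1.2))) := hP.mul ((hχm.comp (hmulr _)).const_mul _)
    have hai : mixedEmbedding.norm (θ p.1.2)⁻¹ ≠ 0 := by rw [norm_inv']; exact inv_ne_zero hp0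
    rw [← nu_smul K _ hai _ hF, ← lintegral_indicator hC]
    congr 1
    funext y
    have : (θ p.1.2)⁻¹ * y * θ p.1.2 = y := by
      rw [mul_right_comm, inv_mul_mixed K _ hp0, one_mul]
    rw [this, mul_comm _ y]
    by_cases hy : y ∈ fundamentalCone K
    · simp [hχ, hy, mul_comm]
    · simp [hχ, hy]
  rw [tsum_congr h1, ← lintegral_tsum, ← lintegral_mul_const _ hP]
  · refine lintegral_congr_ae ?_
    filter_upwards [ae_nu K] with z hz
    rw [ENNReal.tsum_mul_left]
    congr 1
    refine ideal_sum K b hb (fun x => χ (z * θ x)) (wK K) ?_ G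
    intro x hx
    have : ∀ u : (𝓞 K)ˣ, χ (z * θ ((u : K) * x)) = (fundamentalCone K).indicator (fun _ => (1 : ENNReal)) (mixedEmbedding K (e u : K) * (z * θ x)) := by
      intro u
      rw [hθ u x hx, hχ]
      congr 1
      ring
    rw [tsum_congr this]
    rw [e.tsum_eq (fun u => (fundamentalCone K).indicator (fun _ => (1 : ENNReal)) (mixedEmbedding K (u : K) * (z * θ x)))]
    exact unit_count K _ (by rw [map_mul]; exact mul_ne_zero hz (hθ0 x hx))
  · intro p
    exact (hP.mul ((hχm.comp (hmulr _)).const_mul _)).aemeasurable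

lemma emb_inv (x : K) : mixedEmbedding K x⁻¹ = (mixedEmbedding K x)⁻¹ := by
  ext v
  · simp [mixedEmbedding]
  · simp [mixedEmbedding]

lemma emb_norm_ne (x : K) (hx : x ≠ 0) : mixedEmbedding.norm (mixedEmbedding K x) ≠ 0 := by
  rw [mixedEmbedding.norm_eq_norm]
  simp [hx]

lemma meas_gf : Measurable (gf K) := by
  unfold gf
  have : gf K = fun x => Real.exp (-π * (∑ v, (x.1 v)^2 + ∑ v, 2 * ‖x.2 v‖^2)) := by
    funext x; rw [gf, QF_eq]
  have h2 : Measurable (gf K) := by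
    rw [this]
    refine Continuous.measurable ?_
    fun_prop
  exact h2

/-- integrand -/
noncomputable def QQ (σ : ℝ) (y : mixedSpace K) : ENNReal := ENNReal.ofReal (gf K y * mixedEmbedding.norm y ^ σ)

lemma meas_QQ (σ : ℝ) : Measurable (QQ K σ) := by
  unfold QQ
  exact ((meas_gf K).mul ((meas_norm K).pow_const σ)).ennreal_ofReal

/-- zeta as an ENNReal series -/
noncomputable def ZZ (σ : ℝ) : ENNReal := ∑' J : {J : Ideal (𝓞 K) // J ≠ ⊥}, ENNReal.ofReal ((Ideal.absNorm J.1 : ℝ) ^ (-σ))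

/-- nonzero part of theta -/
noncomputable def th0 (I : (FractionalIdeal (𝓞 K)⁰ K)ˣ) (y : mixedSpace K) : ENNReal :=
  ∑' x : {x : K // x ∈ I.1 ∧ x ≠ 0}, ENNReal.ofReal (gf K (y * mixedEmbedding K x.1))

lemma meas_th0 (I : (FractionalIdeal (𝓞 K)⁰ K)ˣ) : Measurable (th0 K I) := by
  unfold th0
  refine Measurable.tsum fun x => ?_
  exact ((meas_gf K).comp (continuous_id.mul continuous_const).measurable).ennreal_ofReal

lemma moment {ι : Type} [Countable ι] (b : ι → (FractionalIdeal (𝓞 K)⁰ K)ˣ)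
    (hb : Function.Bijective (fun i => ClassGroup.mk K (b i))) (θ : K → mixedSpace K) (e : (𝓞 K)ˣ ≃ (𝓞 K)ˣ)
    (hθ0 : ∀ x, x ≠ 0 → mixedEmbedding.norm (θ x) ≠ 0)
    (hθ : ∀ (u : (𝓞 K)ˣ) x, x ≠ 0 → θ ((u : K) * x) = mixedEmbedding K (e u : K) * θ x)
    (P : mixedSpace K → ENNReal) (hP : Measurable P) (σ : ℝ) (j : mixedSpace K → mixedSpace K) (hj : Measurable j)
    (hPQ : ∀ x, x ≠ 0 → ∀ y, QQ K σ (j y * mixedEmbedding K x) = P (y * (θ x)⁻¹)) :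
    ∑' i, ∫⁻ y in fundamentalCone K, ENNReal.ofReal ((mixedEmbedding.norm (j y) * DD K (b i)) ^ σ) * th0 K (b i) (j y) ∂(nu K)
      = ENNReal.ofReal (√|(discr K : ℝ)| ^ σ) * ((∫⁻ y, P y ∂(nu K)) * (ZZ K σ * wK K)) := by
  rw [ZZ]
  have := unfold_sum K b hb θ e hθ0 hθ P hP (fun r => ENNReal.ofReal (r ^ (-σ)))
  rw [← this]
  rw [← (Equiv.subtypeProdEquivSigmaSubtype (fun i x => x ∈ (b i).1 ∧ x ≠ 0)).symm.tsum_eq, ENNReal.tsum_sigma', ← ENNReal.tsum_mul_left]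
  refine tsum_congr fun i => ?_
  rw [← ENNReal.tsum_mul_left]
  have hmm : ∀ x : {x : K // x ∈ (b i).1 ∧ x ≠ 0}, Measurable (fun y => ENNReal.ofReal (gf K (j y * mixedEmbedding K x.1))) := by
    intro x
    exact ((meas_gf K).comp (hj.mul_const _)).ennreal_ofReal
  have hmj : Measurable (fun y => ENNReal.ofReal ((mixedEmbedding.norm (j y) * DD K (b i)) ^ σ)) :=
    ((((meas_norm K).comp hj).mul_const _).pow_const σ).ennreal_ofReal
  simp only [th0, ← ENNReal.tsum_mul_left]
  rw [lintegral_tsum]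
  · refine tsum_congr fun x => ?_
    rw [← lintegral_const_mul]
    · refine lintegral_congr fun y => ?_
      have h1 : P (y * (θ x.1)⁻¹) = _ := (hPQ x.1 x.2.2 y).symm
      have hN : (0:ℝ) < FractionalIdeal.absNorm (b i).1 := by
        have h := DD_pos K (b i)
        rw [DD] at h
        exact pos_of_mul_pos_right h (Real.sqrt_nonneg _)
      have hx := lt_of_le_of_ne (mixedEmbedding.norm_nonneg _) (emb_norm_ne K x.1 x.2.2).symm
      have hy := mixedEmbedding.norm_nonneg (j y)
      change _ = ENNReal.ofReal (√|(discr K : ℝ)| ^ σ) * (ENNReal.ofReal ((mixedEmbedding.norm (mixedEmbedding K x.1) / (FractionalIdeal.absNorm (b i).1 : ℝ)) ^ (-σ)) * P (y * (θ x.1)⁻¹))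
      rw [h1, QQ, DD, map_mul, ← ENNReal.ofReal_mul (by positivity), ← ENNReal.ofReal_mul (by positivity), ← ENNReal.ofReal_mul (by positivity)]
      congr 1
      rw [Real.mul_rpow hy (by positivity), Real.mul_rpow (by positivity) hN.le, Real.mul_rpow hy hx.le, Real.div_rpow hx.le hN.le,
        Real.rpow_neg hx.le, Real.rpow_neg hN.le]
      have := Real.rpow_pos_of_pos hx σ
      have := Real.rpow_pos_of_pos hN σ
      field_simp
    · refine Measurable.const_mul ?_ _
      exact hP.comp (continuous_id.mul continuous_const).measurable
  · intro x
    exact (hmj.mul (hmm x)).aemeasurable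
end DH
end

section
namespace DH
open MeasureTheory Real NumberField NumberField.InfinitePlace NumberField.mixedEmbedding Module
open scoped nonZeroDivisors Classical
set_option linter.unusedSectionVars false
variable (K : Type) [Field K] [NumberField K]

lemma meas_inv : Measurable (fun y : mixedSpace K => y⁻¹) := by
  have : (fun y : mixedSpace K => y⁻¹) = fun y => ((fun v => (y.1 v)⁻¹), (fun v => (y.2 v)⁻¹)) := rfl
  rw [this]
  fun_prop

lemma moment_direct {ι : Type} [Countable ι] (b : ι → (FractionalIdeal (𝓞 K)⁰ K)ˣ)
    (hb : Function.Bijective (fun i => ClassGroup.mk K (b i))) (σ : ℝ) :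
    ∑' i, ∫⁻ y in fundamentalCone K, ENNReal.ofReal ((mixedEmbedding.norm y * DD K (b i)) ^ σ) * th0 K (b i) y ∂(nu K)
      = ENNReal.ofReal (√|(discr K : ℝ)| ^ σ) * ((∫⁻ y, QQ K σ y ∂(nu K)) * (ZZ K σ * wK K)) := by
  refine moment K b hb (fun x => mixedEmbedding K x⁻¹) (Equiv.inv _) ?_ ?_ (QQ K σ) (meas_QQ K σ) σ id measurable_id ?_
  · intro x hx; exact emb_norm_ne K _ (inv_ne_zero hx)
  · intro u x hx
    rw [← map_mul, mul_inv]
    congr 2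
    simp
  · intro x hx y
    rw [emb_inv, inv_inv]; rfl

lemma moment_dual {ι : Type} [Countable ι] (b : ι → (FractionalIdeal (𝓞 K)⁰ K)ˣ)
    (hb : Function.Bijective (fun i => ClassGroup.mk K (b i))) (σ : ℝ) :
    ∑' i, ∫⁻ y in fundamentalCone K, ENNReal.ofReal ((mixedEmbedding.norm y⁻¹ * DD K (b i)) ^ σ) * th0 K (b i) y⁻¹ ∂(nu K)
      = ENNReal.ofReal (√|(discr K : ℝ)| ^ σ) * ((∫⁻ y, QQ K σ y⁻¹ ∂(nu K)) * (ZZ K σ * wK K)) := by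
  refine moment K b hb (fun x => mixedEmbedding K x) (Equiv.refl _) ?_ ?_ (fun y => QQ K σ y⁻¹) ((meas_QQ K σ).comp (meas_inv K)) σ (fun y => y⁻¹) (meas_inv K) ?_
  · intro x hx; exact emb_norm_ne K _ hx
  · intro u x hx
    rw [map_mul]; rfl
  · intro x hx y
    simp only [mul_inv, inv_inv]

lemma dual_bij {ι : Type} (b : ι → (FractionalIdeal (𝓞 K)⁰ K)ˣ)
    (hb : Function.Bijective (fun i => ClassGroup.mk K (b i))) :
    Function.Bijective (fun i => ClassGroup.mk K (dualU K (b i))) := by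
  have h : ∀ I, dualU K I = dualU K 1 * I⁻¹ := by
    intro I
    apply Units.ext
    simp only [dualU, Units.val_mk0, Units.val_mul, Units.val_inv_eq_inv_val]
    rw [FractionalIdeal.dual_eq_mul_inv]; rfl
  have : (fun i => ClassGroup.mk K (dualU K (b i))) =
      (Equiv.mulLeft (ClassGroup.mk K (dualU K 1))) ∘ (Equiv.inv _) ∘ (fun i => ClassGroup.mk K (b i)) := by
    funext i
    simp only [Function.comp, Equiv.coe_mulLeft, Equiv.inv_apply]
    rw [h, map_mul, map_inv]
  rw [this]
  exact (Equiv.bijective _).comp ((Equiv.bijective _).comp hb)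

lemma tsum_split (I : (FractionalIdeal (𝓞 K)⁰ K)ˣ) (f : K → ENNReal) :
    ∑' x : {x : K // x ∈ I.1}, f x.1 = f 0 + ∑' x : {x : K // x ∈ I.1 ∧ x ≠ 0}, f x.1 := by
  have h0 : (0 : K) ∈ I.1 := Submodule.zero_mem (I.1 : Submodule (𝓞 K) K)
  have hS : {x : K | x ∈ I.1} = {0} ∪ {x : K | x ∈ I.1 ∧ x ≠ 0} := by
    ext x
    by_cases hx : x = 0
    · subst hx; simpa using h0
    · simp [hx]
  have hd : Disjoint ({0} : Set K) {x : K | x ∈ I.1 ∧ x ≠ 0} := by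
    rw [Set.disjoint_singleton_left]; simp
  have h1 := Summable.tsum_union_disjoint (f := f) hd ENNReal.summable ENNReal.summable
  rw [← hS, tsum_singleton] at h1
  exact h1

lemma theta_ennreal (I : (FractionalIdeal (𝓞 K)⁰ K)ˣ) (y : mixedSpace K) (hy : mixedEmbedding.norm y ≠ 0) :
    1 + th0 K I y = ENNReal.ofReal (mixedEmbedding.norm y * DD K I)⁻¹ * (1 + th0 K (dualU K I) y⁻¹) := by
  obtain ⟨h1, h2, h3⟩ := theta_eq K I y hy
  have hg0 : ∀ z, 0 ≤ gf K z := fun z => (Real.exp_pos _).le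
  have hz : ∀ z : mixedSpace K, ENNReal.ofReal (gf K (z * mixedEmbedding K 0)) = 1 := by
    intro z; simp [gf, QF_eq]
  have h4 := congrArg ENNReal.ofReal h3
  have hpos : 0 ≤ (mixedEmbedding.norm y * DD K I)⁻¹ := by
    have := DD_pos K I
    have := mixedEmbedding.norm_nonneg y
    positivity
  rw [ENNReal.ofReal_mul hpos, ENNReal.ofReal_tsum_of_nonneg (fun _ => hg0 _) h1, ENNReal.ofReal_tsum_of_nonneg (fun _ => hg0 _) h2] at h4
  rw [tsum_split K I (fun x => ENNReal.ofReal (gf K (y * mixedEmbedding K x))),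
    tsum_split K (dualU K I) (fun x => ENNReal.ofReal (gf K (y⁻¹ * mixedEmbedding K x))), hz, hz] at h4
  exact h4

end DH
end

section
namespace DH
open MeasureTheory Real NumberField NumberField.InfinitePlace NumberField.mixedEmbedding Module
open scoped nonZeroDivisors Classical
set_option linter.unusedSectionVars false
variable (K : Type) [Field K] [NumberField K]

lemma exists_root (c : ℝ) (hc : 0 < c) : ∃ t : ℝ, 0 < t ∧ t ^ finrank ℚ K = c := by
  refine ⟨c ^ ((finrank ℚ K : ℝ)⁻¹), Real.rpow_pos_of_pos hc _, ?_⟩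
  exact Real.rpow_inv_natCast_pow hc.le finrank_pos.ne'

lemma cone_scale (c : ℝ) (hc : 0 < c) (f : ℝ → ENNReal) (hf : Measurable f) :
    ∫⁻ y in fundamentalCone K, f (mixedEmbedding.norm y * c) ∂(nu K) = ∫⁻ y in fundamentalCone K, f (mixedEmbedding.norm y) ∂(nu K) := by
  obtain ⟨t, ht, htc⟩ := exists_root K c hc
  have hC : MeasurableSet (fundamentalCone K) := measurableSet_fundamentalCone K
  rw [← lintegral_indicator hC, ← lintegral_indicator hC]
  have hm : Measurable ((fundamentalCone K).indicator (fun y => f (mixedEmbedding.norm y))) :=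
    (hf.comp (meas_norm K)).indicator hC
  have hn : mixedEmbedding.norm (t • (1 : mixedSpace K)) = c := by
    rw [mixedEmbedding.norm_smul, map_one, mul_one, abs_of_pos ht, htc]
  rw [← nu_smul K (t • 1) (by rw [hn]; exact hc.ne') _ hm]
  refine lintegral_congr fun y => ?_
  have h1 : (t • (1 : mixedSpace K)) * y = t • y := by rw [smul_mul_assoc, one_mul]
  have h2 : mixedEmbedding.norm (t • y) = mixedEmbedding.norm y * c := by
    rw [← h1, map_mul, hn, mul_comm]
  rw [h1]
  by_cases hy : y ∈ fundamentalCone K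
  · rw [Set.indicator_of_mem hy, Set.indicator_of_mem ((fundamentalCone.smul_mem_iff_mem ht.ne').mpr hy), h2]
  · rw [Set.indicator_of_notMem hy, Set.indicator_of_notMem (fun h => hy ((fundamentalCone.smul_mem_iff_mem ht.ne').mp h))]

lemma vol_cone (s : ℝ) (hs : 0 < s) : volume (fundamentalCone K ∩ {x | mixedEmbedding.norm x ≤ s}) =
    ENNReal.ofReal s * volume (fundamentalCone.normLeOne K) := by
  obtain ⟨t, ht, htc⟩ := exists_root K s hs
  have : fundamentalCone K ∩ {x | mixedEmbedding.norm x ≤ s} = (fun y => t⁻¹ • y) ⁻¹' (fundamentalCone.normLeOne K) := by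
    ext y
    simp only [Set.mem_inter_iff, Set.mem_preimage, fundamentalCone.smul_mem_iff_mem (inv_ne_zero ht.ne')]
    refine and_congr_right fun _ => ?_
    change mixedEmbedding.norm y ≤ s ↔ mixedEmbedding.norm (t⁻¹ • y) ≤ 1
    rw [mixedEmbedding.norm_smul, abs_of_pos (inv_pos.mpr ht), inv_pow, htc, inv_mul_le_iff₀ hs, mul_one]
  rw [this, Measure.addHaar_preimage_smul _ (inv_ne_zero ht.ne'), mixedEmbedding.finrank, inv_pow, htc, inv_inv, abs_of_pos hs]

lemma vol_fin : volume (fundamentalCone.normLeOne K) ≠ ⊤ := by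
  rw [fundamentalCone.volume_normLeOne]
  finiteness

lemma map_cone : (volume.restrict (fundamentalCone.normLeOne K)).map (fun y => mixedEmbedding.norm y) =
    volume (fundamentalCone.normLeOne K) • (volume.restrict (Set.Ioc (0:ℝ) 1)) := by
  have : IsFiniteMeasure (volume.restrict (fundamentalCone.normLeOne K)) := ⟨by simpa using (vol_fin K).lt_top⟩
  have hm := meas_norm K
  apply Measure.ext_of_Iic
  intro a
  rw [Measure.map_apply hm measurableSet_Iic, Measure.restrict_apply (hm measurableSet_Iic), Measure.smul_apply, Measure.restrict_apply measurableSet_Iic, smul_eq_mul]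
  have h1 : (fun y : mixedSpace K => mixedEmbedding.norm y) ⁻¹' Set.Iic a ∩ fundamentalCone.normLeOne K = fundamentalCone K ∩ {x | mixedEmbedding.norm x ≤ min a 1} := by
    ext y
    simp only [Set.mem_inter_iff, Set.mem_preimage, Set.mem_Iic, Set.mem_ofPred_eq, le_min_iff]
    tauto
  have h2 : Set.Iic a ∩ Set.Ioc (0:ℝ) 1 = Set.Ioc 0 (min a 1) := by
    ext y
    simp only [Set.mem_inter_iff, Set.mem_Iic, Set.mem_Ioc, le_min_iff]
    tauto
  rw [h1, h2, Real.volume_Ioc, sub_zero]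
  by_cases h : 0 < min a 1
  · rw [vol_cone K _ h, mul_comm]
  · have : fundamentalCone K ∩ {x | mixedEmbedding.norm x ≤ min a 1} = ∅ := by
      rw [Set.eq_empty_iff_forall_notMem]
      rintro y ⟨hy1, hy2⟩
      exact h (lt_of_lt_of_le (fundamentalCone.norm_pos_of_mem hy1) hy2)
    rw [this, ENNReal.ofReal_of_nonpos (not_lt.mp h)]
    simp

lemma cone_term (a : ℝ) (ha : 0 < a) :
    ∫⁻ y in fundamentalCone K, (Set.Iic (1:ℝ)).indicator (fun v => ENNReal.ofReal (v ^ a)) (mixedEmbedding.norm y) ∂(nu K)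
      = ENNReal.ofReal ((volume (fundamentalCone.normLeOne K)).toReal / a) := by
  have hC : MeasurableSet (fundamentalCone K) := measurableSet_fundamentalCone K
  have hpm : ∀ c : ℝ, Measurable (fun v : ℝ => ENNReal.ofReal (v ^ c)) := fun c => (measurable_id.pow_const c).ennreal_ofReal
  have hf : Measurable ((Set.Iic (1:ℝ)).indicator (fun v => ENNReal.ofReal (v ^ a))) := (hpm a).indicator measurableSet_Iic
  rw [← lintegral_indicator hC, lintegral_nu K ((fundamentalCone K).indicator (fun y => (Set.Iic (1:ℝ)).indicator (fun v => ENNReal.ofReal (v ^ a)) (mixedEmbedding.norm y))) ((hf.comp (meas_norm K)).indicator hC)]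
  have h1 : ∀ y : mixedSpace K, ENNReal.ofReal (mixedEmbedding.norm y)⁻¹ *
      (fundamentalCone K).indicator (fun y => (Set.Iic (1:ℝ)).indicator (fun v => ENNReal.ofReal (v ^ a)) (mixedEmbedding.norm y)) y
      = (fundamentalCone.normLeOne K).indicator (fun y => ENNReal.ofReal (mixedEmbedding.norm y ^ (a - 1))) y := by
    intro y
    by_cases hy : y ∈ fundamentalCone K
    · rw [Set.indicator_of_mem hy]
      have hp := fundamentalCone.norm_pos_of_mem hy
      by_cases h1 : mixedEmbedding.norm y ≤ 1
      · rw [Set.indicator_of_mem (by exact h1), Set.indicator_of_mem (fundamentalCone.mem_normLeOne.mpr ⟨hy, h1⟩), ← ENNReal.ofReal_mul (by positivity),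
          Real.rpow_sub_one hp.ne']
        congr 1
        field_simp
      · rw [Set.indicator_of_notMem (by exact h1), Set.indicator_of_notMem (fun h => h1 (fundamentalCone.mem_normLeOne.mp h).2), mul_zero]
    · rw [Set.indicator_of_notMem hy, Set.indicator_of_notMem (fun h => hy (fundamentalCone.mem_normLeOne.mp h).1), mul_zero]
  rw [lintegral_congr h1, lintegral_indicator (fundamentalCone.measurableSet_normLeOne K)]
  have h2 := lintegral_map (μ := volume.restrict (fundamentalCone.normLeOne K)) (hpm (a-1)) (meas_norm K)
  rw [← h2, map_cone, lintegral_smul_measure, smul_eq_mul]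
  have h3 : ∫⁻ v in Set.Ioc (0:ℝ) 1, ENNReal.ofReal (v ^ (a-1)) = ENNReal.ofReal (1 / a) := by
    have hi : IntervalIntegrable (fun v : ℝ => v ^ (a-1)) volume 0 1 := intervalIntegral.intervalIntegrable_rpow' (by linarith)
    rw [intervalIntegrable_iff_integrableOn_Ioc_of_le zero_le_one] at hi
    rw [← ofReal_integral_eq_lintegral_ofReal hi, ← intervalIntegral.integral_of_le zero_le_one, integral_rpow (Or.inl (by linarith))]
    · simp [ha.ne']
    · refine (ae_restrict_iff' measurableSet_Ioc).mpr (Filter.Eventually.of_forall fun v hv => ?_)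
      exact Real.rpow_nonneg hv.1.le _
  rw [h3, div_eq_mul_one_div (ENNReal.toReal _) a, ENNReal.ofReal_mul ENNReal.toReal_nonneg, ENNReal.ofReal_toReal (vol_fin K)]

end DH
end

section
namespace DH
open MeasureTheory Real NumberField NumberField.InfinitePlace NumberField.mixedEmbedding Module
open scoped nonZeroDivisors Classical
set_option linter.unusedSectionVars false
variable (K : Type) [Field K] [NumberField K]

lemma lint_sum {ι : Type} [Countable ι] (v : ι → mixedSpace K → ℝ) (hv : ∀ i, Measurable (v i)) (d : ι → mixedSpace K → ENNReal) (hd : ∀ i, Measurable (d i))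
    (f : ℝ → ENNReal) (hf : Measurable f) :
    ∫⁻ r, f r ∂(Measure.sum (fun i => (((nu K).restrict (fundamentalCone K)).withDensity (d i)).map (v i))) =
    ∑' i, ∫⁻ y in fundamentalCone K, f (v i y) * d i y ∂(nu K) := by
  rw [lintegral_sum_measure]
  refine tsum_congr fun i => ?_
  rw [lintegral_map hf (hv i), lintegral_withDensity_eq_lintegral_mul _ (hd i) (show Measurable (fun y => f (v i y)) from hf.comp (hv i))]
  refine lintegral_congr fun y => ?_
  simp [mul_comm]

theorem measures_exist : ∃ (μA μB m : Measure ℝ) (V : ℝ), 0 ≤ V ∧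
    (∀ σ : ℝ, ∫⁻ v, ENNReal.ofReal (v ^ σ) ∂μA = ENNReal.ofReal (√|(discr K : ℝ)| ^ σ) * ((∫⁻ y, QQ K σ y ∂(nu K)) * (ZZ K σ * wK K))) ∧
    (∀ σ : ℝ, ∫⁻ v, ENNReal.ofReal (v ^ (-σ)) ∂μB = ENNReal.ofReal (√|(discr K : ℝ)| ^ σ) * ((∫⁻ y, QQ K σ y⁻¹ ∂(nu K)) * (ZZ K σ * wK K))) ∧
    (∀ f : ℝ → ENNReal, Measurable f → ∫⁻ v, f v ∂μA + ∫⁻ v, f v ∂m = ∫⁻ v, ENNReal.ofReal v⁻¹ * f v ∂μB + ∫⁻ v, ENNReal.ofReal v⁻¹ * f v ∂m) ∧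
    μA (Set.Iic 0) = 0 ∧ μB (Set.Iic 0) = 0 ∧ 
    (∀ a : ℝ, 0 < a → ∫⁻ v, (Set.Iic (1:ℝ)).indicator (fun v => ENNReal.ofReal (v ^ a)) v ∂m = ENNReal.ofReal (V / a)) ∧ m (Set.Iic 0) = 0 := by
  let ι := ClassGroup (𝓞 K)
  have hsurj : ∀ c : ι, ∃ I : (FractionalIdeal (𝓞 K)⁰ K)ˣ, ClassGroup.mk K I = c := fun c => by
    refine ClassGroup.induction K (P := fun c => ∃ I : (FractionalIdeal (𝓞 K)⁰ K)ˣ, ClassGroup.mk K I = c) ?_ c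
    exact fun I => ⟨I, rfl⟩
  choose b hbe using hsurj
  have hb : Function.Bijective (fun i => ClassGroup.mk K (b i)) := by
    have : (fun i => ClassGroup.mk K (b i)) = id := by funext i; exact hbe i
    rw [this]; exact Function.bijective_id
  have hC : MeasurableSet (fundamentalCone K) := measurableSet_fundamentalCone K
  let v : ι → mixedSpace K → ℝ := fun i y => mixedEmbedding.norm y * DD K (b i)
  have hv : ∀ i, Measurable (v i) := fun i => (meas_norm K).mul_const _
  have hpm : ∀ c : ℝ, Measurable (fun v : ℝ => ENNReal.ofReal (v ^ c)) := fun c => (measurable_id.pow_const c).ennreal_ofReal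
  let dA : ι → mixedSpace K → ENNReal := fun i => th0 K (b i)
  let dB : ι → mixedSpace K → ENNReal := fun i y => th0 K (dualU K (b i)) y⁻¹
  have hdA : ∀ i, Measurable (dA i) := fun i => meas_th0 K _
  have hdB : ∀ i, Measurable (dB i) := fun i => (meas_th0 K _).comp (meas_inv K)
  have h1m : ∀ i : ι, Measurable ((fun _ _ => 1 : ι → mixedSpace K → ENNReal) i) := fun i => measurable_const
  have hvpos : ∀ i, ∀ y ∈ fundamentalCone K, 0 < v i y := fun i y hy =>
    mul_pos (fundamentalCone.norm_pos_of_mem hy) (DD_pos K _)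
  have hnull : ∀ d : ι → mixedSpace K → ENNReal, (∀ i, Measurable (d i)) →
      Measure.sum (fun i => (((nu K).restrict (fundamentalCone K)).withDensity (d i)).map (v i)) (Set.Iic 0) = 0 := by
    intro d hd
    have h := lint_sum K v hv d hd ((Set.Iic (0:ℝ)).indicator (fun _ => 1)) (measurable_const.indicator measurableSet_Iic)
    rw [lintegral_indicator measurableSet_Iic] at h
    rw [setLIntegral_one] at h
    rw [h, ENNReal.tsum_eq_zero]
    intro i
    rw [setLIntegral_congr_fun hC (g := fun _ => 0), lintegral_zero]
    intro y hy
    simp only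
    rw [Set.indicator_of_notMem (by simpa using hvpos i y hy), zero_mul]
  refine ⟨_, _, _, ∑ i : ι, (volume (fundamentalCone.normLeOne K)).toReal, Finset.sum_nonneg fun i _ => ENNReal.toReal_nonneg, 
    fun σ => (lint_sum K v hv dA hdA _ (hpm σ)).trans (moment_direct K b hb σ),
    fun σ => (lint_sum K v hv dB hdB _ (hpm (-σ))).trans (?_ : _ = _), ?_, hnull dA hdA, hnull dB hdB, ?_, hnull (fun _ _ => 1) h1m⟩
  · rw [← moment_dual K (fun i => dualU K (b i)) (dual_bij K b hb) σ]
    refine tsum_congr fun i => setLIntegral_congr_fun hC fun y hy => ?_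
    simp only [dB, v]
    congr 2
    rw [norm_inv', DD_dual, ← mul_inv, Real.rpow_neg (hvpos i y hy).le, Real.inv_rpow (hvpos i y hy).le]
  · intro f hf
    have hf' : Measurable (fun v : ℝ => ENNReal.ofReal v⁻¹ * f v) := (measurable_id.inv.ennreal_ofReal).mul hf
    rw [lint_sum K v hv dA hdA f hf, lint_sum K v hv _ h1m f hf, lint_sum K v hv dB hdB _ hf', lint_sum K v hv _ h1m _ hf',
      ← ENNReal.tsum_add, ← ENNReal.tsum_add]
    refine tsum_congr fun i => ?_
    have hfv : Measurable (fun y => f (v i y)) := hf.comp (hv i)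
    have hfv' : Measurable (fun y => ENNReal.ofReal (v i y)⁻¹ * f (v i y)) := hf'.comp (hv i)
    rw [← lintegral_add_left (show Measurable (fun y => f (v i y) * dA i y) from hfv.mul (hdA i)),
      ← lintegral_add_left (show Measurable (fun y => ENNReal.ofReal (v i y)⁻¹ * f (v i y) * dB i y) from hfv'.mul (hdB i))]
    refine setLIntegral_congr_fun hC fun y hy => ?_
    have := theta_ennreal K (b i) y (fundamentalCone.norm_pos_of_mem hy).ne'
    calc _ = f (v i y) * (1 + th0 K (b i) y) := by simp only [dA]; ring
      _ = _ := by rw [this]; simp only [dB, v]; ring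
  · intro a ha
    have hf : Measurable ((Set.Iic (1:ℝ)).indicator (fun v => ENNReal.ofReal (v ^ a))) := (hpm a).indicator measurableSet_Iic
    rw [lint_sum K v hv _ h1m _ hf, tsum_fintype, Finset.sum_div, ENNReal.ofReal_sum_of_nonneg (fun i _ => by positivity)]
    refine Finset.sum_congr rfl fun i _ => ?_
    rw [← cone_term K a ha, ← cone_scale K (DD K (b i)) (DD_pos K _) _ hf]
    simp only [mul_one, v]
end DH
end

section
namespace DH
open MeasureTheory Real NumberField NumberField.InfinitePlace NumberField.mixedEmbedding Module
open scoped nonZeroDivisors Classical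
set_option linter.unusedSectionVars false
variable (K : Type) [Field K] [NumberField K]

lemma norm_prod (y : mixedSpace K) : mixedEmbedding.norm y = (∏ v, |y.1 v|) * ∏ v, ‖y.2 v‖ ^ 2 := by
  rw [mixedEmbedding.norm_apply, prod_eq_prod_mul_prod]
  congr 1
  · refine Finset.prod_congr rfl fun v _ => ?_
    rw [normAtPlace_apply_of_isReal v.2, mult_isReal]; simp
  · refine Finset.prod_congr rfl fun v _ => ?_
    rw [normAtPlace_apply_of_isComplex v.2, mult_isComplex]

lemma gf_prod (y : mixedSpace K) : gf K y = (∏ v, Real.exp (-π * (y.1 v)^2)) * ∏ v, Real.exp (-(2 * π) * ‖y.2 v‖ ^ 2) := by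
  rw [gf, QF_eq, ← Real.exp_sum, ← Real.exp_sum, ← Real.exp_add, ← Finset.mul_sum, ← Finset.mul_sum, ← Finset.mul_sum]
  congr 1; ring

lemma lint_prod_aux {ι κ : Type} [Fintype ι] [Fintype κ] (hr : ℝ → ℝ) (hc : ℂ → ℝ) (hr0 : ∀ x, 0 ≤ hr x) (hc0 : ∀ x, 0 ≤ hc x) (hri : Integrable hr) (hci : Integrable hc) :
    ∫⁻ y : (ι → ℝ) × (κ → ℂ), ENNReal.ofReal ((∏ v, hr (y.1 v)) * ∏ v, hc (y.2 v)) =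
      ENNReal.ofReal ((∫ x, hr x) ^ Fintype.card ι * (∫ z, hc z) ^ Fintype.card κ) := by
  have h1 : Integrable (fun x : ι → ℝ => ∏ v, hr (x v)) := 
    Integrable.fintype_prod (f := fun _ => hr) (fun _ => hri)
  have h2 : Integrable (fun x : κ → ℂ => ∏ v, hc (x v)) := 
    Integrable.fintype_prod (f := fun _ => hc) (fun _ => hci)
  have h3 : Integrable (fun y : (ι → ℝ) × (κ → ℂ) => (∏ v, hr (y.1 v)) * ∏ v, hc (y.2 v)) := h1.mul_prod h2
  have h0 : 0 ≤ᵐ[volume] (fun y : (ι → ℝ) × (κ → ℂ) => (∏ v, hr (y.1 v)) * ∏ v, hc (y.2 v)) := Filter.Eventually.of_forall fun y => 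
    mul_nonneg (Finset.prod_nonneg fun v _ => hr0 _) (Finset.prod_nonneg fun v _ => hc0 _)
  rw [← ofReal_integral_eq_lintegral_ofReal h3 h0]
  congr 1
  have h4 := integral_prod_mul (μ := (volume : Measure (ι → ℝ))) (ν := (volume : Measure (κ → ℂ)))
    (fun x => ∏ v, hr (x v)) (fun x => ∏ v, hc (x v))
  refine h4.trans ?_
  rw [integral_fintype_prod_volume_eq_pow, integral_fintype_prod_volume_eq_pow]

lemma lint_prod (hr : ℝ → ℝ) (hc : ℂ → ℝ) (hr0 : ∀ x, 0 ≤ hr x) (hc0 : ∀ x, 0 ≤ hc x) (hri : Integrable hr) (hci : Integrable hc) :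
    ∫⁻ y : mixedSpace K, ENNReal.ofReal ((∏ v, hr (y.1 v)) * ∏ v, hc (y.2 v)) =
      ENNReal.ofReal ((∫ x, hr x) ^ nrRealPlaces K * (∫ z, hc z) ^ nrComplexPlaces K) := 
  lint_prod_aux hr hc hr0 hc0 hri hci

lemma real_gamma (σ : ℝ) (hσ : 0 < σ) : ∫ x : ℝ, |x|⁻¹ * (Real.exp (-π * x^2) * |x| ^ σ) = π ^ (-σ/2) * Real.Gamma (σ/2) := by
  have h1 := integral_comp_abs (f := fun x => x⁻¹ * (Real.exp (-π * x^2) * x ^ σ))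
  simp only [sq_abs] at h1
  rw [h1]
  have h2 : ∫ x in Set.Ioi (0:ℝ), x⁻¹ * (Real.exp (-π * x^2) * x ^ σ) = ∫ x in Set.Ioi (0:ℝ), x ^ (σ - 1) * Real.exp (-π * x ^ (2:ℝ)) := by
    refine setIntegral_congr_fun measurableSet_Ioi fun x hx => ?_
    have hx : 0 < x := hx
    rw [Real.rpow_sub_one hx.ne', Real.rpow_two]
    field_simp
  rw [h2, integral_rpow_mul_exp_neg_mul_rpow (by norm_num) (by linarith) Real.pi_pos]
  ring_nf

lemma complex_gamma (σ : ℝ) (hσ : 0 < σ) : ∫ z : ℂ, (‖z‖^2)⁻¹ * (Real.exp (-(2*π) * ‖z‖^2) * (‖z‖^2) ^ σ) = π * ((2*π) ^ (-σ) * Real.Gamma σ) := by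
  have h2 : ∫ z : ℂ, (‖z‖^2)⁻¹ * (Real.exp (-(2*π) * ‖z‖^2) * (‖z‖^2) ^ σ) = ∫ z : ℂ, ‖z‖ ^ (2 * σ - 2) * Real.exp (-(2*π) * ‖z‖ ^ (2:ℝ)) := by
    refine integral_congr_ae ?_
    filter_upwards [compl_mem_ae_iff.mpr (measure_singleton (0:ℂ))] with z hz
    have hx : 0 < ‖z‖ := norm_pos_iff.mpr (by simpa using hz)
    rw [← Real.rpow_two, ← Real.rpow_mul hx.le, Real.rpow_sub hx]
    field_simp
  rw [h2, Complex.integral_rpow_mul_exp_neg_mul_rpow (by norm_num) (by linarith) (by positivity)]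
  have e1 : -(2 * σ - 2 + 2) / 2 = -σ := by ring
  have e2 : (2 * σ - 2 + 2) / 2 = σ := by ring
  rw [e1, e2]; ring

/-- the archimedean factor on the real line -/
noncomputable def GG (σ : ℝ) : ℝ := (π ^ (-σ/2) * Real.Gamma (σ/2)) ^ nrRealPlaces K * (π * ((2*π) ^ (-σ) * Real.Gamma σ)) ^ nrComplexPlaces K

theorem gamma_int (σ : ℝ) (hσ : 0 < σ) : ∫⁻ y, QQ K σ y ∂(nu K) = ENNReal.ofReal (GG K σ) := by
  have hG1 := Real.Gamma_pos_of_pos hσ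
  have hG2 := Real.Gamma_pos_of_pos (half_pos hσ)
  rw [lintegral_nu K _ (meas_QQ K σ), GG, ← real_gamma σ hσ, ← complex_gamma σ hσ, ← lint_prod K]
  · refine lintegral_congr fun y => ?_
    rw [QQ, ← ENNReal.ofReal_mul (by have := mixedEmbedding.norm_nonneg y; positivity), gf_prod, norm_prod]
    congr 1
    simp only [Finset.prod_mul_distrib, Finset.prod_inv_distrib]
    rw [Real.mul_rpow (Finset.prod_nonneg fun v _ => abs_nonneg _) (Finset.prod_nonneg fun v _ => by positivity),
      ← Real.finsetProd_rpow _ _ (fun v _ => abs_nonneg _), ← Real.finsetProd_rpow _ _ (fun v _ => by positivity)]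
    rw [mul_inv]; ring
  · intro x; positivity
  · intro x; positivity
  · apply Integrable.of_integral_ne_zero; rw [real_gamma σ hσ]; positivity
  · apply Integrable.of_integral_ne_zero; rw [complex_gamma σ hσ]; positivity

lemma poly_exp (N : ℕ) : ∃ C : ℝ, 0 < C ∧ ∀ u : ℝ, 0 ≤ u → (1+u)^N * Real.exp (-u^2) ≤ C := by
  refine ⟨N.factorial * Real.exp 2, by positivity, fun u hu => ?_⟩
  have h1 := Real.pow_div_factorial_le_exp (1+u) (by linarith) N
  rw [div_le_iff₀ (by positivity)] at h1
  calc (1+u)^N * Real.exp (-u^2) ≤ (Real.exp (1+u) * N.factorial) * Real.exp (-u^2) := by gcongr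
    _ = N.factorial * Real.exp (1+u-u^2) := by rw [mul_comm (Real.exp (1+u)), mul_assoc, ← Real.exp_add]; ring_nf
    _ ≤ _ := by gcongr; nlinarith [sq_nonneg (u-1/2)]

theorem gamma_dual : ∃ C : ℝ, 1 ≤ C ∧ ∀ (K : Type) [Field K] [NumberField K],
    ∫⁻ y, QQ K 30 y⁻¹ ∂(nu K) ≤ ENNReal.ofReal (C ^ finrank ℚ K) := by
  obtain ⟨C1, hC1, h1⟩ := poly_exp 31
  obtain ⟨C2, hC2, h2⟩ := poly_exp 62
  have i1 : Integrable (fun x : ℝ => C1 * (1 + ‖x‖) ^ (-(2:ℝ))) := (integrable_one_add_norm (by simp)).const_mul _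
  have i2 : Integrable (fun x : ℂ => C2 * (1 + ‖x‖) ^ (-(3:ℝ))) := (integrable_one_add_norm (by rw [Complex.finrank_real_complex]; norm_num)).const_mul _
  set A1 := ∫ x : ℝ, C1 * (1 + ‖x‖) ^ (-(2:ℝ)) with hA1
  set A2 := ∫ x : ℂ, C2 * (1 + ‖x‖) ^ (-(3:ℝ)) with hA2
  have p1 : 0 ≤ A1 := integral_nonneg fun x => by positivity
  have p2 : 0 ≤ A2 := integral_nonneg fun x => by positivity
  refine ⟨1 + A1 + A2, by linarith, ?_⟩
  intro K _ _
  have b1 : ∀ x : ℝ, |x|⁻¹ * (Real.exp (-π * (x⁻¹)^2) * (|x|⁻¹) ^ 30) ≤ C1 * (1 + ‖x‖) ^ (-(2:ℝ)) := by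
    intro x
    by_cases hx : x = 0
    · subst hx; simp; positivity
    have hu : 0 < |x|⁻¹ := by positivity
    have e1 : (1 + ‖x‖) ^ (-(2:ℝ)) = (|x|⁻¹)^2 / (1 + |x|⁻¹)^2 := by
      rw [Real.rpow_neg (by positivity), Real.rpow_two, Real.norm_eq_abs]
      have : 0 < |x| := by positivity
      field_simp
      ring
    have e2 : x⁻¹^2 = |x|⁻¹^2 := by rw [← abs_inv, sq_abs]
    rw [e1, e2]
    set u := |x|⁻¹
    rw [mul_div_assoc', le_div_iff₀ (by positivity)]
    calc u * (Real.exp (-π * u^2) * u^30) * (1+u)^2 = u^2 * (u^29 * (1+u)^2 * Real.exp (-π * u^2)) := by ring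
      _ ≤ u^2 * ((1+u)^29 * (1+u)^2 * Real.exp (-u^2)) := by
        gcongr
        · linarith
        · nlinarith [Real.pi_gt_three, sq_nonneg u]
      _ = u^2 * ((1+u)^31 * Real.exp (-u^2)) := by ring
      _ ≤ u^2 * C1 := by gcongr; exact h1 u hu.le
      _ = _ := by ring
  have b2 : ∀ z : ℂ, (‖z‖^2)⁻¹ * (Real.exp (-(2*π) * (‖z‖⁻¹)^2) * ((‖z‖^2)⁻¹) ^ 30) ≤ C2 * (1 + ‖z‖) ^ (-(3:ℝ)) := by
    intro x
    by_cases hx : x = 0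
    · subst hx; simp; positivity
    have hx' : 0 < ‖x‖ := norm_pos_iff.mpr hx
    have hu : 0 < ‖x‖⁻¹ := by positivity
    have e1 : (1 + ‖x‖) ^ (-(3:ℝ)) = (‖x‖⁻¹)^3 / (1 + ‖x‖⁻¹)^3 := by
      rw [Real.rpow_neg (by positivity), show (3:ℝ) = ((3:ℕ):ℝ) by norm_num, Real.rpow_natCast]
      field_simp
      ring
    rw [e1, ← inv_pow]
    set u := ‖x‖⁻¹
    rw [mul_div_assoc', le_div_iff₀ (by positivity)]
    calc u^2 * (Real.exp (-(2*π) * u^2) * (u^2)^30) * (1+u)^3 = u^3 * (u^59 * (1+u)^3 * Real.exp (-(2*π) * u^2)) := by ring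
      _ ≤ u^3 * ((1+u)^59 * (1+u)^3 * Real.exp (-u^2)) := by
        gcongr
        · linarith
        · nlinarith [Real.pi_gt_three, sq_nonneg u]
      _ = u^3 * ((1+u)^62 * Real.exp (-u^2)) := by ring
      _ ≤ u^3 * C2 := by gcongr; exact h2 u hu.le
      _ = _ := by ring
  rw [lintegral_nu K (fun y => QQ K 30 y⁻¹) ((meas_QQ K 30).comp (meas_inv K))]
  calc _ ≤ ∫⁻ y : mixedSpace K, ENNReal.ofReal ((∏ v, C1 * (1 + ‖y.1 v‖) ^ (-(2:ℝ))) * ∏ v, C2 * (1 + ‖y.2 v‖) ^ (-(3:ℝ))) := by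
        refine lintegral_mono fun y => ?_
        simp only
        rw [QQ, ← ENNReal.ofReal_mul (by have := mixedEmbedding.norm_nonneg y; positivity)]
        apply ENNReal.ofReal_le_ofReal
        calc
          (mixedEmbedding.norm y)⁻¹ * (gf K y⁻¹ * mixedEmbedding.norm y⁻¹ ^ (30:ℝ))
          = (∏ v, |y.1 v|⁻¹ * (Real.exp (-π * ((y.1 v)⁻¹)^2) * (|y.1 v|⁻¹) ^ 30)) * ∏ v, (‖y.2 v‖^2)⁻¹ * (Real.exp (-(2*π) * (‖y.2 v‖⁻¹)^2) * ((‖y.2 v‖^2)⁻¹) ^ 30) := by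
            rw [norm_inv', show (30:ℝ) = ((30:ℕ):ℝ) by norm_num, Real.rpow_natCast, gf_prod, norm_prod]
            simp only [Finset.prod_mul_distrib, Finset.prod_inv_distrib, Prod.fst_inv, Prod.snd_inv, Pi.inv_apply, norm_inv, Finset.prod_pow]
            rw [mul_inv]
            ring
          _ ≤ _ := by
            refine mul_le_mul ?_ ?_ ?_ ?_
            · exact Finset.prod_le_prod (fun v _ => by positivity) fun v _ => b1 _
            · exact Finset.prod_le_prod (fun v _ => by positivity) fun v _ => b2 _
            · exact Finset.prod_nonneg fun v _ => by positivity
            · exact Finset.prod_nonneg fun v _ => by positivity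
    _ = ENNReal.ofReal (A1 ^ nrRealPlaces K * A2 ^ nrComplexPlaces K) := by
        exact lint_prod K (fun x => C1 * (1 + ‖x‖) ^ (-(2:ℝ))) (fun x => C2 * (1 + ‖x‖) ^ (-(3:ℝ))) (fun x => by positivity) (fun x => by positivity) i1 i2
    _ ≤ _ := by
        apply ENNReal.ofReal_le_ofReal
        have hn := card_add_two_mul_card_eq_rank K
        calc A1 ^ nrRealPlaces K * A2 ^ nrComplexPlaces K ≤ (1+A1+A2) ^ nrRealPlaces K * (1+A1+A2) ^ nrComplexPlaces K := by
              gcongr <;> linarith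
          _ = (1+A1+A2) ^ (nrRealPlaces K + nrComplexPlaces K) := by rw [pow_add]
          _ ≤ _ := pow_le_pow_right₀ (by linarith) (by omega)
end DH
end

section
namespace DH
open MeasureTheory Real ProbabilityTheory

lemma ae_pos_of (μ : Measure ℝ) (h0 : μ (Set.Iic 0) = 0) : ∀ᵐ v ∂μ, 0 < v := by
  rw [ae_iff]; convert h0 using 2; ext v; simp

lemma mgf_basic (μ : Measure ℝ) (h0 : μ (Set.Iic 0) = 0) (t M : ℝ) (hM : 0 ≤ M)
    (h : ∫⁻ v, ENNReal.ofReal (v ^ t) ∂μ ≤ ENNReal.ofReal M) :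
    Integrable (fun v => Real.exp (t * Real.log v)) μ ∧ mgf Real.log μ t ≤ M ∧
      ∫⁻ v, ENNReal.ofReal (v ^ t) ∂μ = ENNReal.ofReal (mgf Real.log μ t) := by
  have e : ∫⁻ v, ENNReal.ofReal (v ^ t) ∂μ = ∫⁻ v, ENNReal.ofReal (Real.exp (t * Real.log v)) ∂μ := by
    apply lintegral_congr_ae
    filter_upwards [ae_pos_of μ h0] with v hv
    rw [Real.rpow_def_of_pos hv, mul_comm]
  have ms : AEStronglyMeasurable (fun v => Real.exp (t * Real.log v)) μ := by
    apply Measurable.aestronglyMeasurable; fun_prop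
  have i : Integrable (fun v => Real.exp (t * Real.log v)) μ := by
    refine ⟨ms, ?_⟩
    rw [hasFiniteIntegral_iff_ofReal (Filter.Eventually.of_forall fun v => (Real.exp_pos _).le), ← e]
    exact h.trans_lt ENNReal.ofReal_lt_top
  have q := ofReal_integral_eq_lintegral_ofReal i (Filter.Eventually.of_forall fun v => (Real.exp_pos _).le)
  refine ⟨i, ?_, ?_⟩
  · rw [e, ← q] at h
    exact (ENNReal.ofReal_le_ofReal_iff hM).1 h
  · rw [e, ← q]; rfl

lemma mgf_up (μ : Measure ℝ) (M : ℝ) (hM : 0 ≤ M) 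
    (h : ∫⁻ v, ENNReal.ofReal (v ^ (30:ℝ)) ∂μ ≤ ENNReal.ofReal M) :
    (∀ s : ℂ, s.re < 30 → DifferentiableAt ℂ (complexMGF Real.log (μ.restrict (Set.Ioi 1))) s) ∧
    (∀ s : ℂ, s.re < 30 → ‖complexMGF Real.log (μ.restrict (Set.Ioi 1)) s‖ ≤ M) ∧
    (∀ σ : ℝ, σ < 30 → ∫⁻ v in Set.Ioi 1, ENNReal.ofReal (v ^ σ) ∂μ = ENNReal.ofReal (mgf Real.log (μ.restrict (Set.Ioi 1)) σ)) := by
  have h0 : (μ.restrict (Set.Ioi 1)) (Set.Iic 0) = 0 := by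
    rw [Measure.restrict_apply measurableSet_Iic]
    convert measure_empty (μ := μ)
    ext v; simp; intro h; linarith
  have key : ∀ σ : ℝ, σ < 30 → ∫⁻ v in Set.Ioi 1, ENNReal.ofReal (v ^ σ) ∂μ ≤ ENNReal.ofReal M := by
    intro σ hσ
    refine le_trans ?_ ((setLIntegral_le_lintegral (Set.Ioi 1) _).trans h)
    refine setLIntegral_mono' measurableSet_Ioi fun v hv => ENNReal.ofReal_le_ofReal ?_
    exact Real.rpow_le_rpow_of_exponent_le (le_of_lt hv) hσ.le
  have B := fun σ hσ => mgf_basic _ h0 σ M hM (key σ hσ)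
  refine ⟨fun s hs => ?_, fun s hs => norm_complexMGF_le_mgf.trans (B _ hs).2.1, fun σ hσ => (B σ hσ).2.2⟩
  refine (hasDerivAt_complexMGF ?_).differentiableAt
  have : Set.Iio (30:ℝ) ⊆ integrableExpSet Real.log (μ.restrict (Set.Ioi 1)) := fun σ hσ => (B σ hσ).1
  exact interior_maximal this isOpen_Iio hs

lemma mgf_down (μ : Measure ℝ) (h0 : μ (Set.Iic 0) = 0) (M : ℝ) (hM : 0 ≤ M) 
    (h : ∫⁻ v, ENNReal.ofReal (v ^ (-30:ℝ)) ∂μ ≤ ENNReal.ofReal M) :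
    (∀ s : ℂ, -30 < s.re → DifferentiableAt ℂ (complexMGF Real.log (μ.restrict (Set.Iic 1))) s) ∧
    (∀ s : ℂ, -30 < s.re → ‖complexMGF Real.log (μ.restrict (Set.Iic 1)) s‖ ≤ M) ∧
    (∀ σ : ℝ, -30 < σ → ∫⁻ v in Set.Iic 1, ENNReal.ofReal (v ^ σ) ∂μ = ENNReal.ofReal (mgf Real.log (μ.restrict (Set.Iic 1)) σ)) := by
  have h0' : (μ.restrict (Set.Iic 1)) (Set.Iic 0) = 0 := 
    Measure.absolutelyContinuous_of_le Measure.restrict_le_self h0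
  have key : ∀ σ : ℝ, -30 < σ → ∫⁻ v in Set.Iic 1, ENNReal.ofReal (v ^ σ) ∂μ ≤ ENNReal.ofReal M := by
    intro σ hσ
    refine le_trans ?_ ((setLIntegral_le_lintegral (Set.Iic 1) _).trans h)
    refine lintegral_mono_ae ?_
    filter_upwards [ae_pos_of _ h0', ae_restrict_mem measurableSet_Iic] with v hv hv1
    exact ENNReal.ofReal_le_ofReal (Real.rpow_le_rpow_of_exponent_ge hv hv1 hσ.le)
  have B := fun σ hσ => mgf_basic _ h0' σ M hM (key σ hσ)
  refine ⟨fun s hs => ?_, fun s hs => norm_complexMGF_le_mgf.trans (B _ hs).2.1, fun σ hσ => (B σ hσ).2.2⟩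
  refine (hasDerivAt_complexMGF ?_).differentiableAt
  have : Set.Ioi (-30:ℝ) ⊆ integrableExpSet Real.log (μ.restrict (Set.Iic 1)) := fun σ hσ => (B σ hσ).1
  exact interior_maximal this isOpen_Ioi hs

/-- Abstract Mellin continuation. -/
lemma mellin_cont (μA μB m : Measure ℝ) (V MA MB : ℝ) (hV : 0 ≤ V) (hMA : 0 ≤ MA) (hMB : 0 ≤ MB)
    (hA : ∫⁻ v, ENNReal.ofReal (v ^ (30:ℝ)) ∂μA ≤ ENNReal.ofReal MA)
    (hB : ∫⁻ v, ENNReal.ofReal (v ^ (-30:ℝ)) ∂μB ≤ ENNReal.ofReal MB)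
    (hrel : ∀ f : ℝ → ENNReal, Measurable f → ∫⁻ v, f v ∂μA + ∫⁻ v, f v ∂m = ∫⁻ v, ENNReal.ofReal v⁻¹ * f v ∂μB + ∫⁻ v, ENNReal.ofReal v⁻¹ * f v ∂m)
    (hB0 : μB (Set.Iic 0) = 0) 
    (hm : ∀ a > 0, ∫⁻ v, (Set.Iic (1:ℝ)).indicator (fun v => ENNReal.ofReal (v^a)) v ∂m = ENNReal.ofReal (V/a))
    (hm0 : m (Set.Iic 0) = 0) (X : ℝ → ℝ) (hX0 : ∀ σ, 1 < σ → 0 ≤ X σ)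
    (hX : ∀ σ, 1 < σ → ∫⁻ v, ENNReal.ofReal (v ^ σ) ∂μA = ENNReal.ofReal (X σ)) :
    ∃ A B : ℂ → ℂ, (∀ s : ℂ, s.re < 30 → DifferentiableAt ℂ A s ∧ ‖A s‖ ≤ MA) ∧
      (∀ s : ℂ, -29 < s.re → DifferentiableAt ℂ B s ∧ ‖B s‖ ≤ MB) ∧
      (∀ σ : ℝ, 1 < σ → σ < 30 → (X σ : ℂ) = A σ + B σ + V * (1 / (σ - 1) - 1 / σ)) ∧
      V ≤ 2 * X 2 := by
  obtain ⟨a1, a2, a3⟩ := mgf_up μA MA hMA hA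
  obtain ⟨b1, b2, b3⟩ := mgf_down μB hB0 MB hMB hB
  have key : ∀ σ : ℝ, 1 < σ → σ < 30 → X σ + V / σ = mgf Real.log (μA.restrict (Set.Ioi 1)) σ + mgf Real.log (μB.restrict (Set.Iic 1)) (σ - 1) + V / (σ - 1) := by
    intro σ h1 h2
    have r := hrel ((Set.Iic (1:ℝ)).indicator (fun v => ENNReal.ofReal (v^σ))) ((by fun_prop : Measurable (fun v : ℝ => ENNReal.ofReal (v^σ))).indicator measurableSet_Iic)
    have conv : ∀ μ : Measure ℝ, μ (Set.Iic 0) = 0 → ∫⁻ v, ENNReal.ofReal v⁻¹ * (Set.Iic (1:ℝ)).indicator (fun v => ENNReal.ofReal (v^σ)) v ∂μ = ∫⁻ v, (Set.Iic (1:ℝ)).indicator (fun v => ENNReal.ofReal (v^(σ-1))) v ∂μ := by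
      intro μ h0
      apply lintegral_congr_ae
      filter_upwards [ae_pos_of μ h0] with v hv
      by_cases h : v ∈ Set.Iic (1:ℝ)
      · rw [Set.indicator_of_mem h, Set.indicator_of_mem h, ← ENNReal.ofReal_mul (by positivity), Real.rpow_sub_one hv.ne']
        congr 1; field_simp
      · rw [Set.indicator_of_notMem h, Set.indicator_of_notMem h, mul_zero]
    rw [conv _ hB0, conv _ hm0, hm σ (by linarith), hm (σ-1) (by linarith), lintegral_indicator measurableSet_Iic, lintegral_indicator measurableSet_Iic, b3 (σ-1) (by linarith)] at r
    have sp := lintegral_add_compl (μ := μA) (fun v => ENNReal.ofReal (v ^ σ)) (measurableSet_Iic (a := (1:ℝ)))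
    rw [Set.compl_Iic, a3 σ h2, hX σ h1] at sp
    have n1 : 0 ≤ mgf Real.log (μA.restrict (Set.Ioi 1)) σ := mgf_nonneg
    have n2 : 0 ≤ mgf Real.log (μB.restrict (Set.Iic 1)) (σ-1) := mgf_nonneg
    have n3 : 0 ≤ V / σ := by positivity
    have n4 : 0 ≤ V / (σ-1) := div_nonneg hV (by linarith)
    have : ENNReal.ofReal (X σ + V / σ) = ENNReal.ofReal (mgf Real.log (μA.restrict (Set.Ioi 1)) σ + mgf Real.log (μB.restrict (Set.Iic 1)) (σ - 1) + V / (σ - 1)) := by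
      rw [ENNReal.ofReal_add (hX0 σ h1) n3, ENNReal.ofReal_add (by positivity) n4, ENNReal.ofReal_add n1 n2, ← sp, add_right_comm, r]
      ring
    rwa [ENNReal.ofReal_eq_ofReal_iff (add_nonneg (hX0 σ h1) n3) (by positivity)] at this
  refine ⟨complexMGF Real.log (μA.restrict (Set.Ioi 1)), fun s => complexMGF Real.log (μB.restrict (Set.Iic 1)) (s - 1), fun s hs => ⟨a1 s hs, a2 s hs⟩, fun s hs => ?_, fun σ h1 h2 => ?_, ?_⟩
  · have : -30 < (s-1).re := by simp; linarith
    refine ⟨?_, b2 _ this⟩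
    have := b1 _ this
    fun_prop
  · have k := key σ h1 h2
    rw [complexMGF_ofReal]
    have : ((σ:ℂ) - 1) = ((σ - 1 : ℝ) : ℂ) := by push_cast; rfl
    simp only [this]
    rw [complexMGF_ofReal]
    have k' : X σ = mgf Real.log (μA.restrict (Set.Ioi 1)) σ + mgf Real.log (μB.restrict (Set.Iic 1)) (σ - 1) + V * (1 / (σ - 1) - 1/ σ) := by
      rw [mul_sub, mul_one_div, mul_one_div]; linarith
    rw [k']; push_cast; ring
  · have k := key 2 (by norm_num) (by norm_num)
    have n1 : 0 ≤ mgf Real.log (μA.restrict (Set.Ioi 1)) 2 := mgf_nonneg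
    have n2 : 0 ≤ mgf Real.log (μB.restrict (Set.Iic 1)) (2-1) := mgf_nonneg
    norm_num at k n2 ⊢
    linarith
end DH
end

section
namespace DH
open MeasureTheory Real NumberField NumberField.InfinitePlace Module

noncomputable def i1 (s : ℂ) : ℂ := Complex.exp (Real.log π * (s / 2)) * (Complex.Gamma (s / 2))⁻¹
noncomputable def i2 (s : ℂ) : ℂ := (π : ℂ)⁻¹ * (Complex.exp (Real.log (2 * π) * s) * (Complex.Gamma s)⁻¹)

lemma i1_diff : Differentiable ℂ i1 := by
  have h : Differentiable ℂ (fun s : ℂ => (Complex.Gamma (s / 2))⁻¹) :=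
    Complex.differentiable_one_div_Gamma.comp (differentiable_id.div_const 2)
  unfold i1
  fun_prop

lemma i2_diff : Differentiable ℂ i2 := by
  have h : Differentiable ℂ (fun s : ℂ => (Complex.Gamma s)⁻¹) := Complex.differentiable_one_div_Gamma
  unfold i2
  fun_prop

/-- inverse gamma factor -/
noncomputable def IG (K : Type) [Field K] [NumberField K] (s : ℂ) : ℂ :=
  i1 s ^ nrRealPlaces K * i2 s ^ nrComplexPlaces K

lemma IG_diff (K : Type) [Field K] [NumberField K] : Differentiable ℂ (IG K) := by
  have := i1_diff
  have := i2_diff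
  unfold IG
  fun_prop

lemma IG_GG (K : Type) [Field K] [NumberField K] (σ : ℝ) (hσ : 0 < σ) : IG K σ * (GG K σ : ℂ) = 1 := by
  have g1 := Real.Gamma_pos_of_pos (half_pos hσ)
  have g2 := Real.Gamma_pos_of_pos hσ
  have e1 : i1 σ * ((π^(-σ/2) * Real.Gamma (σ/2) : ℝ) : ℂ) = 1 := by
    have : i1 σ = ((Real.exp (Real.log π * (σ/2)) * (Real.Gamma (σ/2))⁻¹ : ℝ) : ℂ) := by
      unfold i1; push_cast [← Complex.Gamma_ofReal]; rfl
    rw [this, ← Complex.ofReal_mul, ← Real.rpow_def_of_pos pi_pos, neg_div, Real.rpow_neg pi_pos.le]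
    have := Real.rpow_pos_of_pos pi_pos (σ/2)
    norm_cast
    field_simp
  have e2 : i2 σ * ((π * ((2*π)^(-σ) * Real.Gamma σ) : ℝ) : ℂ) = 1 := by
    have : i2 σ = ((π⁻¹ * (Real.exp (Real.log (2*π) * σ) * (Real.Gamma σ)⁻¹) : ℝ) : ℂ) := by
      unfold i2; push_cast [← Complex.Gamma_ofReal]; rfl
    rw [this, ← Complex.ofReal_mul, ← Real.rpow_def_of_pos (by positivity), Real.rpow_neg (by positivity)]
    have := Real.rpow_pos_of_pos (show 0 < 2 * π by positivity) σ
    norm_cast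
    field_simp
  unfold IG GG
  push_cast
  push_cast at e1 e2
  rw [mul_mul_mul_comm, ← mul_pow, ← mul_pow, e1, e2]; simp

lemma GG_pos (K : Type) [Field K] [NumberField K] (σ : ℝ) (hσ : 0 < σ) : 0 < GG K σ := by
  have g1 := Real.Gamma_pos_of_pos (half_pos hσ)
  have g2 := Real.Gamma_pos_of_pos hσ
  unfold GG; positivity

lemma pow_n_bound (K : Type) [Field K] [NumberField K] (a b C : ℝ) (ha : 0 ≤ a) (hb : 0 ≤ b) (hC : 1 ≤ C) (haC : a ≤ C) (hbC : b ≤ C) :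
    a ^ nrRealPlaces K * b ^ nrComplexPlaces K ≤ C ^ finrank ℚ K := by
  have hn := card_add_two_mul_card_eq_rank K
  calc a ^ nrRealPlaces K * b ^ nrComplexPlaces K ≤ C ^ nrRealPlaces K * C ^ nrComplexPlaces K := by gcongr
    _ = C ^ (nrRealPlaces K + nrComplexPlaces K) := by rw [pow_add]
    _ ≤ _ := pow_le_pow_right₀ hC (by omega)

lemma GG_bound (σ : ℝ) (hσ : 0 < σ) : ∃ C : ℝ, 1 ≤ C ∧ ∀ (K : Type) [Field K] [NumberField K], GG K σ ≤ C ^ finrank ℚ K := by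
  have g1 := Real.Gamma_pos_of_pos (half_pos hσ)
  have g2 := Real.Gamma_pos_of_pos hσ
  have p1 : 0 ≤ π^(-σ/2) * Real.Gamma (σ/2) := by positivity
  have p2 : 0 ≤ π * ((2*π)^(-σ) * Real.Gamma σ) := by positivity
  exact ⟨1 + π^(-σ/2) * Real.Gamma (σ/2) + π * ((2*π)^(-σ) * Real.Gamma σ), by linarith, fun K _ _ =>
    pow_n_bound K _ _ _ p1 p2 (by linarith) (by linarith) (by linarith)⟩

lemma IG_bound : ∃ C : ℝ, 1 ≤ C ∧ ∀ (K : Type) [Field K] [NumberField K], ∀ s : ℂ, ‖s‖ ≤ 15 → ‖IG K s‖ ≤ C ^ finrank ℚ K := by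
  obtain ⟨C1, h1⟩ := (isCompact_closedBall (0:ℂ) 15).exists_bound_of_continuousOn i1_diff.continuous.continuousOn
  obtain ⟨C2, h2⟩ := (isCompact_closedBall (0:ℂ) 15).exists_bound_of_continuousOn i2_diff.continuous.continuousOn
  refine ⟨1 + |C1| + |C2|, by have := abs_nonneg C1; have := abs_nonneg C2; linarith, fun K _ _ s hs => ?_⟩
  have hs' : s ∈ Metric.closedBall (0:ℂ) 15 := by simpa using hs
  have q1 := (h1 s hs').trans (le_abs_self _)
  have q2 := (h2 s hs').trans (le_abs_self _)
  rw [IG, norm_mul, norm_pow, norm_pow]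
  have := abs_nonneg C1
  have := abs_nonneg C2
  exact pow_n_bound K _ _ _ (norm_nonneg _) (norm_nonneg _) (by linarith) (by linarith) (by linarith)

lemma n_le_log (K : Type) [Field K] [NumberField K] (h : 1 < finrank ℚ K) :
    1 ≤ Real.log |(discr K : ℝ)| ∧ (finrank ℚ K : ℝ) ≤ 4 * Real.log |(discr K : ℝ)| := by
  have a := abs_discr_gt_two h
  have a3 : (3:ℝ) ≤ |(discr K : ℝ)| := by exact_mod_cast a
  have b := abs_discr_ge h
  constructor
  · rw [Real.le_log_iff_exp_le (by linarith)]
    have := Real.exp_one_lt_d9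
    linarith
  · obtain ⟨k, hk⟩ : ∃ k, finrank ℚ K = k + 1 := ⟨finrank ℚ K - 1, by omega⟩
    have hk1 : (1:ℝ) ≤ k := by
      have : 1 ≤ k := by omega
      exact_mod_cast this
    have c : (2:ℝ)^k ≤ |(discr K : ℝ)| := by
      push_cast at b
      refine le_trans ?_ b
      rw [hk, pow_succ, mul_comm ((3 * π / 4)^k), ← mul_assoc]
      have p3 := Real.pi_gt_three
      have : (2:ℝ)^k ≤ (3 * π / 4)^k := by gcongr; linarith
      have p := pow_pos (show (0:ℝ) < 2 by norm_num) k
      calc (2:ℝ)^k ≤ 1 * (3 * π / 4)^k := by linarith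
        _ ≤ _ := by gcongr; linarith
    have := Real.log_le_log (by positivity) c
    rw [Real.log_pow] at this
    have l2 := Real.log_two_gt_d9
    rw [hk]; push_cast
    nlinarith
end DH
end

section
namespace DH
open MeasureTheory Real NumberField NumberField.InfinitePlace Module

noncomputable def Zr (K : Type) [Field K] [NumberField K] (σ : ℝ) : ℝ :=
  ∑' I : {I : Ideal (𝓞 K) // I ≠ ⊥}, (Ideal.absNorm I.1 : ℝ) ^ (-σ)

lemma Zr_summable (K : Type) [Field K] [NumberField K] (σ : ℝ) (hσ : 1 < σ) :
    Summable fun I : {I : Ideal (𝓞 K) // I ≠ ⊥} => (Ideal.absNorm I.1 : ℝ) ^ (-σ) := by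
  refine (zeta_summable K σ hσ).1.congr fun I => ?_
  have hpos : 0 < Ideal.absNorm I.1 :=
    Nat.pos_of_ne_zero (by rw [Ne, Ideal.absNorm_eq_zero_iff]; exact I.2)
  rw [Complex.norm_natCast_cpow_of_pos hpos]
  simp

lemma Zr_nonneg (K : Type) [Field K] [NumberField K] (σ : ℝ) : 0 ≤ Zr K σ :=
  tsum_nonneg fun I => by positivity

lemma ZZ_eq (K : Type) [Field K] [NumberField K] (σ : ℝ) (hσ : 1 < σ) : ZZ K σ = ENNReal.ofReal (Zr K σ) := by
  rw [ZZ, Zr, ENNReal.ofReal_tsum_of_nonneg (fun I => by positivity) (Zr_summable K σ hσ)]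

lemma Zr_complex (K : Type) [Field K] [NumberField K] (σ : ℝ) :
    ∑' I : {I : Ideal (𝓞 K) // I ≠ ⊥}, (Ideal.absNorm I.1 : ℂ) ^ (-(σ:ℂ)) = (Zr K σ : ℂ) := by
  rw [Zr, Complex.ofReal_tsum]
  refine tsum_congr fun I => ?_
  rw [Complex.ofReal_cpow (by positivity)]
  push_cast; rfl

lemma strip_preconn : IsPreconnected ({s : ℂ | |s.re| < 25} \ {1}) := by
  have c1 : Convex ℝ {s : ℂ | |s.re| < 25} := by
    have : {s : ℂ | |s.re| < 25} = {s : ℂ | -25 < s.re} ∩ {s | s.re < 25} := by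
      ext s; simp [abs_lt]
    rw [this]
    exact (convex_halfSpace_re_gt _).inter (convex_halfSpace_re_lt _)
  have p1 := (c1.inter (convex_halfSpace_im_gt 0)).isPreconnected
  have p2 := (c1.inter (convex_halfSpace_re_gt 1)).isPreconnected
  have p3 := (c1.inter (convex_halfSpace_im_lt 0)).isPreconnected
  have p4 := (c1.inter (convex_halfSpace_re_lt 1)).isPreconnected
  have q1 := p1.union (⟨2, 1⟩ : ℂ) (by constructor <;> simp; norm_num) (by constructor <;> simp; norm_num) p2
  have q2 := q1.union (⟨2, -1⟩ : ℂ) (by right; constructor <;> simp; norm_num) (by constructor <;> simp; norm_num) p3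
  have q3 := q2.union (⟨0, 1⟩ : ℂ) (by left; left; constructor <;> simp) (by constructor <;> simp) p4
  convert q3 using 1
  ext s
  simp only [Set.mem_sdiff, Set.mem_ofPred_eq, Set.mem_singleton_iff, Set.mem_union, Set.mem_inter_iff, Complex.ext_iff, Complex.one_re, Complex.one_im]
  constructor
  · rintro ⟨h1, h2⟩
    rcases lt_trichotomy s.im 0 with h | h | h
    · tauto
    · rcases lt_trichotomy s.re 1 with h' | h' | h' <;> tauto
    · tauto
  · rintro (((h | h) | h) | h) <;> refine ⟨h.1, fun e => ?_⟩ <;> have := h.2 <;> rw [e.1] at * <;> rw [e.2] at * <;> exact absurd this (lt_irrefl _)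


set_option maxHeartbeats 2000000 in
theorem zeta_cont : ∃ C : ℝ, 1 ≤ C ∧ ∀ (K : Type) [Field K] [NumberField K], 1 < finrank ℚ K →
    ∀ ζ : ℂ → ℂ, (∀ s, s ≠ 1 → AnalyticAt ℂ ζ s) →
    (∀ s : ℂ, 1 < s.re → ζ s = ∑' I : {I : Ideal (𝓞 K) // I ≠ ⊥}, (Ideal.absNorm I.1 : ℂ) ^ (-s)) →
    ∃ k : ℂ → ℂ, (∀ s : ℂ, |s.re| < 25 → DifferentiableAt ℂ k s) ∧
      (∀ s : ℂ, s ≠ 1 → |s.re| < 25 → k s = s * (s - 1) * ζ s) ∧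
      ∀ s : ℂ, ‖s‖ ≤ 15 → ‖k s‖ ≤ Real.exp (C * Real.log |(discr K : ℝ)|) := by
  obtain ⟨C0, h0, H0⟩ := gamma_dual
  obtain ⟨C1, h1, H1⟩ := IG_bound
  obtain ⟨C2, h2, H2⟩ := GG_bound 30 (by norm_num)
  obtain ⟨C3, h3, H3⟩ := GG_bound 2 (by norm_num)
  set C := C0 + C1 + C2 + C3 with hC
  have hC1 : 1 ≤ C := by linarith
  have hlC := Real.log_nonneg hC1
  refine ⟨46 + 8 * Real.log C, by linarith, fun K _ _ hn ζ hζa hζ => ?_⟩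
  obtain ⟨hl1, hnl⟩ := n_le_log K hn
  set l := Real.log |(discr K : ℝ)| with hl
  set n := finrank ℚ K with hnn
  have hd : 0 < |(discr K : ℝ)| := by
    rw [abs_pos]; exact_mod_cast discr_ne_zero K
  obtain ⟨μA, μB, m, V, hV, hA, hB, hrel, -, hB0, hm, hm0⟩ := measures_exist K
  set D := √|(discr K : ℝ)| with hD
  have hDe : D = Real.exp (l / 2) := by
    rw [hD, Real.sqrt_eq_rpow, Real.rpow_def_of_pos hd, hl]; ring_nf
  have hDpos : 0 < D := by rw [hDe]; positivity
  have hlD : Real.log D = l / 2 := by rw [hDe, Real.log_exp]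
  obtain ⟨W, hW, hWe⟩ : ∃ W : ℝ, 0 < W ∧ wK K = ENNReal.ofReal W :=
    ⟨(wK K).toReal, ENNReal.toReal_pos (wK_ne K).1 (wK_ne K).2, (ENNReal.ofReal_toReal (wK_ne K).2).symm⟩
  set X : ℝ → ℝ := fun σ => D ^ σ * (GG K σ * (Zr K σ * W)) with hX
  have hX0 : ∀ σ, 1 < σ → 0 ≤ X σ := fun σ hσ => by
    have := GG_pos K σ (by linarith)
    have := Zr_nonneg K σ
    positivity
  have hXA : ∀ σ, 1 < σ → ∫⁻ v, ENNReal.ofReal (v ^ σ) ∂μA = ENNReal.ofReal (X σ) := by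
    intro σ hσ
    have := GG_pos K σ (by linarith)
    have := Zr_nonneg K σ
    rw [hA σ, gamma_int K σ (by linarith), ZZ_eq K σ hσ, hWe, ← ENNReal.ofReal_mul (by positivity),
      ← ENNReal.ofReal_mul (by positivity), ← ENNReal.ofReal_mul (by positivity)]
  set MB := D ^ (30:ℝ) * (C0 ^ n * (Zr K 30 * W)) with hMB
  have hMB0 : 0 ≤ MB := by
    have := Zr_nonneg K 30
    positivity
  have hBB : ∫⁻ v, ENNReal.ofReal (v ^ (-30:ℝ)) ∂μB ≤ ENNReal.ofReal MB := by
    have := Zr_nonneg K 30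
    rw [hB 30, ZZ_eq K 30 (by norm_num), hWe, hMB, ENNReal.ofReal_mul (by positivity), ENNReal.ofReal_mul (by positivity),
      ENNReal.ofReal_mul (by positivity)]
    gcongr
    exact H0 K
  obtain ⟨A, B, a, b, ab, V2⟩ := mellin_cont μA μB m V (X 30) MB hV (hX0 30 (by norm_num)) hMB0
    (hXA 30 (by norm_num)).le hBB hrel hB0 hm hm0 X hX0 hXA
  have hre : ∀ s : ℂ, |s.re| < 25 → s.re < 30 ∧ -29 < s.re := fun s hs => by
    rw [abs_lt] at hs; constructor <;> linarith [hs.1, hs.2]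
  set k : ℂ → ℂ := fun s => IG K s * Complex.exp (-((l / 2 : ℝ) : ℂ) * s) * (W : ℂ)⁻¹ * (s * (s - 1) * (A s + B s) + V) with hk
  have kd : ∀ s : ℂ, |s.re| < 25 → DifferentiableAt ℂ k s := by
    intro s hs
    have d1 := (a s (hre s hs).1).1
    have d2 := (b s (hre s hs).2).1
    have d3 := IG_diff K s
    rw [hk]
    fun_prop
  have kreal : ∀ σ : ℝ, 1 < σ → σ < 25 → k σ = σ * (σ - 1) * ζ σ := by
    intro σ hσ hσ2
    rw [hζ σ (by simpa using hσ), Zr_complex]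
    have e := ab σ hσ (by linarith)
    have n0 : (σ : ℂ) ≠ 0 := by norm_cast; linarith
    have n1 : (σ : ℂ) - 1 ≠ 0 := by
      have : σ - 1 ≠ 0 := by linarith
      exact_mod_cast this
    have e2 : (σ : ℂ) * (σ - 1) * (A σ + B σ) + V = σ * (σ - 1) * X σ := by
      rw [e]; field_simp; ring
    have e3 := IG_GG K σ (by linarith)
    have e4 : Complex.exp (-((l / 2 : ℝ) : ℂ) * σ) * ((D ^ σ : ℝ) : ℂ) = 1 := by
      rw [hDe, ← Real.exp_mul, Complex.ofReal_exp, ← Complex.exp_add]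
      push_cast
      rw [neg_mul, neg_add_cancel, Complex.exp_zero]
    have hWc : (W : ℂ) ≠ 0 := by exact_mod_cast hW.ne'
    rw [hk]
    simp only
    rw [e2, hX]
    simp only
    push_cast only [Complex.ofReal_mul]
    calc _ = (σ:ℂ) * (σ - 1) * Zr K σ * (IG K σ * (GG K σ : ℂ)) * (Complex.exp (-((l / 2 : ℝ) : ℂ) * σ) * ((D ^ σ : ℝ) : ℂ)) * ((W:ℂ)⁻¹ * W) := by ring
      _ = _ := by rw [e3, e4, inv_mul_cancel₀ hWc]; ring
  refine ⟨k, kd, ?_, ?_⟩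
  · have hopen : IsOpen {s : ℂ | |s.re| < 25} := isOpen_lt (by fun_prop) continuous_const
    have ank : AnalyticOnNhd ℂ k ({s : ℂ | |s.re| < 25} \ {1}) := by
      have : AnalyticOnNhd ℂ k {s : ℂ | |s.re| < 25} :=
        DifferentiableOn.analyticOnNhd (fun s hs => (kd s hs).differentiableWithinAt) hopen
      exact this.mono Set.sdiff_subset
    have anz : AnalyticOnNhd ℂ (fun s => s * (s - 1) * ζ s) ({s : ℂ | |s.re| < 25} \ {1}) := by
      intro s hs
      have := hζa s hs.2
      fun_prop
    have hfr : ∃ᶠ s in nhdsWithin (2:ℂ) {2}ᶜ, k s = s * (s - 1) * ζ s := by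
      have ht : Filter.Tendsto (fun j : ℕ => ((2 + 1 / ((j:ℝ) + 1) : ℝ) : ℂ)) Filter.atTop (nhdsWithin (2:ℂ) {2}ᶜ) := by
        rw [tendsto_nhdsWithin_iff]
        constructor
        · have h := tendsto_one_div_add_atTop_nhds_zero_nat (𝕜 := ℝ)
          have h' := (h.const_add (2:ℝ))
          have := (Complex.continuous_ofReal.tendsto (2 + 0)).comp h'
          simpa [Function.comp_def] using this
        · refine Filter.Eventually.of_forall fun j => ?_
          simp only [Set.mem_compl_iff, Set.mem_singleton_iff]
          have : (0:ℝ) < 1 / ((j:ℝ) + 1) := by positivity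
          intro h
          have h' : (2 + 1 / ((j:ℝ) + 1) : ℝ) = 2 := by exact_mod_cast h
          linarith
      refine ht.frequently (Filter.Frequently.of_forall fun j => ?_)
      have p : (0:ℝ) < 1 / ((j:ℝ) + 1) := by positivity
      have q : 1 / ((j:ℝ) + 1) ≤ 1 := by
        rw [div_le_one (by positivity)]
        have : (0:ℝ) ≤ j := by positivity
        linarith
      exact kreal _ (by linarith) (by linarith)
    have E := ank.eqOn_of_preconnected_of_frequently_eq anz strip_preconn (z₀ := 2) ⟨by simp; norm_num, by simp⟩ hfr
    intro s hs1 hs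
    exact E ⟨hs, hs1⟩
  · intro s hs
    have hsre : |s.re| ≤ 15 := (Complex.abs_re_le_norm s).trans hs
    obtain ⟨r1, r2⟩ := hre s (by linarith)
    have bA := (a s r1).2
    have bB := (b s r2).2
    have bI := H1 K s hs
    have Z30 : Zr K 30 ≤ Real.exp (4 * n) := (zeta_bound K 30 (by norm_num)).2
    have Z2 : Zr K 2 ≤ Real.exp (4 * n) := (zeta_bound K 2 le_rfl).2
    have Z30p := Zr_nonneg K 30
    have Z2p := Zr_nonneg K 2
    have G30p := GG_pos K 30 (by norm_num)
    have G2p := GG_pos K 2 (by norm_num)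
    have D1 : 1 ≤ D := by rw [hDe]; exact Real.one_le_exp (by linarith)
    set Y := D ^ (30:ℝ) * (C ^ n * (Real.exp (4 * n) * W)) with hY
    have y1 : X 30 ≤ Y := by
      rw [hX, hY]
      simp only
      have : GG K 30 ≤ C ^ n := (H2 K).trans (pow_le_pow_left₀ (by linarith) (by linarith) _)
      gcongr
    have y2 : X 2 ≤ Y := by
      rw [hX, hY]
      simp only
      have : GG K 2 ≤ C ^ n := (H3 K).trans (pow_le_pow_left₀ (by linarith) (by linarith) _)
      have : D ^ (2:ℝ) ≤ D ^ (30:ℝ) := Real.rpow_le_rpow_of_exponent_le D1 (by norm_num)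
      gcongr
    have y3 : MB ≤ Y := by
      rw [hMB, hY]
      have : C0 ^ n ≤ C ^ n := pow_le_pow_left₀ (by linarith) (by linarith) _
      gcongr
    have Y0 : 0 < Y := by positivity
    have bI2 : ‖IG K s‖ ≤ C ^ n := bI.trans (pow_le_pow_left₀ (by linarith) (by linarith) _)
    have be : ‖Complex.exp (-((l / 2 : ℝ) : ℂ) * s)‖ ≤ Real.exp (15 * l / 2) := by
      rw [Complex.norm_exp]
      apply Real.exp_le_exp.2
      rw [← Complex.ofReal_neg, Complex.re_ofReal_mul]
      have := (abs_le.1 hsre).1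
      nlinarith
    have bF : ‖s * (s - 1) * (A s + B s) + V‖ ≤ 482 * Y := by
      have s1 : ‖s - 1‖ ≤ 16 := by
        have := norm_sub_le s 1
        rw [norm_one] at this; linarith
      calc _ ≤ ‖s * (s - 1) * (A s + B s)‖ + ‖(V:ℂ)‖ := norm_add_le _ _
        _ = ‖s‖ * ‖s - 1‖ * ‖A s + B s‖ + V := by rw [norm_mul, norm_mul, Complex.norm_real, Real.norm_of_nonneg hV]
        _ ≤ 15 * 16 * (Y + Y) + 2 * Y := by
          have : ‖A s + B s‖ ≤ Y + Y := (norm_add_le _ _).trans (by linarith)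
          have : V ≤ 2 * Y := by linarith
          gcongr
        _ = _ := by ring
    have hCn : C ^ n = Real.exp (n * Real.log C) := by
      rw [mul_comm, Real.exp_mul, Real.exp_log (by linarith), Real.rpow_natCast]
    have h482 : (482:ℝ) ≤ Real.exp 7 := by
      have e1 := Real.exp_one_gt_d9
      calc (482:ℝ) ≤ 2.7 ^ 7 := by norm_num
        _ ≤ (Real.exp 1) ^ 7 := by gcongr; linarith
        _ = Real.exp 7 := by rw [← Real.exp_nat_mul]; norm_num
    calc ‖k s‖ = ‖IG K s‖ * ‖Complex.exp (-((l / 2 : ℝ) : ℂ) * s)‖ * W⁻¹ * ‖s * (s - 1) * (A s + B s) + V‖ := by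
          rw [hk]; simp only [norm_mul, norm_inv, Complex.norm_real, Real.norm_of_nonneg hW.le]
      _ ≤ C ^ n * Real.exp (15 * l / 2) * W⁻¹ * (482 * Y) := by gcongr
      _ = 482 * (C ^ n * C ^ n * Real.exp (15 * l / 2) * D ^ (30:ℝ) * Real.exp (4 * n)) * (W⁻¹ * W) := by rw [hY]; ring
      _ = 482 * (C ^ n * C ^ n * Real.exp (15 * l / 2) * D ^ (30:ℝ) * Real.exp (4 * n)) := by rw [inv_mul_cancel₀ hW.ne', mul_one]
      _ ≤ Real.exp 7 * (Real.exp (n * Real.log C) * Real.exp (n * Real.log C) * Real.exp (15 * l / 2) * Real.exp (l / 2 * 30) * Real.exp (4 * n)) := by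
          rw [hCn, hDe, ← Real.exp_mul]
          gcongr
      _ = Real.exp (7 + (n * Real.log C + n * Real.log C + 15 * l / 2 + l / 2 * 30 + 4 * n)) := by
          simp only [Real.exp_add]
      _ ≤ _ := by
          apply Real.exp_le_exp.2
          nlinarith [mul_le_mul_of_nonneg_right hnl hlC]
end DH
end

section
open NumberField
namespace DH

theorem final : ∃ C : ℝ, 1 ≤ C ∧ ∀ (L : Type) [Field L] [NumberField L],
        1 < Module.finrank ℚ L →
        ∀ ζ : ℂ → ℂ,
          (∀ s : ℂ, s ≠ 1 → AnalyticAt ℂ ζ s) →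
          (∀ s : ℂ, 1 < s.re →
            ζ s = ∑' I : {I : Ideal (𝓞 L) // I ≠ ⊥}, (Ideal.absNorm I.1 : ℂ) ^ (-s)) →
        ∀ β₁ : ℝ, 0 < β₁ → β₁ < 1 → ζ β₁ = 0 → 
        ∀ ρ : ℂ, 0 < ρ.re → ρ.re < 1 → ζ ρ = 0 → ρ ≠ (β₁ : ℂ) → |ρ.im| ≤ 1 → ∀ J : ℕ,
        ((J : ℝ) - 3) / 4 - 220 * (C * Real.log |(NumberField.discr L : ℝ)|) ≤ 4 * (1 - β₁) * J ^ 2 * (2 - ρ.re) ^ J := by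
  obtain ⟨C, hC, H⟩ := zeta_cont
  refine ⟨C + 16, by linarith, fun L _ _ hn ζ hζa hζ β₁ hβ0 hβ1 hβ ρ hρ0 hρ1 hρ hne hρt J => ?_⟩
  obtain ⟨hl1, hnl⟩ := n_le_log L hn
  obtain ⟨k, kd, ke, kb⟩ := H L hn ζ hζa hζ
  set l := Real.log |(NumberField.discr L : ℝ)| with hl
  set g : ℂ → ℂ := fun s => if s = 1 then k 1 else (s - 1) * ζ s with hg
  have g1 : ∀ s, s ≠ 1 → g s = (s - 1) * ζ s := fun s hs => by simp [hg, hs]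
  have gev : ∀ s, s ≠ 1 → g =ᶠ[nhds s] fun s => (s - 1) * ζ s := fun s hs => by
    filter_upwards [isOpen_ne.mem_nhds hs] with z hz using g1 z hz
  have gd : Differentiable ℂ g := by
    intro s
    by_cases hs : s = 1
    · have : g =ᶠ[nhds s] fun s => k s / s := by
        have o : IsOpen {s : ℂ | |s.re| < 25 ∧ s ≠ 0} :=
          (isOpen_lt (show Continuous fun s : ℂ => |s.re| by fun_prop) continuous_const).and isOpen_ne
        filter_upwards [o.mem_nhds (show s ∈ {s : ℂ | |s.re| < 25 ∧ s ≠ 0} by rw [hs]; constructor <;> norm_num)] with z hz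
        by_cases h1 : z = 1
        · simp [hg, h1]
        · rw [g1 z h1, ke z h1 hz.1]
          have := hz.2
          field_simp
      refine DifferentiableAt.congr_of_eventuallyEq ?_ this
      have := kd s (by rw [hs]; norm_num)
      have h0 : s ≠ 0 := by rw [hs]; norm_num
      fun_prop (disch := assumption)
    · refine DifferentiableAt.congr_of_eventuallyEq ?_ (gev s hs)
      have := (hζa s hs).differentiableAt
      fun_prop
  set Λ : ℕ → ℝ := fun n => Real.log n * logCoeff L n with hΛ
  have hΛ0 : ∀ n, 0 ≤ Λ n := fun n => mul_nonneg (Real.log_natCast_nonneg n) (logCoeff_nonneg L n)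
  have hΛe : (fun n => (Λ n : ℂ)) = LSeries.logMul (fun n => (logCoeff L n : ℂ)) := by
    ext n
    simp only [hΛ, LSeries.logMul, Complex.ofReal_mul, Complex.natCast_log]
  have hab0 : LSeries.abscissaOfAbsConv (fun n => (logCoeff L n : ℂ)) ≤ 1 := by
    have := LSeries.abscissaOfAbsConv_le_of_forall_lt_LSeriesSummable (f := fun n => (logCoeff L n : ℂ)) (x := 1) fun y hy => (zeta_eq_exp L y (by simpa using hy)).1
    simpa using this
  have hab : LSeries.abscissaOfAbsConv (fun n => (Λ n : ℂ)) ≤ 1 := by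
    rw [hΛe, LSeries.abscissaOfAbsConv_logMul]; exact hab0
  have hlt : ∀ s : ℂ, 1 < s.re → LSeries.abscissaOfAbsConv (fun n => (logCoeff L n : ℂ)) < s.re := fun s hs =>
    lt_of_le_of_lt hab0 (by exact_mod_cast hs)
  have ne1 : ∀ s : ℂ, 1 < s.re → s ≠ 1 := fun s hs h => by rw [h] at hs; simp at hs
  have hexp : ∀ s : ℂ, 1 < s.re → ζ s = Complex.exp (LSeries (fun n => (logCoeff L n : ℂ)) s) := fun s hs => by
    rw [hζ s hs, (zeta_eq_exp L s hs).2]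
  have hlog : ∀ s : ℂ, 1 < s.re → deriv g s / g s = (s - 1)⁻¹ - LSeries (fun n => (Λ n : ℂ)) s := by
    intro s hs
    have ev : g =ᶠ[nhds s] fun s => (s - 1) * Complex.exp (LSeries (fun n => (logCoeff L n : ℂ)) s) := by
      have o : IsOpen {s : ℂ | 1 < s.re} := isOpen_lt continuous_const (by fun_prop)
      filter_upwards [o.mem_nhds hs] with z hz
      rw [g1 z (ne1 z hz), hexp z hz]
    have d := ((hasDerivAt_id s).sub_const 1).mul (LSeries_hasDerivAt (hlt s hs)).cexp
    rw [ev.deriv_eq, ev.eq_of_nhds]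
    have d' := d.deriv
    simp only [id] at d'
    have e : (fun s => (s - 1) * Complex.exp (LSeries (fun n => (logCoeff L n : ℂ)) s)) = ((fun x => id x - 1) * fun x => Complex.exp (LSeries (fun n => (logCoeff L n : ℂ)) x)) := rfl
    rw [e, d.deriv, hΛe]
    have s1 : s - 1 ≠ 0 := sub_ne_zero.2 (ne1 s hs)
    have x0 := Complex.exp_ne_zero (LSeries (fun n => (logCoeff L n : ℂ)) s)
    simp only [id]
    field_simp
    ring
  have hc : ∀ t : ℝ, Real.exp (-(16 * l)) ≤ ‖g (2 + t * Complex.I)‖ := by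
    intro t
    have hre : (1:ℝ) < (2 + t * Complex.I : ℂ).re := by simp
    rw [g1 _ (ne1 _ hre), norm_mul, hζ _ hre]
    have a := zeta_lower L t
    have b : 1 ≤ ‖(2 + t * Complex.I : ℂ) - 1‖ := by
      refine le_trans ?_ (Complex.abs_re_le_norm _)
      simp; norm_num
    have c : Real.exp (-(16 * l)) ≤ Real.exp (-(4 * Module.finrank ℚ L)) := Real.exp_le_exp.2 (by linarith)
    have := Real.exp_pos (-(16 * l))
    nlinarith
  refine abstract_DH g gd Λ hΛ0 hab hlog ((C + 16) * l) (by nlinarith) ?_ ?_ β₁ hβ0 hβ1 ?_ ρ hρ0 hρ1 ?_ hne hρt J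
  · intro t _ h
    have := hc t
    rw [h, norm_zero] at this
    exact absurd this (not_le.2 (Real.exp_pos _))
  · intro t ht s hs
    have hcn : ‖(2 + t * Complex.I : ℂ)‖ ≤ 3 := by
      refine (norm_add_le _ _).trans ?_
      rw [norm_mul, Complex.norm_I, Complex.norm_real, Real.norm_eq_abs]
      norm_num
      linarith
    have u : ‖s‖ ≤ 15 := by
      have := norm_add_le (s - (2 + t * Complex.I)) (2 + t * Complex.I)
      rw [sub_add_cancel] at this; linarith
    have v : 9 ≤ ‖s‖ := by
      have := norm_sub_le s (2 + t * Complex.I)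
      linarith
    have hs1 : s ≠ 1 := fun h => by rw [h, norm_one] at v; norm_num at v
    have K := ke s hs1 (by linarith [Complex.abs_re_le_norm s])
    have e : k s = s * g s := by rw [K, g1 s hs1]; ring
    have w := kb s u
    rw [e, norm_mul] at w
    have : ‖g s‖ ≤ Real.exp (C * l) := by nlinarith [norm_nonneg (g s)]
    refine this.trans ?_
    calc Real.exp (C * l) = Real.exp ((C + 16) * l) * Real.exp (-(16 * l)) := by rw [← Real.exp_add]; ring_nf
      _ ≤ _ := by gcongr; exact hc t
  · rw [g1 _ (by norm_cast; linarith), hβ, mul_zero]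
  · rw [g1 _ (fun h => by rw [h] at hρ1; simp at hρ1), hρ, mul_zero]

end DH
end

open NumberField

/-- **Deuring–Heilbronn phenomenon for low-lying zeros (`|t| ≤ 1`).**
For every `η ∈ (0,1]` there are constants `c₁', c₂' > 0`, depending only on `η`, such
that: if `L ≠ ℚ` is a number field with Dedekind zeta function `ζ`, `β₁` is an
exceptional real zero of `ζ`, and `ρ = β' + it` is a nontrivial zero of `ζ` with
`ρ ≠ β₁` and `|t| ≤ 1`, then either `β' ≤ 1 - η` or
`β' ≤ 1 - c₂' · log(c₁' / ((1-β₁)·log d_L)) / log d_L`. -/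
theorem deuring_heilbronn_low_lying (η : ℝ) (hη0 : 0 < η) (hη1 : η ≤ 1) :
    ∃ c₁' : ℝ, 0 < c₁' ∧ ∃ c₂' : ℝ, 0 < c₂' ∧
      ∀ (L : Type) [Field L] [NumberField L],
        1 < Module.finrank ℚ L →
        ∀ ζ : ℂ → ℂ,
          (∀ s : ℂ, s ≠ 1 → AnalyticAt ℂ ζ s) →
          (∀ s : ℂ, 1 < s.re →
            ζ s = ∑' I : {I : Ideal (𝓞 L) // I ≠ ⊥}, (Ideal.absNorm I.1 : ℂ) ^ (-s)) →
        ∀ β₁ : ℝ, (0 < β₁ ∧ β₁ < 1 ∧ ζ β₁ = 0 ∧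
            1 - 1 / (29.57 * (Real.log |(NumberField.discr L : ℝ)| +
              (Module.finrank ℚ L : ℝ) * Real.log 2)) ≤ β₁) →
        ∀ ρ : ℂ, (0 < ρ.re ∧ ρ.re < 1 ∧ ζ ρ = 0 ∧ ρ ≠ (β₁ : ℂ) ∧ |ρ.im| ≤ 1) →
          ρ.re ≤ 1 - η ∨
          ρ.re ≤ 1 - c₂' *
            Real.log (c₁' / ((1 - β₁) * Real.log |(NumberField.discr L : ℝ)|)) /
            Real.log |(NumberField.discr L : ℝ)| := by
  obtain ⟨C, hC, H⟩ := DH.final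
  obtain ⟨c₁, h₁, c₂, h₂, N⟩ := DH.numeric_DH C hC
  refine ⟨c₁, h₁, c₂, h₂, fun L _ _ hn ζ hζa hζ β₁ hβ ρ hρ => Or.inr ?_⟩
  obtain ⟨b0, b1, b2, -⟩ := hβ
  obtain ⟨r0, r1, r2, r3, r4⟩ := hρ
  have := N (Real.log |(NumberField.discr L : ℝ)|) (1 - β₁) (1 - ρ.re) (DH.n_le_log L hn).1 (by linarith) (by linarith) (fun J => by
    have h := H L hn ζ hζa hζ β₁ b0 b1 b2 ρ r0 r1 r2 r3 r4 J
    rwa [show 1 + (1 - ρ.re) = 2 - ρ.re by ring])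
  linarith
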